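/- Assume d ≥ 2, k ∈ {1,…,d−1}, 2 < p < 2_s^⋆, and let (g_ε) be (s,γ)-admissible for some s > d/(d+1) and γ > 1. Let (δ_ε)_{ε>0} be positive numbers with δ_ε → 0 as ε → 0⁺. For each ε ∈ (0,1) let u_ε ∈ H^s_k be nonzero with q_ε(u_ε)/‖u_ε‖_{L^p}² = R^k_ε(p), and decompose u_ε = v_ε + w_ε where v̂_ε = 1_{A_{ε,δ_ε}} û_ε and ŵ_ε = (1 − 1_{A_{ε,δ_ε}}) û_ε. Then, as ε → 0⁺, ‖w_ε‖_{L^p}/‖v_ε‖_{L^p} → 0 and q_ε(w_ε)/q_ε(v_ε) → 0 (in particular v_ε ≠ 0 for all sufficiently small ε). -/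

import Mathlib

open MeasureTheory Real Filter
open scoped ENNReal FourierTransform RealInnerProductSpace Topology

noncomputable section

/-- Euclidean space `ℝ^d`. -/
abbrev Rd (d : ℕ) : Type := EuclideanSpace ℝ (Fin d)

/-- `U` is the (distributional, hence `L²`-) Fourier transform of `u`:
it pairs against Schwartz functions the way the Fourier transform of `u` must. -/
def IsFT {d : ℕ} (U u : Rd d → ℂ) : Prop :=
  ∀ φ : SchwartzMap (Rd d) ℂ, ∫ ξ, U ξ * φ ξ = ∫ x, u x * 𝓕 (⇑φ) x

/-- An element of `H^s(ℝ^d)`: an `L²` function `toFun` together with its Fourier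
transform `ft`, satisfying the `H^s` integrability condition. -/
structure HsFn (d : ℕ) (s : ℝ) where
  toFun : Rd d → ℂ
  ft : Rd d → ℂ
  memL2 : MemLp toFun 2 volume
  ft_memL2 : MemLp ft 2 volume
  isFT : IsFT ft toFun
  memHs : Integrable (fun ξ : Rd d => ‖ft ξ‖ ^ 2 * (1 + ‖ξ‖ ^ 2) ^ s) volume

/-- The quadratic form `q_ε(u) = ∫ |û(ξ)|² g(|ξ|) dξ` (for a fixed symbol `g`). -/
def qeps {d : ℕ} {s : ℝ} (g : ℝ → ℝ) (u : HsFn d s) : ℝ :=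
  ∫ ξ : Rd d, ‖u.ft ξ‖ ^ 2 * g ‖ξ‖

/-- The `L^p` norm (as a real number). -/
def LpN {d : ℕ} (p : ℝ) (f : Rd d → ℂ) : ℝ :=
  (eLpNorm f (ENNReal.ofReal p) volume).toReal

/-- The set of values of the Rayleigh quotient `q_ε(u)/‖u‖_p²` over nonzero
`u ∈ H^s` satisfying the symmetry constraint `P`. -/
def RayleighSet (d : ℕ) (s p : ℝ) (g : ℝ → ℝ) (P : (Rd d → ℂ) → Prop) : Set ℝ :=
  {t | ∃ u : HsFn d s, P u.toFun ∧ ¬ u.toFun =ᵐ[volume] (fun _ => (0 : ℂ)) ∧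
      MemLp u.toFun (ENNReal.ofReal p) volume ∧
      t = qeps g u / LpN p u.toFun ^ 2}

/-- The Rayleigh quotient infimum. -/
def Rayleigh (d : ℕ) (s p : ℝ) (g : ℝ → ℝ) (P : (Rd d → ℂ) → Prop) : ℝ :=
  sInf (RayleighSet d s p g P)

/-- The Rayleigh quotient infimum is attained. -/
def Attained (d : ℕ) (s p : ℝ) (g : ℝ → ℝ) (P : (Rd d → ℂ) → Prop) : Prop :=
  ∃ u : HsFn d s, P u.toFun ∧ ¬ u.toFun =ᵐ[volume] (fun _ => (0 : ℂ)) ∧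
      MemLp u.toFun (ENNReal.ofReal p) volume ∧
      qeps g u / LpN p u.toFun ^ 2 = Rayleigh d s p g P

/-- A radial function. -/
def Radial {d : ℕ} (f : Rd d → ℂ) : Prop := ∀ x y : Rd d, ‖x‖ = ‖y‖ → f x = f y

/-- The squared norm of the first block of coordinates (the first `d - k` ones),
under the identification `ℝ^d = ℝ^{d-k} × ℝ^k`. -/
def blockSq (d k : ℕ) (x : Rd d) : ℝ := ∑ i : Fin d, if (i : ℕ) < d - k then x i ^ 2 else 0

/-- A `G_k = O(d-k) × O(k)`-symmetric function: it depends only on the norms of the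
two blocks of coordinates. -/
def GkSymmetric (d k : ℕ) (f : Rd d → ℂ) : Prop :=
  ∀ x y : Rd d, blockSq d k x = blockSq d k y → ‖x‖ = ‖y‖ → f x = f y

/-- An `(s,γ)`-admissible family of symbols, with admissibility constants `c, C`. -/
def IsAdmissible (s γ c C : ℝ) (g : ℝ → ℝ → ℝ) : Prop :=
  (∀ ε ∈ Set.Ioo (0:ℝ) 1, Measurable (g ε)) ∧
  (∀ ε ∈ Set.Ioo (0:ℝ) 1, ∀ r : ℝ, 0 < g ε r) ∧
  (∀ ε ∈ Set.Ioo (0:ℝ) 1, ∀ r : ℝ, 1/2 ≤ |r - 1| →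
      c * (1 + |r| ^ (2*s)) ≤ g ε r ∧ g ε r ≤ C * (1 + |r| ^ (2*s))) ∧
  (∀ ε ∈ Set.Ioo (0:ℝ) 1, ∀ r : ℝ, |r - 1| ≤ 1/2 →
      c * (ε + |r - 1| ^ γ) ≤ g ε r ∧ g ε r ≤ C * (ε + |r - 1| ^ γ))

/-- The `G_k`-symmetric Stein–Tomas exponent `2_⋆^k`. -/
def twoStarK (d k : ℕ) : ℝ :=
  2 * ((d : ℝ) + (min k (d - k) : ℕ)) / ((d : ℝ) - 2 + (min k (d - k) : ℕ))

/-- The interpolation parameter `α_k`. -/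
def alphaK (d k : ℕ) (p : ℝ) : ℝ := (1/2 - 1/p) / (1/2 - 1/twoStarK d k)

/-- The spherical shell `A_{ε,δ}` around the unit sphere (with `I_{ε,δ}` scale `ε^{1/γ}`). -/
def Aset (d : ℕ) (γ ε δ : ℝ) : Set (Rd d) :=
  {ξ | δ * ε ^ (1/γ) ≤ |‖ξ‖ - 1| ∧ |‖ξ‖ - 1| ≤ δ⁻¹ * ε ^ (1/γ)}


section
variable {d : ℕ}

lemma ae_zero_of_schwartz {f : Rd d → ℂ} (hf : LocallyIntegrable f volume)
    (h : ∀ φ : SchwartzMap (Rd d) ℂ, ∫ x, f x * φ x = 0) : f =ᵐ[volume] fun _ => 0 := by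
  apply ae_eq_zero_of_integral_contDiff_smul_eq_zero hf
  intro g hg hgc
  have h1 : HasCompactSupport (fun x => (g x : ℂ)) := hgc.comp_left (g := fun r : ℝ => (r : ℂ)) (by simp)
  have h2 : ContDiff ℝ ((⊤ : ℕ∞) : WithTop ℕ∞) (fun x => (g x : ℂ)) :=
    Complex.ofRealCLM.contDiff.comp hg
  have h3 := h (h1.toSchwartzMap h2)
  rw [← h3]
  congr 1; ext x
  change g x • f x = f x * (g x : ℂ)
  rw [Complex.real_smul, mul_comm]

lemma memL2_li {f : Rd d → ℂ} (hf : MemLp f 2 volume) : LocallyIntegrable f volume :=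
  hf.locallyIntegrable (by norm_num)

lemma int_mul_schwartz {f : Rd d → ℂ} (hf : MemLp f 2 volume) (φ : SchwartzMap (Rd d) ℂ) :
    Integrable (fun x => f x * φ x) volume :=
  hf.integrable_mul (φ.memLp 2 volume)

lemma int_mul_schwartz1 {f : Rd d → ℂ} (hf : Integrable f volume) (φ : SchwartzMap (Rd d) ℂ) :
    Integrable (fun x => f x * φ x) volume := by
  have := hf.bdd_mul (c := (SchwartzMap.seminorm ℝ 0 0) φ) (f := fun x => φ x) φ.continuous.aestronglyMeasurable
    (Eventually.of_forall fun x => SchwartzMap.norm_le_seminorm ℝ φ x)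
  refine this.congr (Eventually.of_forall fun x => ?_)
  simp [mul_comm]

lemma isFT_unique_left {U U' u : Rd d → ℂ} (h : IsFT U u) (h' : IsFT U' u)
    (hU : MemLp U 2 volume) (hU' : Integrable U' volume ∨ MemLp U' 2 volume) : U =ᵐ[volume] U' := by
  have hli : LocallyIntegrable U' volume := hU'.elim (fun h => h.locallyIntegrable) memL2_li
  have := ae_zero_of_schwartz (f := fun x => U x - U' x) ((memL2_li hU).sub hli) (by
    intro φ
    have e : ∀ x, (U x - U' x) * φ x = U x * φ x - U' x * φ x := fun x => by ring
    simp_rw [e]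
    rw [integral_sub (int_mul_schwartz hU φ)
      (hU'.elim (fun h => int_mul_schwartz1 h φ) (fun h => int_mul_schwartz h φ)), h φ, h' φ, sub_self])
  filter_upwards [this] with x hx
  exact sub_eq_zero.1 hx

/-- Bounded integrability, general case. -/
lemma isFT_unique_left' {U U' u : Rd d → ℂ} (h : IsFT U u) (h' : IsFT U' u)
    (hU : MemLp U 2 volume) (hU' : LocallyIntegrable U' volume)
    (hi : ∀ φ : SchwartzMap (Rd d) ℂ, Integrable (fun x => U' x * φ x) volume) : U =ᵐ[volume] U' := by
  have := ae_zero_of_schwartz (f := fun x => U x - U' x) ((memL2_li hU).sub hU') (by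
    intro φ
    have e : ∀ x, (U x - U' x) * φ x = U x * φ x - U' x * φ x := fun x => by ring
    simp_rw [e]
    rw [integral_sub (int_mul_schwartz hU φ) (hi φ), h φ, h' φ, sub_self])
  filter_upwards [this] with x hx
  exact sub_eq_zero.1 hx

lemma isFT_unique_right {U u u' : Rd d → ℂ} (h : IsFT U u) (h' : IsFT U u')
    (hu : MemLp u 2 volume) (hu' : LocallyIntegrable u' volume)
    (hi : ∀ φ : SchwartzMap (Rd d) ℂ, Integrable (fun x => u' x * φ x) volume) : u =ᵐ[volume] u' := by
  have := ae_zero_of_schwartz (f := fun x => u x - u' x) ((memL2_li hu).sub hu') (by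
    intro φ
    have e : ∀ x, (u x - u' x) * φ x = u x * φ x - u' x * φ x := fun x => by ring
    simp_rw [e]
    rw [integral_sub (int_mul_schwartz hu φ) (hi φ), sub_eq_zero]
    have h1 := h (𝓕⁻ φ)
    have h2 := h' (𝓕⁻ φ)
    have e2 : 𝓕 (⇑(𝓕⁻ φ : SchwartzMap (Rd d) ℂ)) = ⇑φ := by
      rw [← SchwartzMap.fourier_coe]; simp
    rw [e2] at h1 h2
    rw [← h1, ← h2])
  filter_upwards [this] with x hx
  exact sub_eq_zero.1 hx

lemma exists_FT {u : Rd d → ℂ} (hu : MemLp u 2 volume) :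
    ∃ U : Rd d → ℂ, MemLp U 2 volume ∧ IsFT U u ∧ eLpNorm U 2 volume = eLpNorm u 2 volume := by
  set f := hu.toLp u
  refine ⟨(𝓕 f : Lp (α := Rd d) ℂ 2 volume), Lp.memLp _, ?_, ?_⟩
  · intro φ
    have h := congrArg (fun T => T φ) (Lp.fourier_toTemperedDistribution_eq f)
    simp only [TemperedDistribution.fourier_apply, Lp.toTemperedDistribution_apply] at h
    have e1 : ∀ ξ, (𝓕 f : Lp (α := Rd d) ℂ 2 volume) ξ * φ ξ = φ ξ • (𝓕 f : Lp (α := Rd d) ℂ 2 volume) ξ := by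
      intro ξ; simp [mul_comm]
    simp_rw [e1]
    rw [← h]
    apply integral_congr_ae
    filter_upwards [hu.coeFn_toLp] with x hx
    rw [hx]
    simp [mul_comm, SchwartzMap.fourier_coe]
  · have h := Lp.norm_fourier_eq f
    rw [Lp.norm_def, Lp.norm_def] at h
    have h2 := (ENNReal.toReal_eq_toReal_iff' (Lp.eLpNorm_ne_top _) (Lp.eLpNorm_ne_top _)).1 h
    rw [h2]
    exact eLpNorm_congr_ae hu.coeFn_toLp

lemma exists_invFT {U : Rd d → ℂ} (hU : MemLp U 2 volume) :
    ∃ u : Rd d → ℂ, MemLp u 2 volume ∧ IsFT U u := by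
  set F := hU.toLp U
  refine ⟨(𝓕⁻ F : Lp (α := Rd d) ℂ 2 volume), Lp.memLp _, ?_⟩
  intro φ
  have h := congrArg (fun T => T φ) (Lp.fourier_toTemperedDistribution_eq (𝓕⁻ F : Lp (α := Rd d) ℂ 2 volume))
  simp only [TemperedDistribution.fourier_apply, Lp.toTemperedDistribution_apply,
    FourierTransform.fourier_fourierInv_eq] at h
  have e1 : ∀ ξ, (𝓕⁻ F : Lp (α := Rd d) ℂ 2 volume) ξ * 𝓕 (⇑φ) ξ = (𝓕 φ : SchwartzMap (Rd d) ℂ) ξ • (𝓕⁻ F : Lp (α := Rd d) ℂ 2 volume) ξ := by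
    intro ξ; simp [mul_comm, SchwartzMap.fourier_coe]
  simp_rw [e1]
  rw [h]
  apply integral_congr_ae
  filter_upwards [hU.coeFn_toLp] with x hx
  rw [hx]
  simp [mul_comm]

lemma isFT_plancherel {U u : Rd d → ℂ} (hU : MemLp U 2 volume) (hu : MemLp u 2 volume)
    (h : IsFT U u) : eLpNorm u 2 volume = eLpNorm U 2 volume := by
  obtain ⟨V, hV, hVu, e⟩ := exists_FT hu
  rw [← e]
  exact eLpNorm_congr_ae (isFT_unique_left hVu h hV (Or.inr hU))

lemma isFT_fourier {u : Rd d → ℂ} (hu : Integrable u volume) : IsFT (𝓕 u) u := by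
  intro φ
  have := VectorFourier.integral_fourierIntegral_smul_eq_flip (e := 𝐞) (μ := (volume : Measure (Rd d)))
    (ν := (volume : Measure (Rd d))) (L := innerₗ (Rd d)) (f := u) (g := φ) Real.continuous_fourierChar
    (by exact continuous_inner) hu φ.integrable
  simp only [smul_eq_mul, flip_innerₗ] at this
  exact this

lemma isFT_fourierInv {U : Rd d → ℂ} (hU : Integrable U volume) : IsFT U (𝓕⁻ U) := by
  intro φ
  have h1 := isFT_fourier hU (𝓕 φ)
  -- `∫ 𝓕 U ξ * 𝓕 φ ξ = ∫ U x * 𝓕 (𝓕 φ) x`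
  have e2 : ∀ x, 𝓕 (⇑(𝓕 φ : SchwartzMap (Rd d) ℂ)) x = φ (-x) := by
    intro x
    have : 𝓕⁻ (⇑(𝓕 φ : SchwartzMap (Rd d) ℂ)) (-x) = φ (-x) := by
      rw [← SchwartzMap.fourierInv_coe]; simp
    rw [← this, Real.fourierInv_eq_fourier_neg, neg_neg]
  have h3 := isFT_fourier (hU.comp_neg) (𝓕 φ)
  simp_rw [e2] at h3
  have h4 : ∫ x, U (-x) * φ (-x) = ∫ x, U x * φ x := integral_neg_eq_self (fun x => U x * φ x) volume
  rw [← h4, ← h3]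
  congr 1
  ext x
  rw [Real.fourierInv_eq_fourier_comp_neg, SchwartzMap.fourier_coe]

end

section
variable {d : ℕ}

structure Good (U : Rd d → ℂ) : Prop where
  mem : MemLp U 2 volume
  bdd : ∃ B : ℝ, ∀ ξ, B < ‖ξ‖ → U ξ = 0

lemma memLp_int_sq {f : Rd d → ℂ} (h : MemLp f 2 volume) : Integrable (fun x => ‖f x‖ ^ 2) volume := by
  simpa using h.integrable_norm_rpow (by norm_num) (by norm_num)

lemma memLp_of_int_rpow {f : Rd d → ℂ} {p : ℝ} (hp : 2 ≤ p) (hm : AEStronglyMeasurable f volume)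
    (h : Integrable (fun x => ‖f x‖ ^ p) volume) : MemLp f (ENNReal.ofReal p) volume := by
  have hp0 : (0:ℝ) ≤ p := by linarith
  refine (integrable_norm_rpow_iff hm (p := ENNReal.ofReal p) ?_ (by simp)).1 ?_
  · simp; linarith
  · simpa [ENNReal.toReal_ofReal hp0] using h

lemma LpN_rpow {f : Rd d → ℂ} {p : ℝ} (hp : 2 ≤ p) (h : MemLp f (ENNReal.ofReal p) volume) :
    LpN p f ^ p = ∫ x, ‖f x‖ ^ p := by
  have hp0 : (0:ℝ) ≤ p := by linarith
  have h1 : ENNReal.ofReal p ≠ 0 := by simp; linarith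
  have h2 := h.eLpNorm_eq_integral_rpow_norm h1 (by simp)
  rw [LpN, h2, ENNReal.toReal_ofReal (by positivity), ENNReal.toReal_ofReal hp0, 
    ← Real.rpow_mul (by positivity), inv_mul_cancel₀ (by linarith), Real.rpow_one]

lemma int_rpow_of_bdd {f : Rd d → ℂ} {p M : ℝ} (hp : 2 ≤ p) (h : MemLp f 2 volume)
    (hM : ∀ x, ‖f x‖ ≤ M) : Integrable (fun x => ‖f x‖ ^ p) volume ∧
      ∫ x, ‖f x‖ ^ p ≤ M ^ (p - 2) * ∫ x, ‖f x‖ ^ 2 := by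
  have key : ∀ x, ‖f x‖ ^ p ≤ M ^ (p-2) * ‖f x‖ ^ 2 := by
    intro x
    have : ‖f x‖ ^ p = ‖f x‖ ^ (p - 2) * ‖f x‖ ^ 2 := by
      rw [← Real.rpow_natCast, ← Real.rpow_add_of_nonneg (norm_nonneg _) (by linarith) (by norm_num)]
      congr 1; push_cast; ring
    rw [this]
    gcongr
    exact hM x
  have hi := (memLp_int_sq h).const_mul (M ^ (p-2))
  have h1 : Integrable (fun x => ‖f x‖ ^ p) volume := by
    refine hi.mono' ?_ (Eventually.of_forall fun x => ?_)
    · have := h.1.norm.aemeasurable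
      exact (this.pow_const p).aestronglyMeasurable
    · rw [Real.norm_of_nonneg (by positivity)]; exact key x
  refine ⟨h1, ?_⟩
  rw [← integral_const_mul]
  exact integral_mono h1 hi key

lemma eLpNorm_two_sq {f : Rd d → ℂ} (h : MemLp f 2 volume) :
    (eLpNorm f 2 volume).toReal ^ 2 = ∫ x, ‖f x‖ ^ 2 := by
  have h2 := h.eLpNorm_eq_integral_rpow_norm (by norm_num) (by norm_num)
  rw [h2, ENNReal.toReal_ofReal (by positivity), ← Real.rpow_natCast, ← Real.rpow_mul (by positivity)]
  simp

lemma isFT_plancherel_int {U u : Rd d → ℂ} (hU : MemLp U 2 volume) (hu : MemLp u 2 volume)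
    (h : IsFT U u) : ∫ x, ‖u x‖ ^ 2 = ∫ x, ‖U x‖ ^ 2 := by
  rw [← eLpNorm_two_sq hU, ← eLpNorm_two_sq hu, isFT_plancherel hU hu h]

namespace Good

lemma mul_cont {U : Rd d → ℂ} (h : Good U) {m : Rd d → ℂ} (hm : Continuous m) :
    Good (fun ξ => m ξ * U ξ) := by
  obtain ⟨B, hB⟩ := h.bdd
  refine ⟨?_, B, fun ξ hξ => by simp [hB ξ hξ]⟩
  obtain ⟨M, hM⟩ := (isCompact_closedBall (0 : Rd d) B).exists_bound_of_continuousOn hm.continuousOn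
  refine MemLp.of_le_mul (c := M) h.mem (hm.aestronglyMeasurable.mul h.mem.1)
    (Eventually.of_forall fun ξ => ?_)
  by_cases hξ : B < ‖ξ‖
  · simp [hB ξ hξ]
  · rw [norm_mul]
    exact mul_le_mul_of_nonneg_right (hM ξ (by simpa using hξ)) (norm_nonneg _)

lemma indicator {U : Rd d → ℂ} (h : Good U) {S : Set (Rd d)} (hS : MeasurableSet S) :
    Good (S.indicator U) := by
  obtain ⟨B, hB⟩ := h.bdd
  exact ⟨h.mem.indicator hS, B, fun ξ hξ => by simp [Set.indicator, hB ξ hξ]⟩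

lemma of_indicator {U : Rd d → ℂ} (h : MemLp U 2 volume) {S : Set (Rd d)} (hS : MeasurableSet S)
    (B : ℝ) (hB : ∀ ξ ∈ S, ‖ξ‖ ≤ B) : Good (S.indicator U) := by
  refine ⟨h.indicator hS, B, fun ξ hξ => ?_⟩
  rw [Set.indicator_of_notMem]
  intro h'
  exact absurd (hB ξ h') (not_le.2 hξ)

lemma integrable {U : Rd d → ℂ} (h : Good U) : Integrable U volume := by
  obtain ⟨B, hB⟩ := h.bdd
  have h1 : IntegrableOn U (Metric.closedBall 0 B) volume := by
    have : IsFiniteMeasure (volume.restrict (Metric.closedBall (0 : Rd d) B)) :=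
      ⟨by simpa using (isCompact_closedBall (0 : Rd d) B).measure_lt_top⟩
    exact (h.mem.restrict _).integrable (by norm_num)
  refine (integrableOn_iff_integrable_of_support_subset ?_).1 h1
  intro ξ hξ
  by_contra h'
  exact hξ (hB ξ (by simpa using h'))

lemma bound {U : Rd d → ℂ} (x : Rd d) : ‖𝓕⁻ U x‖ ≤ ∫ ξ, ‖U ξ‖ := by
  rw [Real.fourierInv_eq]
  refine (norm_integral_le_integral_norm _).trans (le_of_eq ?_)
  simp

lemma cont {U : Rd d → ℂ} (h : Good U) : Continuous (𝓕⁻ U) := by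
  exact VectorFourier.fourierIntegral_continuous Real.continuous_fourierChar
    (by simp only [LinearMap.neg_apply, innerₗ_apply_apply]; fun_prop) h.integrable

lemma invFT_int {U : Rd d → ℂ} (h : Good U) (φ : SchwartzMap (Rd d) ℂ) :
    Integrable (fun x => 𝓕⁻ U x * φ x) volume :=
  φ.integrable.bdd_mul (c := ∫ ξ, ‖U ξ‖) h.cont.aestronglyMeasurable
    (Eventually.of_forall fun x => bound x)

lemma memLp_two {U : Rd d → ℂ} (h : Good U) : MemLp (𝓕⁻ U) 2 volume := by
  obtain ⟨u, hu, hUu⟩ := exists_invFT h.mem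
  exact (memLp_congr_ae (isFT_unique_right hUu (isFT_fourierInv h.integrable) hu
    h.cont.locallyIntegrable h.invFT_int)).1 hu

lemma isFT {U : Rd d → ℂ} (h : Good U) : IsFT U (𝓕⁻ U) := isFT_fourierInv h.integrable

lemma plancherel {U : Rd d → ℂ} (h : Good U) : eLpNorm (𝓕⁻ U) 2 volume = eLpNorm U 2 volume :=
  isFT_plancherel h.mem h.memLp_two h.isFT

lemma ae_eq {U u : Rd d → ℂ} (h : Good U) (hu : MemLp u 2 volume) (hUu : IsFT U u) :
    u =ᵐ[volume] 𝓕⁻ U :=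
  isFT_unique_right hUu h.isFT hu h.cont.locallyIntegrable h.invFT_int


lemma plancherel_int {U : Rd d → ℂ} (h : Good U) : ∫ x, ‖𝓕⁻ U x‖ ^ 2 = ∫ x, ‖U x‖ ^ 2 :=
  isFT_plancherel_int h.mem h.memLp_two h.isFT

lemma int_rpow {U : Rd d → ℂ} (h : Good U) {p : ℝ} (hp : 2 ≤ p) :
    Integrable (fun x => ‖𝓕⁻ U x‖ ^ p) volume :=
  (int_rpow_of_bdd hp h.memLp_two bound).1

lemma memLp {U : Rd d → ℂ} (h : Good U) {p : ℝ} (hp : 2 ≤ p) :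
    MemLp (𝓕⁻ U) (ENNReal.ofReal p) volume :=
  memLp_of_int_rpow hp h.memLp_two.1 (h.int_rpow hp)

lemma hasLineDerivAt {U : Rd d → ℂ} (h : Good U) (x v : Rd d) :
    HasLineDerivAt ℝ (𝓕⁻ U) (𝓕⁻ (fun ξ => (2 * π * ⟪ξ, v⟫ : ℝ) * Complex.I * U ξ) x) x v := by
  have hi : Integrable (fun v ↦ ‖v‖ * ‖U v‖) := by
    have := (h.mul_cont (m := fun ξ => (‖ξ‖ : ℂ)) (by fun_prop)).integrable.norm
    simpa using this
  have h1 := Real.hasFDerivAt_fourier h.integrable hi (-x)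
  have e : 𝓕⁻ U = fun y => 𝓕 U (-y) := by
    ext y; rw [Real.fourierInv_eq_fourier_neg]
  have h2 : HasFDerivAt (𝓕⁻ U) ((𝓕 (VectorFourier.fourierSMulRight (innerSL ℝ) U) (-x)).comp
      (-ContinuousLinearMap.id ℝ (Rd d))) x := by
    rw [e]
    exact h1.comp x (hasFDerivAt_id x).neg
  have h3 := h2.hasLineDerivAt v
  have hm : Integrable (VectorFourier.fourierSMulRight (innerSL ℝ) U) volume := by
    refine (hi.const_mul (2 * π * ‖innerSL ℝ (E := Rd d)‖)).mono' h.integrable.1.fourierSMulRight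
      (Eventually.of_forall fun ξ => ?_)
    refine (VectorFourier.norm_fourierSMulRight_le _ _ _).trans (le_of_eq ?_)
    ring
  have key : (𝓕⁻ (fun ξ => (2 * π * ⟪ξ, v⟫ : ℝ) * Complex.I * U ξ) x) =
      ((𝓕 (VectorFourier.fourierSMulRight (innerSL ℝ) U) (-x)).comp
      (-ContinuousLinearMap.id ℝ (Rd d))) v := by
    simp only [ContinuousLinearMap.comp_apply, neg_apply, ContinuousLinearMap.id_apply,
      map_neg]
    rw [Real.fourierInv_eq_fourier_neg, Real.fourier_continuousLinearMap_apply hm,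
      Real.fourier_eq, Real.fourier_eq, ← integral_neg]
    congr 1; ext ξ
    have e5 : innerSL ℝ ξ v = ⟪ξ, v⟫ := rfl
    simp [VectorFourier.fourierSMulRight_apply, e5]
    ring
  rw [key]
  exact h3

end Good

end

section
variable {d : ℕ}

/-- second block square -/
def blockSq2 (d k : ℕ) (x : Rd d) : ℝ := ∑ i : Fin d, if (i : ℕ) < d - k then 0 else x i ^ 2

lemma block_add (k : ℕ) (x : Rd d) : blockSq d k x + blockSq2 d k x = ‖x‖ ^ 2 := by
  rw [EuclideanSpace.norm_sq_eq, blockSq, blockSq2, ← Finset.sum_add_distrib]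
  refine Finset.sum_congr rfl fun i _ => ?_
  split_ifs <;> simp

lemma blockSq_nonneg (k : ℕ) (x : Rd d) : 0 ≤ blockSq d k x :=
  Finset.sum_nonneg fun i _ => by split_ifs <;> positivity

lemma blockSq2_nonneg (k : ℕ) (x : Rd d) : 0 ≤ blockSq2 d k x :=
  Finset.sum_nonneg fun i _ => by split_ifs <;> positivity

def IsG (d k : ℕ) (A : Rd d ≃ₗᵢ[ℝ] Rd d) : Prop := ∀ x, blockSq d k (A x) = blockSq d k x

def proj1 (d k : ℕ) (x : Rd d) : Rd d := WithLp.toLp 2 fun i => if (i : ℕ) < d - k then x i else 0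
def proj2 (d k : ℕ) (x : Rd d) : Rd d := WithLp.toLp 2 fun i => if (i : ℕ) < d - k then 0 else x i

@[simp] lemma proj1_apply (k : ℕ) (x : Rd d) (i : Fin d) :
    proj1 d k x i = if (i : ℕ) < d - k then x i else 0 := rfl
@[simp] lemma proj2_apply (k : ℕ) (x : Rd d) (i : Fin d) :
    proj2 d k x i = if (i : ℕ) < d - k then 0 else x i := rfl

lemma proj_add (k : ℕ) (x : Rd d) : proj1 d k x + proj2 d k x = x := by
  ext i; simp; split_ifs <;> simp

lemma norm_proj1 (k : ℕ) (x : Rd d) : ‖proj1 d k x‖ ^ 2 = blockSq d k x := by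
  rw [EuclideanSpace.norm_sq_eq, blockSq]
  refine Finset.sum_congr rfl fun i _ => ?_
  simp

lemma norm_proj2 (k : ℕ) (x : Rd d) : ‖proj2 d k x‖ ^ 2 = blockSq2 d k x := by
  rw [EuclideanSpace.norm_sq_eq, blockSq2]
  refine Finset.sum_congr rfl fun i _ => ?_
  simp

lemma refl_apply (v x : Rd d) : ∃ c : ℝ, Submodule.reflection (ℝ ∙ v)ᗮ x = x - c • v := by
  rw [Submodule.reflection_orthogonal_apply, Submodule.reflection_singleton_apply]
  refine ⟨2 * (⟪v, x⟫ / ‖v‖ ^ 2), ?_⟩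
  simp [mul_smul, two_smul]

lemma isG_refl1 (k : ℕ) (v : Rd d) (hv : ∀ i : Fin d, ¬ (i : ℕ) < d - k → v i = 0) :
    IsG d k (Submodule.reflection (ℝ ∙ v)ᗮ) := by
  intro x
  have h1 := block_add k x
  have h2 := block_add k (Submodule.reflection (ℝ ∙ v)ᗮ x)
  rw [LinearIsometryEquiv.norm_map] at h2
  have h3 : blockSq2 d k (Submodule.reflection (ℝ ∙ v)ᗮ x) = blockSq2 d k x := by
    obtain ⟨c, hc⟩ := refl_apply v x
    rw [hc]
    refine Finset.sum_congr rfl fun i _ => ?_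
    split_ifs with h
    · rfl
    · simp [hv i h]
  linarith

lemma isG_refl2 (k : ℕ) (v : Rd d) (hv : ∀ i : Fin d, (i : ℕ) < d - k → v i = 0) :
    IsG d k (Submodule.reflection (ℝ ∙ v)ᗮ) := by
  intro x
  obtain ⟨c, hc⟩ := refl_apply v x
  rw [hc]
  refine Finset.sum_congr rfl fun i _ => ?_
  split_ifs with h
  · simp [hv i h]
  · rfl

lemma inner_zero_of_blocks (k : ℕ) (v w : Rd d) (hv : ∀ i : Fin d, (i : ℕ) < d - k → v i = 0)
    (hw : ∀ i : Fin d, ¬ (i : ℕ) < d - k → w i = 0) : ⟪v, w⟫ = 0 := by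
  rw [PiLp.inner_apply]
  refine Finset.sum_eq_zero fun i _ => ?_
  by_cases h : (i : ℕ) < d - k
  · simp [hv i h]
  · simp [hw i h]

lemma refl_fix (v x : Rd d) (h : ⟪v, x⟫ = 0) : Submodule.reflection (ℝ ∙ v)ᗮ x = x := by
  rw [Submodule.reflection_orthogonal_apply, Submodule.reflection_singleton_apply]
  simp [h]

lemma exists_G (k : ℕ) (x y : Rd d) (h1 : blockSq d k x = blockSq d k y) (h2 : ‖x‖ = ‖y‖) :
    ∃ A, IsG d k A ∧ A x = y := by
  have n1 : ‖proj1 d k x‖ = ‖proj1 d k y‖ := by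
    rw [← sq_eq_sq₀ (norm_nonneg _) (norm_nonneg _), norm_proj1, norm_proj1, h1]
  have n2 : ‖proj2 d k x‖ = ‖proj2 d k y‖ := by
    rw [← sq_eq_sq₀ (norm_nonneg _) (norm_nonneg _), norm_proj2, norm_proj2]
    have := block_add k x
    have := block_add k y
    rw [← h2] at this
    linarith
  set v1 := proj1 d k x - proj1 d k y with hv1
  set v2 := proj2 d k x - proj2 d k y with hv2
  have hb1 : ∀ i : Fin d, ¬ (i : ℕ) < d - k → v1 i = 0 := by
    intro i hi; simp [hv1, hi]
  have hb2 : ∀ i : Fin d, (i : ℕ) < d - k → v2 i = 0 := by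
    intro i hi; simp [hv2, hi]
  have hG1 := isG_refl1 k v1 hb1
  have hG2 := isG_refl2 k v2 hb2
  refine ⟨(Submodule.reflection (ℝ ∙ v1)ᗮ).trans (Submodule.reflection (ℝ ∙ v2)ᗮ), ?_, ?_⟩
  · intro z
    rw [LinearIsometryEquiv.trans_apply, hG2, hG1]
  · rw [LinearIsometryEquiv.trans_apply, ← proj_add k x, map_add, map_add]
    rw [hv1, Submodule.reflection_sub n1, ← hv1, refl_fix v1 (proj2 d k x), refl_fix v2 (proj1 d k y),
      hv2, Submodule.reflection_sub n2, proj_add]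
    · refine inner_zero_of_blocks k _ _ hb2 (fun i hi => by simp [hi])
    · rw [real_inner_comm]
      refine inner_zero_of_blocks k _ _ (fun i hi => by simp [hi]) hb1

lemma symm_iff (k : ℕ) (f : Rd d → ℂ) : GkSymmetric d k f ↔ ∀ A, IsG d k A → ∀ x, f (A x) = f x := by
  constructor
  · intro h A hA x
    exact h _ _ (hA x) (by simp)
  · intro h x y h1 h2
    obtain ⟨A, hA, rfl⟩ := exists_G k x y h1 h2
    exact (h A hA x).symm

lemma IsG.symm {k : ℕ} {A : Rd d ≃ₗᵢ[ℝ] Rd d} (h : IsG d k A) : IsG d k A.symm := by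
  intro x
  have := h (A.symm x)
  simpa using this.symm

/-- Fourier transforms of invariant functions are invariant. -/
lemma FT_inv {U u : Rd d → ℂ} (hU : MemLp U 2 volume) (h : IsFT U u) (A : Rd d ≃ₗᵢ[ℝ] Rd d)
    (hu : ∀ x, u (A x) = u x) : (fun ξ => U (A ξ)) =ᵐ[volume] U := by
  have hmp := A.measurePreserving
  have hU' : MemLp (fun ξ => U (A ξ)) 2 volume := hU.comp_measurePreserving hmp
  refine isFT_unique_left (u := u) ?_ h hU' (Or.inr hU)
  intro φ
  set ψ := SchwartzMap.compCLMOfContinuousLinearEquiv ℂ A.symm.toContinuousLinearEquiv φ with hψ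
  have e1 : ∀ x, ψ x = φ (A.symm x) := fun x => rfl
  have h1 := h ψ
  have h2 : ∫ ξ, U ξ * ψ ξ = ∫ ξ, U (A ξ) * φ ξ := by
    rw [← hmp.integral_comp A.toHomeomorph.measurableEmbedding (fun ξ => U ξ * ψ ξ)]
    simp [e1]
  have h3 : ∫ x, u x * 𝓕 (⇑ψ) x = ∫ x, u x * 𝓕 (⇑φ) x := by
    rw [← hmp.integral_comp A.toHomeomorph.measurableEmbedding (fun ξ => u ξ * 𝓕 (⇑ψ) ξ)]
    congr 1; ext x
    rw [hu]
    have : (⇑ψ) = (⇑φ) ∘ A.symm := by ext; simp [e1]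
    rw [this, Real.fourier_comp_linearIsometry]
    simp
  rw [← h2, h1, h3]

lemma invFT_symm {U : Rd d → ℂ} (A : Rd d ≃ₗᵢ[ℝ] Rd d)
    (hu : (fun ξ => U (A ξ)) =ᵐ[volume] U) (x : Rd d) : 𝓕⁻ U (A x) = 𝓕⁻ U x := by
  have h1 : 𝓕⁻ (U ∘ A) x = 𝓕⁻ U (A x) := Real.fourierInv_comp_linearIsometry A U x
  rw [← h1]
  exact Real.fourierInv_congr_ae hu x

/-- a.e. invariance -/
def AEInv (k : ℕ) (U : Rd d → ℂ) : Prop := ∀ A, IsG d k A → (fun ξ => U (A ξ)) =ᵐ[volume] U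

lemma AEInv.symm_inv {k : ℕ} {U : Rd d → ℂ} (h : AEInv k U) : GkSymmetric d k (𝓕⁻ U) :=
  (symm_iff k _).2 fun A hA x => invFT_symm A (h A hA) x

lemma aeInv_of_symm {k : ℕ} {U u : Rd d → ℂ} (hU : MemLp U 2 volume) (h : IsFT U u)
    (hu : GkSymmetric d k u) : AEInv k U := fun A hA =>
  FT_inv hU h A ((symm_iff k u).1 hu A hA)

lemma AEInv.congr {k : ℕ} {U V : Rd d → ℂ} (h : AEInv k U) (hUV : U =ᵐ[volume] V) : AEInv k V := by
  intro A hA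
  have h1 := A.measurePreserving.quasiMeasurePreserving.ae_eq_comp hUV
  filter_upwards [h A hA, hUV, h1] with x h1 h2 h3
  simp only [Function.comp_apply] at h3
  rw [← h3, h1, h2]

lemma AEInv.mul_rad {k : ℕ} {U : Rd d → ℂ} (h : AEInv k U) (m : ℝ → ℂ) :
    AEInv k (fun ξ => m ‖ξ‖ * U ξ) := by
  intro A hA
  filter_upwards [h A hA] with x h1
  simp [h1]

lemma AEInv.indicator {k : ℕ} {U : Rd d → ℂ} (h : AEInv k U) (S : Set ℝ) :
    AEInv k ({ξ : Rd d | ‖ξ‖ ∈ S}.indicator U) := by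
  intro A hA
  filter_upwards [h A hA] with x h1
  have : ‖A x‖ = ‖x‖ := A.norm_map x
  by_cases hx : ‖x‖ ∈ S
  · have hx' : ‖A x‖ ∈ S := this ▸ hx
    rw [Set.indicator_of_mem (by exact hx'), Set.indicator_of_mem (by exact hx), h1]
  · have hx' : ¬ ‖A x‖ ∈ S := this ▸ hx
    rw [Set.indicator_of_notMem (by exact hx'), Set.indicator_of_notMem (by exact hx)]

end

section
variable {d : ℕ}

structure SymB (s C' : ℝ) (g : ℝ → ℝ) : Prop where
  meas : Measurable g
  pos : ∀ r, 0 < g r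
  up : ∀ r, g r ≤ C' * (1 + r ^ 2) ^ s

lemma symB_of_admissible {s γ c C : ℝ} {g : ℝ → ℝ → ℝ} (hs : 0 < s) (hγ : 1 < γ) (hc : 0 < c) (hcC : c ≤ C)
    (hg : IsAdmissible s γ c C g) {ε : ℝ} (hε : ε ∈ Set.Ioo (0:ℝ) 1) : SymB s (2 * C) (g ε) := by
  obtain ⟨h1, h2, h3, h4⟩ := hg
  refine ⟨h1 ε hε, h2 ε hε, fun r => ?_⟩
  have hC : 0 < C := by linarith
  have hb : (1:ℝ) ≤ (1 + r ^ 2) ^ s := Real.one_le_rpow (by nlinarith [sq_nonneg r]) hs.le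
  rcases le_total (1/2) |r - 1| with h | h
  · have h5 := (h3 ε hε r h).2
    have : |r| ^ (2 * s) ≤ (1 + r ^ 2) ^ s := by
      rw [Real.rpow_mul (abs_nonneg _)]
      refine Real.rpow_le_rpow (by positivity) ?_ hs.le
      rw [Real.rpow_two, sq_abs]; linarith
    nlinarith
  · have h5 := (h4 ε hε r h).2
    have : |r - 1| ^ γ ≤ 1 := Real.rpow_le_one (abs_nonneg _) (by linarith) (by linarith)
    have := hε.2
    nlinarith

lemma SymB.int {s C' : ℝ} {g : ℝ → ℝ} (hg : SymB s C' g) {U : Rd d → ℂ} (hm : AEStronglyMeasurable U volume)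
    (h : Integrable (fun ξ : Rd d => ‖U ξ‖ ^ 2 * (1 + ‖ξ‖ ^ 2) ^ s) volume) :
    Integrable (fun ξ : Rd d => ‖U ξ‖ ^ 2 * g ‖ξ‖) volume := by
  refine (h.const_mul C').mono' ?_ (Eventually.of_forall fun ξ => ?_)
  · exact (hm.norm.pow 2).mul (hg.meas.comp measurable_norm).aestronglyMeasurable
  · rw [Real.norm_of_nonneg (mul_nonneg (by positivity) (hg.pos _).le)]
    have := hg.up ‖ξ‖
    nlinarith [sq_nonneg ‖U ξ‖]

lemma Good.hs {U : Rd d → ℂ} (h : Good U) (s : ℝ) :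
    Integrable (fun ξ : Rd d => ‖U ξ‖ ^ 2 * (1 + ‖ξ‖ ^ 2) ^ s) volume := by
  have hc : Continuous fun ξ : Rd d => ((1 + ‖ξ‖ ^ 2) ^ (s/2) : ℝ) := by
    refine Continuous.rpow_const (by fun_prop) (fun ξ => Or.inl (by positivity))
  have := memLp_int_sq (h.mul_cont (m := fun ξ => (((1 + ‖ξ‖ ^ 2) ^ (s/2) : ℝ) : ℂ)) (by fun_prop)).mem
  refine this.congr (Eventually.of_forall fun ξ => ?_)
  simp only [norm_mul, Complex.norm_real]
  rw [Real.norm_of_nonneg (by positivity), mul_pow, mul_comm]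
  congr 1
  rw [← Real.rpow_natCast, ← Real.rpow_mul (by positivity)]
  congr 1; push_cast; ring

lemma Good.int_g {U : Rd d → ℂ} (h : Good U) {s C' : ℝ} {g : ℝ → ℝ} (hg : SymB s C' g) :
    Integrable (fun ξ : Rd d => ‖U ξ‖ ^ 2 * g ‖ξ‖) volume := hg.int h.mem.1 (h.hs s)

lemma LpN_nonneg (p : ℝ) (f : Rd d → ℂ) : 0 ≤ LpN p f := ENNReal.toReal_nonneg

lemma LpN_pos {p : ℝ} (hp : 2 ≤ p) {f : Rd d → ℂ} (h : MemLp f (ENNReal.ofReal p) volume)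
    (h0 : ¬ f =ᵐ[volume] fun _ => (0:ℂ)) : 0 < LpN p f := by
  refine ENNReal.toReal_pos ?_ h.2.ne
  intro h1
  exact h0 ((eLpNorm_eq_zero_iff h.1 (by simp; linarith)).1 h1)

lemma LpN_congr {p : ℝ} {f g : Rd d → ℂ} (h : f =ᵐ[volume] g) : LpN p f = LpN p g := by
  rw [LpN, eLpNorm_congr_ae h, LpN]

lemma rayleigh_bddBelow {s p C' : ℝ} {g : ℝ → ℝ} (hg : SymB s C' g) (P : (Rd d → ℂ) → Prop) :
    BddBelow (RayleighSet d s p g P) := by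
  refine ⟨0, ?_⟩
  rintro t ⟨u, -, -, -, rfl⟩
  refine div_nonneg (integral_nonneg fun ξ => mul_nonneg (by positivity) (hg.pos _).le) (by positivity)

lemma rayleigh_le {s p C' : ℝ} {g : ℝ → ℝ} (hg : SymB s C' g) {k : ℕ} (hp : 2 ≤ p) {u U : Rd d → ℂ}
    (hu : GkSymmetric d k u) (h2 : MemLp u 2 volume) (hup : MemLp u (ENNReal.ofReal p) volume)
    (hU : Good U) (h : IsFT U u) :
    Rayleigh d s p g (GkSymmetric d k) * LpN p u ^ 2 ≤ ∫ ξ, ‖U ξ‖ ^ 2 * g ‖ξ‖ := by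
  by_cases h0 : u =ᵐ[volume] fun _ => (0:ℂ)
  · have : LpN p u = 0 := by
      rw [LpN_congr h0, LpN]
      have : (fun _ => 0 : Rd d → ℂ) = 0 := rfl
      rw [this, eLpNorm_zero]; rfl
    rw [this]
    simp only [ne_eq, OfNat.ofNat_ne_zero, not_false_eq_true, zero_pow, mul_zero]
    exact integral_nonneg fun ξ => mul_nonneg (by positivity) (hg.pos _).le
  · have hpos := LpN_pos hp hup h0
    have : Rayleigh d s p g (GkSymmetric d k) ≤ (∫ ξ, ‖U ξ‖ ^ 2 * g ‖ξ‖) / LpN p u ^ 2 := by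
      refine csInf_le (rayleigh_bddBelow hg _) ?_
      exact ⟨⟨u, U, h2, hU.mem, h, hU.hs s⟩, hu, h0, hup, rfl⟩
    rwa [le_div_iff₀ (by positivity)] at this

lemma rayleigh_good {s p C' : ℝ} {g : ℝ → ℝ} (hg : SymB s C' g) {k : ℕ} (hp : 2 ≤ p) {U : Rd d → ℂ}
    (hU : Good U) (hi : AEInv k U) :
    Rayleigh d s p g (GkSymmetric d k) * LpN p (𝓕⁻ U) ^ 2 ≤ ∫ ξ, ‖U ξ‖ ^ 2 * g ‖ξ‖ :=
  rayleigh_le hg hp hi.symm_inv hU.memLp_two (hU.memLp hp) hU hU.isFT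

end

section
variable {d : ℕ}

def Bd (p : ℝ) (W : Rd d → ℝ) (B : ℝ) (U : Rd d → ℂ) : Prop :=
  ∀ u, MemLp u 2 volume → IsFT U u → MemLp u (ENNReal.ofReal p) volume ∧
    LpN p u ^ 2 ≤ B * ∫ ξ, ‖U ξ‖ ^ 2 * W ξ

lemma Bd.of_good {p : ℝ} (hp : 2 ≤ p) {W : Rd d → ℝ} {B : ℝ} {U : Rd d → ℂ} (hU : Good U)
    (h : LpN p (𝓕⁻ U) ^ 2 ≤ B * ∫ ξ, ‖U ξ‖ ^ 2 * W ξ) : Bd p W B U := by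
  intro u hu hUu
  have := hU.ae_eq hu hUu
  exact ⟨(memLp_congr_ae this).2 (hU.memLp hp), by rwa [LpN_congr this]⟩

lemma IsFT.congr {U V u v : Rd d → ℂ} (h : IsFT U u) (h1 : U =ᵐ[volume] V) (h2 : u =ᵐ[volume] v) :
    IsFT V v := by
  intro φ
  have e1 : ∫ ξ, V ξ * φ ξ = ∫ ξ, U ξ * φ ξ := integral_congr_ae (by
    filter_upwards [h1] with x hx; rw [hx])
  have e2 : ∫ ξ, v ξ * 𝓕 (⇑φ) ξ = ∫ ξ, u ξ * 𝓕 (⇑φ) ξ := integral_congr_ae (by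
    filter_upwards [h2] with x hx; rw [hx])
  rw [e1, e2, h φ]

lemma IsFT.sub {U V u v : Rd d → ℂ} (h : IsFT U u) (h' : IsFT V v) (hU : MemLp U 2 volume)
    (hV : MemLp V 2 volume) (hu : MemLp u 2 volume) (hv : MemLp v 2 volume) :
    IsFT (fun x => U x - V x) (fun x => u x - v x) := by
  intro φ
  simp_rw [sub_mul]
  rw [integral_sub (int_mul_schwartz hU φ) (int_mul_schwartz hV φ), h φ, h' φ, integral_sub]
  · exact int_mul_schwartz hu (𝓕 φ)
  · exact int_mul_schwartz hv (𝓕 φ)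

lemma IsFT.add {U V u v : Rd d → ℂ} (h : IsFT U u) (h' : IsFT V v) (hU : MemLp U 2 volume)
    (hV : MemLp V 2 volume) (hu : MemLp u 2 volume) (hv : MemLp v 2 volume) :
    IsFT (fun x => U x + V x) (fun x => u x + v x) := by
  intro φ
  simp_rw [add_mul]
  rw [integral_add (int_mul_schwartz hU φ) (int_mul_schwartz hV φ), h φ, h' φ, integral_add]
  · exact int_mul_schwartz hu (𝓕 φ)
  · exact int_mul_schwartz hv (𝓕 φ)

lemma isFT_zero : IsFT (fun _ => 0 : Rd d → ℂ) (fun _ => 0) := by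
  intro φ; simp

lemma isFT_unique_right2 {U u u' : Rd d → ℂ} (h : IsFT U u) (h' : IsFT U u')
    (hu : MemLp u 2 volume) (hu' : MemLp u' 2 volume) : u =ᵐ[volume] u' :=
  isFT_unique_right h h' hu (memL2_li hu') (fun φ => int_mul_schwartz hu' φ)

lemma LpN_add_le {p : ℝ} (hp : 2 ≤ p) {f g : Rd d → ℂ} (hf : MemLp f (ENNReal.ofReal p) volume)
    (hg : MemLp g (ENNReal.ofReal p) volume) : LpN p (fun x => f x + g x) ≤ LpN p f + LpN p g := by
  rw [LpN, LpN, LpN, ← ENNReal.toReal_add hf.2.ne hg.2.ne]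
  refine ENNReal.toReal_mono (ENNReal.add_ne_top.2 ⟨hf.2.ne, hg.2.ne⟩) ?_
  exact eLpNorm_add_le hf.1 hg.1 (by
    rw [← ENNReal.ofReal_one]; exact ENNReal.ofReal_le_ofReal (by linarith))

lemma cs2 {a b B1 B2 q1 q2 : ℝ} (hB1 : 0 ≤ B1) (hB2 : 0 ≤ B2) (hq1 : 0 ≤ q1)
    (hq2 : 0 ≤ q2) (h1 : a ^ 2 ≤ B1 * q1) (h2 : b ^ 2 ≤ B2 * q2) :
    (a + b) ^ 2 ≤ (B1 + B2) * (q1 + q2) := by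
  have h : (a * b) ^ 2 ≤ (B1 * q1) * (B2 * q2) := by
    rw [mul_pow]; exact mul_le_mul h1 h2 (sq_nonneg _) (by positivity)
  have h3 : 2 * (a * b) ≤ B1 * q2 + B2 * q1 := by
    have h5 : (2 * (a * b)) ^ 2 ≤ (B1 * q2 + B2 * q1) ^ 2 := by
      nlinarith [sq_nonneg (B1 * q2 - B2 * q1)]
    exact le_of_abs_le (abs_le_of_sq_le_sq h5 (by positivity))
  nlinarith

/-- Additivity over two disjoint frequency sets. -/
lemma Bd.split {p : ℝ} (hp : 2 ≤ p) {W : Rd d → ℝ} (hW : ∀ ξ, 0 ≤ W ξ) {B1 B2 : ℝ} (hB1 : 0 ≤ B1) (hB2 : 0 ≤ B2)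
    {U : Rd d → ℂ} (hU : MemLp U 2 volume) (hI : Integrable (fun ξ => ‖U ξ‖ ^ 2 * W ξ) volume)
    {S : Set (Rd d)} (hS : MeasurableSet S)
    (h1 : Bd p W B1 (S.indicator U)) (h2 : Bd p W B2 (Sᶜ.indicator U)) : Bd p W (B1 + B2) U := by
  intro u hu hUu
  obtain ⟨u1, hu1, hF1⟩ := exists_invFT (hU.indicator hS)
  obtain ⟨u2, hu2, hF2⟩ := exists_invFT (hU.indicator hS.compl)
  obtain ⟨m1, b1⟩ := h1 u1 hu1 hF1
  obtain ⟨m2, b2⟩ := h2 u2 hu2 hF2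
  have hF := hF1.add hF2 (hU.indicator hS) (hU.indicator hS.compl) hu1 hu2
  have e : (fun x => S.indicator U x + Sᶜ.indicator U x) = U := by
    ext x; exact congrFun (Set.indicator_self_add_compl S U) x
  rw [e] at hF
  have e2 := isFT_unique_right2 hUu hF hu (hu1.add hu2)
  refine ⟨(memLp_congr_ae e2).2 (m1.add m2), ?_⟩
  rw [LpN_congr e2]
  have h3 := LpN_add_le hp m1 m2
  have eq : ∫ ξ, ‖U ξ‖ ^ 2 * W ξ = (∫ ξ, ‖S.indicator U ξ‖ ^ 2 * W ξ) + ∫ ξ, ‖Sᶜ.indicator U ξ‖ ^ 2 * W ξ := by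
    have f : ∀ T : Set (Rd d), (fun ξ => ‖T.indicator U ξ‖ ^ 2 * W ξ) = T.indicator (fun ξ => ‖U ξ‖ ^ 2 * W ξ) := by
      intro T; ext ξ; by_cases h : ξ ∈ T <;> simp [h]
    rw [f, f, integral_indicator hS, integral_indicator hS.compl, integral_add_compl hS hI]
  rw [eq]
  have hn : ∀ T : Set (Rd d), 0 ≤ ∫ ξ, ‖T.indicator U ξ‖ ^ 2 * W ξ := fun T =>
    integral_nonneg fun ξ => mul_nonneg (by positivity) (hW ξ)
  calc LpN p (fun x => u1 x + u2 x) ^ 2 ≤ (LpN p u1 + LpN p u2) ^ 2 := by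
        gcongr; exact LpN_nonneg _ _
    _ ≤ _ := cs2 hB1 hB2 (hn _) (hn _) b1 b2

/-- Countable version. -/
lemma Bd.iUnion {p : ℝ} (hp : 2 ≤ p) {W : Rd d → ℝ} (hW : ∀ ξ, 0 ≤ W ξ) {B : ℕ → ℝ} (hB : ∀ n, 0 ≤ B n)
    (hBs : Summable B)
    {U : Rd d → ℂ} (hU : MemLp U 2 volume) (hI : Integrable (fun ξ => ‖U ξ‖ ^ 2 * W ξ) volume)
    {S : ℕ → Set (Rd d)} (hS : ∀ n, MeasurableSet (S n)) (hd : Pairwise (Function.onFun Disjoint S))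
    (hc : ∀ ξ, U ξ ≠ 0 → ∃ n, ξ ∈ S n)
    (h : ∀ n, Bd p W (B n) ((S n).indicator U)) : Bd p W (∑' n, B n) U := by
  intro u hu hUu
  set T : ℕ → Set (Rd d) := fun n => ⋃ j ∈ Finset.range n, S j with hT
  have hTm : ∀ n, MeasurableSet (T n) := fun n => Finset.measurableSet_biUnion _ fun j _ => hS j
  have hmemT : ∀ n ξ, ξ ∈ T n ↔ ∃ j < n, ξ ∈ S j := by
    intro n ξ; simp [hT]
  have hfin : ∀ n, Bd p W (∑ j ∈ Finset.range n, B j) ((T n).indicator U) := by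
    intro n
    induction n with
    | zero =>
      intro v hv hF
      have e0 : (T 0).indicator U = fun _ => 0 := by ext x; simp [hT]
      rw [e0] at hF
      have := isFT_unique_right2 hF isFT_zero hv MemLp.zero
      refine ⟨(memLp_congr_ae this).2 MemLp.zero, ?_⟩
      rw [LpN_congr this, LpN]
      have : (fun _ => 0 : Rd d → ℂ) = 0 := rfl
      rw [this, eLpNorm_zero]; simp
    | succ n ih =>
      rw [Finset.sum_range_succ]
      have hI' : Integrable (fun ξ => ‖(T (n+1)).indicator U ξ‖ ^ 2 * W ξ) volume := by
        refine (hI.indicator (hTm (n+1))).congr (Eventually.of_forall fun ξ => ?_)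
        by_cases h : ξ ∈ T (n+1) <;> simp [h]
      refine Bd.split hp hW (Finset.sum_nonneg fun j _ => hB j) (hB n) (hU.indicator (hTm (n+1))) hI' (hTm n) ?_ ?_
      · convert ih using 1
        rw [Set.indicator_indicator]
        congr 1
        ext ξ
        simp only [Set.mem_inter_iff, hmemT]
        exact ⟨fun h => h.1, fun ⟨j, h1, h2⟩ => ⟨⟨j, h1, h2⟩, j, by omega, h2⟩⟩
      · convert h n using 1
        rw [Set.indicator_indicator]
        congr 1
        ext ξ
        simp only [Set.mem_inter_iff, Set.mem_compl_iff, hmemT]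
        constructor
        · rintro ⟨h1, j, h2, h3⟩
          have : j = n := by
            by_contra hne
            exact h1 ⟨j, by omega, h3⟩
          exact this ▸ h3
        · intro hn
          refine ⟨?_, n, by omega, hn⟩
          rintro ⟨j, hj, hj'⟩
          exact Set.disjoint_left.1 (hd (show j ≠ n by omega)) hj' hn
  choose v hv hvF using fun n => exists_invFT (hU.indicator (hTm n))
  have hvp := fun n => hfin n (v n) (hv n) (hvF n)
  have hlim : Tendsto (fun n => eLpNorm (v n - u) 2 volume) atTop (𝓝 0) := by
    have e1 : ∀ n, eLpNorm (v n - u) 2 volume = eLpNorm ((T n).indicator U - U) 2 volume := fun n =>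
      isFT_plancherel ((hU.indicator (hTm n)).sub hU) ((hv n).sub hu)
        ((hvF n).sub hUu (hU.indicator (hTm n)) hU (hv n) hu)
    simp_rw [e1]
    have e2 : ∀ n, eLpNorm ((T n).indicator U - U) 2 volume =
        ENNReal.ofReal ((∫ ξ, ‖((T n).indicator U - U) ξ‖ ^ 2) ^ (1/2 : ℝ)) := by
      intro n
      rw [((hU.indicator (hTm n)).sub hU).eLpNorm_eq_integral_rpow_norm (by norm_num) (by norm_num)]
      simp
    simp_rw [e2]
    have e3 : Tendsto (fun n => ∫ ξ, ‖((T n).indicator U - U) ξ‖ ^ 2) atTop (𝓝 (∫ ξ : Rd d, (0:ℝ))) := by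
      refine tendsto_integral_of_dominated_convergence (fun ξ => ‖U ξ‖ ^ 2) ?_ (memLp_int_sq hU) ?_ ?_
      · intro n
        exact (((hU.indicator (hTm n)).sub hU).1.norm.pow 2)
      · intro n
        refine Eventually.of_forall fun ξ => ?_
        by_cases h : ξ ∈ T n <;> simp [h]
      · refine Eventually.of_forall fun ξ => ?_
        by_cases h0 : U ξ = 0
        · have : ∀ n, (T n).indicator U ξ = 0 := by
            intro n; by_cases h : ξ ∈ T n <;> simp [h, h0]
          simp [this, h0]
        · obtain ⟨n, hn⟩ := hc ξ h0
          refine tendsto_const_nhds.congr' ?_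
          filter_upwards [eventually_gt_atTop n] with m hm
          have : ξ ∈ T m := (hmemT m ξ).2 ⟨n, hm, hn⟩
          simp [this]
    simp only [integral_zero] at e3
    have e4 := (e3.rpow_const (p := (1/2 : ℝ)) (Or.inr (by norm_num)))
    have e5 := (ENNReal.continuous_ofReal.tendsto _).comp e4
    simpa [Function.comp_def] using e5
  have hmeas := tendstoInMeasure_of_tendsto_eLpNorm (by norm_num) (fun n => (hv n).1) hu.1 hlim
  obtain ⟨ns, hns, hae⟩ := hmeas.exists_seq_tendsto_ae
  have hfatou := Lp.eLpNorm_lim_le_liminf_eLpNorm (p := ENNReal.ofReal p) (fun n => (hv (ns n)).1) u hae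
  set Q := ∫ ξ, ‖U ξ‖ ^ 2 * W ξ
  have hQ0 : 0 ≤ Q := integral_nonneg fun ξ => mul_nonneg (by positivity) (hW ξ)
  have hT0 : 0 ≤ ∑' n, B n := tsum_nonneg hB
  have hbound : ∀ n, eLpNorm (v n) (ENNReal.ofReal p) volume ≤ ENNReal.ofReal (Real.sqrt ((∑' n, B n) * Q)) := by
    intro n
    rw [← ENNReal.ofReal_toReal (hvp n).1.2.ne]
    refine ENNReal.ofReal_le_ofReal ?_
    refine Real.le_sqrt_of_sq_le ((hvp n).2.trans ?_)
    have hs : ∑ j ∈ Finset.range n, B j ≤ ∑' n, B n := hBs.sum_le_tsum _ fun j _ => hB j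
    have hq : ∫ ξ, ‖(T n).indicator U ξ‖ ^ 2 * W ξ ≤ Q := by
      have f : (fun ξ => ‖(T n).indicator U ξ‖ ^ 2 * W ξ) = (T n).indicator (fun ξ => ‖U ξ‖ ^ 2 * W ξ) := by
        ext ξ; by_cases h : ξ ∈ T n <;> simp [h]
      rw [f, integral_indicator (hTm n)]
      exact setIntegral_le_integral hI (Eventually.of_forall fun ξ => mul_nonneg (by positivity) (hW ξ))
    have hq0 : 0 ≤ ∫ ξ, ‖(T n).indicator U ξ‖ ^ 2 * W ξ :=
      integral_nonneg fun ξ => mul_nonneg (by positivity) (hW ξ)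
    exact mul_le_mul hs hq hq0 hT0
  have hfin2 : eLpNorm u (ENNReal.ofReal p) volume ≤ ENNReal.ofReal (Real.sqrt ((∑' n, B n) * Q)) :=
    hfatou.trans (liminf_le_of_le (by isBoundedDefault) (fun b hb => by
      obtain ⟨n, hn⟩ := hb.exists
      exact hn.trans (hbound _)))
  refine ⟨⟨hu.1, hfin2.trans_lt ENNReal.ofReal_lt_top⟩, ?_⟩
  have h5 : LpN p u ≤ Real.sqrt ((∑' n, B n) * Q) := ENNReal.toReal_le_of_le_ofReal (Real.sqrt_nonneg _) hfin2
  calc LpN p u ^ 2 ≤ Real.sqrt ((∑' n, B n) * Q) ^ 2 := by gcongr; exact LpN_nonneg _ _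
    _ = _ := Real.sq_sqrt (by positivity)

end

section
variable {d : ℕ}

/-- From `P^p ≤ X^{p-2 over 2} N` to `P^2 ≤ ...`. -/
lemma interp_aux {p P X N : ℝ} (hp : 2 < p) (hP : 0 ≤ P) (hX : 0 ≤ X) (hN : 0 ≤ N)
    (h : P ^ p ≤ X ^ (p - 2) * N) : P ^ 2 ≤ (X ^ 2) ^ (1 - 2 / p) * N ^ (2 / p) := by
  have hp0 : (0:ℝ) < p := by linarith
  have h1 : (P ^ p) ^ (2 / p) ≤ (X ^ (p - 2) * N) ^ (2 / p) :=
    Real.rpow_le_rpow (by positivity) h (by positivity)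
  rw [← Real.rpow_mul hP, Real.mul_rpow (by positivity) hN, ← Real.rpow_mul hX] at h1
  have e1 : p * (2 / p) = 2 := by field_simp
  rw [e1, Real.rpow_two] at h1
  refine h1.trans (le_of_eq ?_)
  rw [← Real.rpow_two, ← Real.rpow_mul hX]
  congr 2
  field_simp

lemma cs_int_norm {V : Rd d → ℂ} (hV : MemLp V 2 volume) {T : Set (Rd d)} (hT : MeasurableSet T)
    (hf : volume T ≠ ⊤) (h0 : ∀ ξ, ξ ∉ T → V ξ = 0) :
    (∫ ξ, ‖V ξ‖) ^ 2 ≤ volume.real T * ∫ ξ, ‖V ξ‖ ^ 2 := by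
  have h1 : MemLp (T.indicator fun _ => (1:ℝ)) 2 volume := memLp_indicator_const 2 hT 1 (Or.inr hf)
  have e1 : ∫ ξ, ‖V ξ‖ = ∫ ξ, (T.indicator (fun _ => (1:ℝ)) ξ) * ‖V ξ‖ := by
    congr 1; ext ξ; by_cases h : ξ ∈ T <;> simp [h, h0 ξ]
  have h2 := integral_mul_le_Lp_mul_Lq_of_nonneg (μ := (volume : Measure (Rd d))) (p := 2) (q := 2)
    (by constructor <;> norm_num) (f := T.indicator fun _ => (1:ℝ)) (g := fun ξ => ‖V ξ‖)
    (Eventually.of_forall fun ξ => Set.indicator_nonneg (by simp) ξ)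
    (Eventually.of_forall fun ξ => norm_nonneg _) (by simpa using h1) (by simpa using hV.norm)
  rw [← e1] at h2
  have e2 : ∫ ξ, (T.indicator (fun _ => (1:ℝ)) ξ) ^ (2:ℝ) = volume.real T := by
    have : (fun ξ => (T.indicator (fun _ => (1:ℝ)) ξ) ^ (2:ℝ)) = T.indicator (fun _ => (1:ℝ)) := by
      ext ξ; by_cases h : ξ ∈ T <;> simp [h]
    rw [this, integral_indicator hT]; simp
  have e3 : ∫ ξ, ‖V ξ‖ ^ (2:ℝ) = ∫ ξ, ‖V ξ‖ ^ 2 := by simp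
  rw [e2, e3] at h2
  have hN : 0 ≤ ∫ ξ, ‖V ξ‖ ^ 2 := integral_nonneg fun _ => by positivity
  have hv : 0 ≤ volume.real T := measureReal_nonneg
  calc (∫ ξ, ‖V ξ‖) ^ 2 ≤ (volume.real T ^ (1/2:ℝ) * (∫ ξ, ‖V ξ‖ ^ 2) ^ (1/2:ℝ)) ^ 2 := by
        gcongr
    _ = _ := by
        rw [mul_pow, ← Real.sqrt_eq_rpow, ← Real.sqrt_eq_rpow, Real.sq_sqrt hv, Real.sq_sqrt hN]

lemma bernstein_ineq {p : ℝ} (hp : 2 < p) {V : Rd d → ℂ} (hV : Good V) {T : Set (Rd d)} (hT : MeasurableSet T)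
    (hf : volume T ≠ ⊤) (h0 : ∀ ξ, ξ ∉ T → V ξ = 0) :
    LpN p (𝓕⁻ V) ^ 2 ≤ (volume.real T) ^ (1 - 2 / p) * ∫ ξ, ‖V ξ‖ ^ 2 := by
  have hp0 : (0:ℝ) < p := by linarith
  have h1 := (int_rpow_of_bdd hp.le hV.memLp_two Good.bound).2
  rw [← LpN_rpow hp.le (hV.memLp hp.le), hV.plancherel_int] at h1
  have hN : 0 ≤ ∫ ξ, ‖V ξ‖ ^ 2 := integral_nonneg fun _ => by positivity
  have hX : 0 ≤ ∫ ξ, ‖V ξ‖ := integral_nonneg fun _ => norm_nonneg _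
  have h2 := interp_aux hp (LpN_nonneg _ _) hX hN h1
  have hexp : 0 ≤ 1 - 2 / p := by
    rw [sub_nonneg, div_le_one hp0]; exact hp.le
  refine h2.trans ?_
  calc _ ≤ (volume.real T * ∫ ξ, ‖V ξ‖ ^ 2) ^ (1 - 2 / p) * (∫ ξ, ‖V ξ‖ ^ 2) ^ (2 / p) := by
        gcongr
        exact cs_int_norm hV.mem hT hf h0
    _ = _ := by
        rw [Real.mul_rpow measureReal_nonneg hN, mul_assoc, ← Real.rpow_add_of_nonneg hN hexp (by positivity)]
        simp

/-- Sobolev embedding away from the sphere. -/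
lemma outer_bound {s p c : ℝ} (hd : 0 < d) (hs : 0 < s) (hp : 2 < p) (hc : 0 < c)
    (hps : s < (d : ℝ) / 2 → p < 2 * (d : ℝ) / ((d : ℝ) - 2 * s)) :
    ∃ C1 : ℝ, 0 ≤ C1 ∧ ∀ (g : ℝ → ℝ), (∀ r, 0 < g r) →
      (∀ r, 1/2 ≤ |r - 1| → c * (1 + |r| ^ (2*s)) ≤ g r) →
      ∀ U : Rd d → ℂ, MemLp U 2 volume → Integrable (fun ξ => ‖U ξ‖ ^ 2 * g ‖ξ‖) volume →
      (∀ ξ, U ξ ≠ 0 → 1/2 ≤ |‖ξ‖ - 1|) → Bd p (fun ξ => g ‖ξ‖) C1 U := by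
  have hp0 : (0:ℝ) < p := by linarith
  have hd0 : (0:ℝ) < d := by exact_mod_cast hd
  have hexp : 0 < 1 - 2 / p := by
    rw [sub_pos, div_lt_one hp0]; exact hp
  have hkey : (d:ℝ) * (1 - 2 / p) < 2 * s := by
    rcases lt_or_ge s ((d:ℝ)/2) with h | h
    · have h1 := hps h
      rw [lt_div_iff₀ (by linarith)] at h1
      rw [mul_sub, mul_one, mul_div_assoc', sub_lt_iff_lt_add, ← sub_lt_iff_lt_add', lt_div_iff₀ hp0]
      nlinarith
    · have : 0 < (d:ℝ) * (2 / p) := by positivity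
      nlinarith
  set ω := volume.real (Metric.closedBall (0 : Rd d) 1) with hω
  set x : ℝ := 2 ^ ((d:ℝ) * (1 - 2 / p) - 2 * s) with hx
  have hx0 : 0 < x := by positivity
  have hx1 : x < 1 := Real.rpow_lt_one_of_one_lt_of_neg (by norm_num) (by linarith)
  set B : ℕ → ℝ := fun j => (ω ^ (1 - 2/p) * 2 ^ (2*s) / c) * x ^ j with hB
  have hω0 : 0 ≤ ω := measureReal_nonneg
  have hB0 : ∀ j, 0 ≤ B j := fun j => by positivity
  have hBs : Summable B := (summable_geometric_of_lt_one hx0.le hx1).mul_left _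
  refine ⟨∑' j, B j, tsum_nonneg hB0, ?_⟩
  intro g hg hgl U hU hI hout
  set S : ℕ → Set (Rd d) := fun j => {ξ | ‖ξ‖ < 2 ^ j ∧ (j ≠ 0 → 2 ^ j ≤ 2 * ‖ξ‖)} with hS
  have hSm : ∀ j, MeasurableSet (S j) := by
    intro j
    by_cases hj : j = 0
    · simp only [hS, hj, ne_eq, not_true_eq_false, false_imp_iff, and_true]
      exact measurableSet_lt measurable_norm measurable_const
    · simp only [hS, hj, ne_eq, not_false_eq_true, true_imp_iff]
      exact (measurableSet_lt measurable_norm measurable_const).inter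
        (measurableSet_le measurable_const (measurable_norm.const_mul _))
  refine Bd.iUnion hp.le (fun ξ => (hg _).le) hB0 hBs hU hI hSm ?_ ?_ ?_
  · have key : ∀ i j : ℕ, i < j → Disjoint (S i) (S j) := by
      intro i j hij
      rw [Set.disjoint_left]
      rintro ξ ⟨h1, -⟩ ⟨-, h2⟩
      have h3 := h2 (by omega)
      have : (2:ℝ) ^ (i+1) ≤ 2 ^ j := pow_le_pow_right₀ (by norm_num) hij
      rw [pow_succ] at this
      linarith
    intro i j hij
    rcases lt_or_gt_of_ne hij with h | h
    · exact key i j h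
    · exact (key j i h).symm
  · intro ξ _
    have hex : ∃ n : ℕ, ‖ξ‖ < 2 ^ n := pow_unbounded_of_one_lt _ (by norm_num)
    classical
    refine ⟨Nat.find hex, Nat.find_spec hex, fun hj => ?_⟩
    have := Nat.find_min hex (m := Nat.find hex - 1) (by omega)
    rw [not_lt] at this
    have e : (2:ℝ) ^ (Nat.find hex) = 2 * 2 ^ (Nat.find hex - 1) := by
      rw [← pow_succ']; congr 1; omega
    rw [e]; linarith
  · intro j
    have hG : Good ((S j).indicator U) := Good.of_indicator hU (hSm j) (2 ^ j) fun ξ h => h.1.le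
    refine Bd.of_good hp.le hG ?_
    have hb := bernstein_ineq hp hG (T := Metric.closedBall 0 (2 ^ j)) measurableSet_closedBall
      (isCompact_closedBall _ _).measure_lt_top.ne (fun ξ hξ => by
        rw [Set.indicator_of_notMem]
        intro h
        exact hξ (by simpa using h.1.le))
    have hvol : volume.real (Metric.closedBall (0 : Rd d) (2 ^ j)) = (2 ^ j) ^ d * ω := by
      rw [hω, Measure.real, Measure.addHaar_closedBall' _ _ (by positivity), ENNReal.toReal_mul,
        ENNReal.toReal_ofReal (by positivity)]
      simp [Measure.real]
    rw [hvol] at hb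
    have hN : 0 ≤ ∫ ξ, ‖(S j).indicator U ξ‖ ^ 2 := integral_nonneg fun _ => by positivity
    have hlow : ∀ ξ, ‖(S j).indicator U ξ‖ ^ 2 * (c * (2 ^ j) ^ (2*s) / 2 ^ (2*s)) ≤ ‖(S j).indicator U ξ‖ ^ 2 * g ‖ξ‖ := by
      intro ξ
      by_cases h : ξ ∈ S j ∧ U ξ ≠ 0
      · refine mul_le_mul_of_nonneg_left ?_ (by positivity)
        refine le_trans ?_ (hgl _ (hout ξ h.2))
        rw [mul_div_assoc]
        refine mul_le_mul_of_nonneg_left ?_ hc.le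
        rw [← Real.div_rpow (by positivity) (by norm_num)]
        by_cases hj : j = 0
        · have : ((2:ℝ) ^ j / 2) ^ (2 * s) ≤ 1 := by
            refine Real.rpow_le_one (by positivity) ?_ (by positivity)
            rw [hj]; norm_num
          have : 0 ≤ |‖ξ‖| ^ (2 * s) := by positivity
          linarith
        · have h3 := h.1.2 hj
          have : ((2:ℝ) ^ j / 2) ^ (2 * s) ≤ |‖ξ‖| ^ (2 * s) := by
            refine Real.rpow_le_rpow (by positivity) ?_ (by positivity)
            rw [abs_of_nonneg (norm_nonneg _)]; linarith
          linarith
      · have : (S j).indicator U ξ = 0 := by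
          by_cases h1 : ξ ∈ S j
          · simp only [h1, true_and, not_not] at h; simp [h1, h]
          · simp [h1]
        simp [this]
    have hI' : Integrable (fun ξ => ‖(S j).indicator U ξ‖ ^ 2 * g ‖ξ‖) volume := by
      refine (hI.indicator (hSm j)).congr (Eventually.of_forall fun ξ => ?_)
      by_cases h : ξ ∈ S j <;> simp [h]
    have hint := integral_mono ((memLp_int_sq hG.mem).mul_const _) hI' hlow
    rw [integral_mul_const] at hint
    set N := ∫ ξ, ‖(S j).indicator U ξ‖ ^ 2
    set q := ∫ ξ, ‖(S j).indicator U ξ‖ ^ 2 * g ‖ξ‖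
    refine hb.trans ?_
    have hy : (0:ℝ) < c * (2 ^ j) ^ (2*s) / 2 ^ (2*s) := by positivity
    have hNq : N ≤ q / (c * (2 ^ j) ^ (2*s) / 2 ^ (2*s)) := by rwa [le_div_iff₀ hy]
    calc _ ≤ ((2 ^ j) ^ d * ω) ^ (1 - 2 / p) * (q / (c * (2 ^ j) ^ (2*s) / 2 ^ (2*s))) := by gcongr
      _ = B j * q := by
        have e1 : (((2:ℝ) ^ j) ^ d) ^ (1 - 2 / p) = (2 ^ ((d:ℝ) * (1 - 2 / p))) ^ j := by
          rw [← pow_mul, mul_comm, pow_mul, ← Real.rpow_natCast, ← Real.rpow_natCast, ← Real.rpow_natCast,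
            ← Real.rpow_mul (by norm_num), ← Real.rpow_mul (by norm_num), ← Real.rpow_mul (by norm_num)]
          congr 1; ring
        have e2 : ((2:ℝ) ^ j) ^ (2*s) = (2 ^ (2*s)) ^ j := by
          rw [← Real.rpow_natCast, ← Real.rpow_natCast,
            ← Real.rpow_mul (by norm_num), ← Real.rpow_mul (by norm_num)]
          congr 1; ring
        rw [Real.mul_rpow (by positivity) hω0, e1, e2, hB]
        simp only [hx]
        rw [Real.rpow_sub (x := (2:ℝ)) (by norm_num) ((d:ℝ) * (1 - 2 / p)) (2 * s), div_pow]
        have h2 : (0:ℝ) < 2 ^ (2 * s) := by positivity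
        generalize (2:ℝ) ^ (2 * s) = a at *
        generalize (2:ℝ) ^ ((d:ℝ) * (1 - 2 / p)) = b at *
        generalize ω ^ (1 - 2 / p) = z at *
        field_simp

end

section
variable {d : ℕ}

lemma invFT_dilate (U : Rd d → ℂ) {r : ℝ} (hr : 0 < r) (x : Rd d) :
    𝓕⁻ (fun ξ => U (r • ξ)) x = ((r ^ d)⁻¹ : ℝ) * 𝓕⁻ U (r⁻¹ • x) := by
  rw [Real.fourierInv_eq, Real.fourierInv_eq]
  have h := Measure.integral_comp_smul (volume : Measure (Rd d)) (fun ζ : Rd d => 𝐞 ⟪ζ, r⁻¹ • x⟫ • U ζ) r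
  simp only [finrank_euclideanSpace, Fintype.card_fin] at h
  rw [abs_of_pos (by positivity)] at h
  rw [Complex.real_smul] at h
  rw [← h]
  congr 1; ext ξ
  rw [inner_smul_left, inner_smul_right]
  simp only [conj_trivial]
  rw [mul_inv_cancel_left₀ hr.ne']

lemma int_dilate (f : Rd d → ℝ) {r : ℝ} (hr : 0 < r) :
    ∫ ξ, f (r • ξ) = (r ^ d)⁻¹ * ∫ ξ, f ξ := by
  have h := Measure.integral_comp_smul (volume : Measure (Rd d)) f r
  simp only [finrank_euclideanSpace, Fintype.card_fin] at h
  rw [abs_of_pos (by positivity), smul_eq_mul] at h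
  exact h

lemma Good.dilate {U : Rd d → ℂ} (h : Good U) {r : ℝ} (hr : 0 < r) : Good (fun ξ => U (r • ξ)) := by
  obtain ⟨B, hB⟩ := h.bdd
  have hq : Measure.QuasiMeasurePreserving (fun ξ : Rd d => r • ξ) volume volume := by
    refine ⟨measurable_const_smul r, ?_⟩
    rw [Measure.map_addHaar_smul _ hr.ne']
    exact Measure.smul_absolutelyContinuous
  have hm : AEStronglyMeasurable (fun ξ => U (r • ξ)) volume := h.mem.1.comp_quasiMeasurePreserving hq
  refine ⟨?_, B / r, fun ξ hξ => hB _ ?_⟩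
  · refine (memLp_two_iff_integrable_sq_norm hm).2 ?_
    have := (memLp_int_sq h.mem).comp_smul hr.ne'
    exact this
  · rw [norm_smul, Real.norm_of_nonneg hr.le]
    rwa [div_lt_iff₀' hr] at hξ

lemma AEInv.dilate {k : ℕ} {U : Rd d → ℂ} (h : AEInv k U) {r : ℝ} (hr : 0 < r) :
    AEInv k (fun ξ => U (r • ξ)) := by
  intro A hA
  have hq : Measure.QuasiMeasurePreserving (fun ξ : Rd d => r • ξ) volume volume := by
    refine ⟨measurable_const_smul r, ?_⟩
    rw [Measure.map_addHaar_smul _ hr.ne']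
    exact Measure.smul_absolutelyContinuous
  have := hq.ae_eq_comp (h A hA)
  filter_upwards [this] with x hx
  simpa using hx

/-- The dilated Rayleigh inequality. -/
lemma rayleigh_dilate {s p C' : ℝ} {g : ℝ → ℝ} (hg : SymB s C' g) {k : ℕ} (hp : 2 < p) {U : Rd d → ℂ}
    (hU : Good U) (hi : AEInv k U) {r M : ℝ} (hr : 0 < r) (hr2 : r ≤ 2)
    (hR : 0 ≤ Rayleigh d s p g (GkSymmetric d k)) (hM0 : 0 ≤ M)
    (hM : ∀ ξ, U (r • ξ) ≠ 0 → g ‖ξ‖ ≤ M) :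
    Rayleigh d s p g (GkSymmetric d k) * LpN p (𝓕⁻ U) ^ 2 ≤ 2 ^ d * M * ∫ ξ, ‖U ξ‖ ^ 2 := by
  have hp0 : (0:ℝ) < p := by linarith
  have hG := hU.dilate hr
  have h1 := rayleigh_good hg hp.le hG (hi.dilate hr)
  set R := Rayleigh d s p g (GkSymmetric d k)
  have h2 : ∫ ξ, ‖U (r • ξ)‖ ^ 2 * g ‖ξ‖ ≤ M * ((r ^ d)⁻¹ * ∫ ξ, ‖U ξ‖ ^ 2) := by
    rw [← int_dilate (fun ξ => ‖U ξ‖ ^ 2) hr, ← integral_const_mul]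
    refine integral_mono (hG.int_g hg) ((memLp_int_sq hG.mem).const_mul M) fun ξ => ?_
    by_cases h : U (r • ξ) = 0
    · simp [h]
    · have := hM ξ h
      simp only
      rw [mul_comm]
      gcongr
  have h3 : LpN p (𝓕⁻ U) ^ p = (r ^ d) ^ (p - 1) * LpN p (𝓕⁻ (fun ξ => U (r • ξ))) ^ p := by
    rw [LpN_rpow hp.le (hU.memLp hp.le), LpN_rpow hp.le (hG.memLp hp.le)]
    simp_rw [invFT_dilate U hr, norm_mul]
    have : ∀ x : Rd d, (‖(((r ^ d)⁻¹ : ℝ) : ℂ)‖ * ‖𝓕⁻ U (r⁻¹ • x)‖) ^ p =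
        ((r ^ d)⁻¹) ^ p * ‖𝓕⁻ U (r⁻¹ • x)‖ ^ p := by
      intro x
      rw [Real.mul_rpow (norm_nonneg _) (norm_nonneg _), Complex.norm_real, Real.norm_of_nonneg (by positivity)]
    simp_rw [this]
    rw [integral_const_mul, int_dilate (fun x => ‖𝓕⁻ U x‖ ^ p) (inv_pos.2 hr)]
    have hrd : 0 < r ^ d := by positivity
    rw [Real.inv_rpow hrd.le, Real.rpow_sub hrd, Real.rpow_one, inv_pow, inv_inv]
    field_simp
  have h4 : LpN p (𝓕⁻ U) ^ 2 ≤ (2 ^ d * r ^ d) * LpN p (𝓕⁻ (fun ξ => U (r • ξ))) ^ 2 := by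
    have hrd : 0 < r ^ d := by positivity
    have h5 : LpN p (𝓕⁻ U) ^ 2 = (LpN p (𝓕⁻ U) ^ p) ^ (2/p) := by
      rw [← Real.rpow_mul (LpN_nonneg _ _), mul_div_cancel₀ _ hp0.ne', Real.rpow_two]
    rw [h5, h3, Real.mul_rpow (by positivity) (Real.rpow_nonneg (LpN_nonneg _ _) _),
      ← Real.rpow_mul (LpN_nonneg _ _), mul_div_cancel₀ _ hp0.ne', Real.rpow_two, ← Real.rpow_mul hrd.le]
    have hE : (p - 1) * (2/p) = (1 - 2/p) + 1 := by field_simp; ring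
    rw [hE, Real.rpow_add hrd, Real.rpow_one]
    have hexp : 0 ≤ 1 - 2 / p := by
      rw [sub_nonneg, div_le_one hp0]; exact hp.le
    have h6 : (r ^ d) ^ (1 - 2/p) ≤ 2 ^ d := by
      calc (r ^ d) ^ (1 - 2/p) ≤ ((2:ℝ) ^ d) ^ (1 - 2/p) := by gcongr
        _ ≤ ((2:ℝ) ^ d) ^ (1:ℝ) := by
          refine Real.rpow_le_rpow_of_exponent_le (one_le_pow₀ (by norm_num)) ?_
          have : 0 ≤ 2 / p := by positivity
          linarith
        _ = 2 ^ d := Real.rpow_one _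
    gcongr
  have hrd : 0 < r ^ d := by positivity
  calc R * LpN p (𝓕⁻ U) ^ 2 ≤ R * ((2 ^ d * r ^ d) * LpN p (𝓕⁻ (fun ξ => U (r • ξ))) ^ 2) := by gcongr
    _ = (2 ^ d * r ^ d) * (R * LpN p (𝓕⁻ (fun ξ => U (r • ξ))) ^ 2) := by ring
    _ ≤ (2 ^ d * r ^ d) * (M * ((r ^ d)⁻¹ * ∫ ξ, ‖U ξ‖ ^ 2)) := by
      exact mul_le_mul_of_nonneg_left (h1.trans h2) (by positivity)
    _ = _ := by field_simp

end

section
variable {d : ℕ}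

def tauF (γ a : ℝ) : ℝ := ∑' j : ℕ, if a < j + 1 then ((j : ℝ) ^ γ)⁻¹ else 0

lemma tau_summable {γ : ℝ} (hγ : 1 < γ) (a : ℝ) :
    Summable fun j : ℕ => if a < j + 1 then ((j : ℝ) ^ γ)⁻¹ else 0 := by
  refine Summable.of_nonneg_of_le (fun j => ?_) (fun j => ?_) (Real.summable_nat_rpow_inv.2 hγ)
  · split_ifs <;> positivity
  · split_ifs
    · exact le_rfl
    · positivity

lemma tau_tendsto {γ : ℝ} (hγ : 1 < γ) : Tendsto (tauF γ) atTop (𝓝 0) := by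
  have h : Tendsto (fun a : ℝ => ∑' j : ℕ, if a < j + 1 then ((j : ℝ) ^ γ)⁻¹ else 0) atTop
      (𝓝 (∑' _ : ℕ, (0:ℝ))) := tendsto_tsum_of_dominated_convergence
    (Real.summable_nat_rpow_inv.2 hγ) (fun j => by
      refine tendsto_const_nhds.congr' ?_
      filter_upwards [eventually_ge_atTop ((j:ℝ)+1)] with a ha
      rw [if_neg (not_lt.2 ha)])
    (Eventually.of_forall fun a j => by
      split_ifs
      · rw [Real.norm_of_nonneg (by positivity)]
      · simp; positivity)
  rw [tsum_zero] at h
  exact h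

lemma mid_side {s γ p C' c C t ε a σ : ℝ} {g : ℝ → ℝ} (hg : SymB s C' g) {k : ℕ} (hp : 2 < p)
    (hγ : 1 < γ) (hc : 0 < c) (hC : 0 < C) (ht : 0 < t) (ht4 : t ≤ 1/4) (hε : ε = t ^ γ) (ha : 2 ≤ a)
    (hσ : σ = 1 ∨ σ = -1)
    (hgb : ∀ r : ℝ, |r - 1| ≤ 1/2 → c * (ε + |r - 1| ^ γ) ≤ g r ∧ g r ≤ C * (ε + |r - 1| ^ γ))
    (hR : 0 < Rayleigh d s p g (GkSymmetric d k))
    {U : Rd d → ℂ} (hU : MemLp U 2 volume) (hi : AEInv k U)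
    (hI : Integrable (fun ξ => ‖U ξ‖ ^ 2 * g ‖ξ‖) volume)
    (hsupp : ∀ ξ, U ξ ≠ 0 → a * t < σ * (‖ξ‖ - 1) ∧ σ * (‖ξ‖ - 1) ≤ 1/2) :
    Bd p (fun ξ => g ‖ξ‖) ((2 ^ d * (C * (1 + 2 ^ γ)) / c) / Rayleigh d s p g (GkSymmetric d k) * tauF γ a) U := by
  set R := Rayleigh d s p g (GkSymmetric d k) with hRdef
  have hε0 : 0 < ε := by rw [hε]; positivity
  set D := 2 ^ d * (C * (1 + 2 ^ γ)) / c with hD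
  have hD0 : 0 < D := by positivity
  set S : ℕ → Set (Rd d) := fun j => {ξ | ‖ξ‖ ∈ {r : ℝ | j * t ≤ σ * (r - 1) ∧ σ * (r - 1) < (j + 1) * t}} with hS
  have hSm : ∀ j, MeasurableSet (S j) := by
    intro j
    have hm : Measurable fun r : ℝ => σ * (r - 1) := by fun_prop
    exact measurable_norm ((measurableSet_le measurable_const hm).inter (measurableSet_lt hm measurable_const))
  have hmS : ∀ j ξ, ξ ∈ S j ↔ (j * t ≤ σ * (‖ξ‖ - 1) ∧ σ * (‖ξ‖ - 1) < (j + 1) * t) := fun j ξ => Iff.rfl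
  have hbdd : ∀ ξ, U ξ ≠ 0 → ‖ξ‖ ≤ 2 := by
    intro ξ h
    have := hsupp ξ h
    have h3 : 0 ≤ a * t := by positivity
    rcases hσ with rfl | rfl <;> linarith
  rw [tauF, ← tsum_mul_left]
  refine Bd.iUnion hp.le (fun ξ => (hg.pos _).le) ?_ ((tau_summable hγ a).mul_left _) hU hI hSm ?_ ?_ ?_
  · intro j; split_ifs <;> positivity
  · have key : ∀ i j : ℕ, i < j → Disjoint (S i) (S j) := by
      intro i j hij
      rw [Set.disjoint_left]
      intro ξ h1 h2
      rw [hmS] at h1 h2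
      have : ((i:ℝ) + 1) ≤ j := by exact_mod_cast hij
      nlinarith [h1.2, h2.1]
    intro i j hij
    rcases lt_or_gt_of_ne hij with h | h
    · exact key i j h
    · exact (key j i h).symm
  · intro ξ h
    have h1 := (hsupp ξ h).1
    have h0 : 0 ≤ σ * (‖ξ‖ - 1) / t := div_nonneg (by nlinarith) ht.le
    refine ⟨⌊σ * (‖ξ‖ - 1) / t⌋₊, (hmS _ _).2 ⟨?_, ?_⟩⟩
    · have := Nat.floor_le h0
      rwa [le_div_iff₀ ht] at this
    · have := Nat.lt_floor_add_one (σ * (‖ξ‖ - 1) / t)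
      rwa [div_lt_iff₀ ht] at this
  · intro j
    by_cases hz : ∀ ξ, (S j).indicator U ξ = 0
    · have hz' : (S j).indicator U = fun _ => 0 := funext hz
      intro v hv hF
      rw [hz'] at hF
      have := isFT_unique_right2 hF isFT_zero hv MemLp.zero
      refine ⟨(memLp_congr_ae this).2 MemLp.zero, ?_⟩
      rw [LpN_congr this, LpN]
      have : (fun _ => 0 : Rd d → ℂ) = 0 := rfl
      rw [this, eLpNorm_zero]; simp [hz]
    push Not at hz
    obtain ⟨ξ0, hξ0⟩ := hz
    have hzzS : ξ0 ∈ S j := Set.mem_of_indicator_ne_zero hξ0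
    have hzzU : U ξ0 ≠ 0 := by rwa [Set.indicator_of_mem hzzS] at hξ0
    rw [hmS] at hzzS
    have hs0 := hsupp ξ0 hzzU
    have haj : a < j + 1 := by
      have : a * t < (j + 1) * t := hs0.1.trans hzzS.2
      exact lt_of_mul_lt_mul_right this ht.le
    have hj1 : (1:ℝ) < j := by linarith
    have hjt : j * t ≤ 1/2 := hzzS.1.trans hs0.2
    have hjt0 : 0 ≤ j * t := by positivity
    rw [if_pos haj]
    have hG : Good ((S j).indicator U) := by
      refine ⟨hU.indicator (hSm j), 2, fun ξ hξ => ?_⟩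
      by_contra hne
      have h1 : ξ ∈ S j := Set.mem_of_indicator_ne_zero hne
      rw [Set.indicator_of_mem h1] at hne
      exact absurd (hbdd ξ hne) (not_le.2 hξ)
    refine Bd.of_good hp.le hG ?_
    set r := 1 + σ * (j * t) with hr
    have hr0 : 1/2 ≤ r := by rcases hσ with h | h <;> rw [hr, h] <;> linarith
    have hr2 : r ≤ 2 := by rcases hσ with h | h <;> rw [hr, h] <;> linarith
    have h1 := rayleigh_dilate hg (k := k) hp hG (hi.indicator _) (r := r) (M := C * (1 + 2 ^ γ) * ε) (by linarith) hr2
      hR.le (by positivity) (by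
        intro ξ hξ
        have hm : r • ξ ∈ S j := Set.mem_of_indicator_ne_zero hξ
        rw [hmS, norm_smul, Real.norm_of_nonneg (by linarith)] at hm
        have habs : |‖ξ‖ - 1| ≤ 2 * t := by
          have hn := norm_nonneg ξ
          have : r * |‖ξ‖ - 1| ≤ t := by
            have hh : |r * (‖ξ‖ - 1)| ≤ t := by
              rw [abs_le]
              rcases hσ with h | h <;> rw [h] at hr hm <;> constructor <;> nlinarith [hm.1, hm.2]
            rwa [abs_mul, abs_of_nonneg (show 0 ≤ r by linarith)] at hh
          nlinarith [abs_nonneg (‖ξ‖ - 1)]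
        have h3 := (hgb ‖ξ‖ (by linarith)).2
        have h4 : |‖ξ‖ - 1| ^ γ ≤ 2 ^ γ * ε := by
          rw [hε, ← Real.mul_rpow (by norm_num) ht.le]
          exact Real.rpow_le_rpow (abs_nonneg _) habs (by linarith)
        nlinarith)
    rw [← hRdef] at h1
    have hlow : ∀ ξ, ‖(S j).indicator U ξ‖ ^ 2 * (c * ((j:ℝ) ^ γ * ε)) ≤ ‖(S j).indicator U ξ‖ ^ 2 * g ‖ξ‖ := by
      intro ξ
      by_cases hne : (S j).indicator U ξ = 0
      · simp [hne]
      have hm : ξ ∈ S j := Set.mem_of_indicator_ne_zero hne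
      have hUn : U ξ ≠ 0 := by rwa [Set.indicator_of_mem hm] at hne
      rw [hmS] at hm
      have hs1 := hsupp ξ hUn
      have habs : |‖ξ‖ - 1| = σ * (‖ξ‖ - 1) := by
        have h0 : 0 ≤ a * t := by positivity
        rcases hσ with h | h <;> rw [h] at hs1 ⊢
        · rw [abs_of_nonneg] <;> linarith
        · rw [abs_of_nonpos] <;> linarith
      refine mul_le_mul_of_nonneg_left ?_ (by positivity)
      refine le_trans ?_ (hgb ‖ξ‖ (by rw [habs]; exact hs1.2)).1
      refine mul_le_mul_of_nonneg_left ?_ hc.le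
      have : (j:ℝ) ^ γ * ε ≤ |‖ξ‖ - 1| ^ γ := by
        rw [hε, ← Real.mul_rpow (by positivity) ht.le, habs]
        exact Real.rpow_le_rpow (by positivity) hm.1 (by linarith)
      linarith
    have hint := integral_mono ((memLp_int_sq hG.mem).mul_const _) (hG.int_g hg) hlow
    rw [integral_mul_const] at hint
    set N := ∫ ξ, ‖(S j).indicator U ξ‖ ^ 2
    set q := ∫ ξ, ‖(S j).indicator U ξ‖ ^ 2 * g ‖ξ‖
    have hjγ : 0 < (j:ℝ) ^ γ := by positivity
    have hN : N * ε ≤ q / (c * (j:ℝ) ^ γ) := by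
      rw [le_div_iff₀ (by positivity)]; linarith
    have h2 : R * LpN p (𝓕⁻ ((S j).indicator U)) ^ 2 ≤ 2 ^ d * (C * (1 + 2 ^ γ)) * (q / (c * (j:ℝ) ^ γ)) := by
      calc _ ≤ _ := h1
        _ = 2 ^ d * (C * (1 + 2 ^ γ)) * (N * ε) := by ring
        _ ≤ _ := by gcongr
    rw [← le_div_iff₀' hR] at h2
    refine h2.trans (le_of_eq ?_)
    rw [hD]
    field_simp

end

section
variable {d : ℕ}

lemma invFT_shell_lower {t : ℝ} (ht4 : t ≤ 1/4) {S : Set (Rd d)} (hSm : MeasurableSet S)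
    (hS : ∀ ξ ∈ S, |‖ξ‖ - 1| ≤ t) (hG : Good (S.indicator (fun _ => (1:ℂ)))) {x : Rd d} (hx : ‖x‖ ≤ 1/20) :
    volume.real S / 2 ≤ ‖𝓕⁻ (S.indicator (fun _ => (1:ℂ))) x‖ := by
  have hmt : volume S ≠ ⊤ := by
    refine ((Metric.isBounded_closedBall (x := (0 : Rd d)) (r := 2)).subset ?_).measure_lt_top.ne
    intro ξ hξ
    have := abs_le.1 (hS ξ hξ)
    simp only [mem_closedBall_zero_iff]; linarith
  have hi : Integrable (fun ξ => 𝐞 ⟪ξ, x⟫ • S.indicator (fun _ => (1:ℂ)) ξ) volume := by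
    refine hG.integrable.mono ?_ (Eventually.of_forall fun ξ => by simp)
    refine AEStronglyMeasurable.smul ?_ hG.mem.1
    have : Continuous fun ξ : Rd d => 𝐞 ⟪ξ, x⟫ := Real.continuous_fourierChar.comp (by fun_prop)
    exact (continuous_subtype_val.comp this).aestronglyMeasurable
  rw [Real.fourierInv_eq]
  refine le_trans ?_ (Complex.re_le_norm _)
  have h1 : (∫ ξ, 𝐞 ⟪ξ, x⟫ • S.indicator (fun _ => (1:ℂ)) ξ).re
      = ∫ ξ, (𝐞 ⟪ξ, x⟫ • S.indicator (fun _ => (1:ℂ)) ξ).re := (integral_re hi).symm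
  rw [h1]
  have h2 : volume.real S / 2 = ∫ ξ, S.indicator (fun _ => (1/2:ℝ)) ξ := by
    rw [integral_indicator_const _ hSm]; simp; ring
  rw [h2]
  refine integral_mono ?_ hi.re ?_
  · exact (integrable_indicator_iff hSm).2 (integrableOn_const hmt)
  · intro ξ
    by_cases hξ : ξ ∈ S
    · simp only [Set.indicator_of_mem hξ]
      have h3 : |⟪ξ, x⟫| ≤ 1/16 := by
        have h4 := abs_real_inner_le_norm ξ x
        have h5 := abs_le.1 (hS ξ hξ)
        have : ‖ξ‖ * ‖x‖ ≤ (5/4) * (1/20) := by gcongr; linarith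
        linarith
      rw [Circle.smul_def, Real.fourierChar_apply]
      have : (Complex.exp (↑(2 * π * ⟪ξ, x⟫) * Complex.I) • (1:ℂ)).re = Real.cos (2 * π * ⟪ξ, x⟫) := by
        rw [smul_eq_mul, mul_one, Complex.exp_ofReal_mul_I_re]
      show (1/2:ℝ) ≤ (Complex.exp (↑(2 * π * ⟪ξ, x⟫) * Complex.I) • (1:ℂ)).re
      rw [this]
      have h6 : |2 * π * ⟪ξ, x⟫| ≤ 1/2 := by
        rw [abs_mul, abs_of_pos (by positivity)]
        have := Real.pi_lt_d2
        nlinarith [abs_nonneg ⟪ξ, x⟫, Real.pi_pos]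
      have h7 := Real.one_sub_sq_div_two_le_cos (x := 2 * π * ⟪ξ, x⟫)
      have h8 : (2 * π * ⟪ξ, x⟫) ^ 2 ≤ (1/2)^2 := sq_le_sq' (by linarith [(abs_le.1 h6).1]) (abs_le.1 h6).2
      linarith
    · simp [Set.indicator_of_notMem hξ]

lemma shell_meas (hd : 0 < d) {t : ℝ} (ht : 0 < t) (ht4 : t ≤ 1/4) :
    volume.real (Metric.closedBall (0 : Rd d) 1) * t ≤ volume.real {ξ : Rd d | ‖ξ‖ ∈ {r : ℝ | |r - 1| ≤ t}} := by
  have hsub : Metric.closedBall (0 : Rd d) 1 \ Metric.closedBall (0 : Rd d) (1 - t) ⊆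
      {ξ : Rd d | ‖ξ‖ ∈ {r : ℝ | |r - 1| ≤ t}} := by
    intro ξ hξ
    simp only [Set.mem_sdiff, mem_closedBall_zero_iff, not_le] at hξ
    show |‖ξ‖ - 1| ≤ t
    rw [abs_le]; constructor <;> linarith [hξ.1, hξ.2]
  have hfin : volume {ξ : Rd d | ‖ξ‖ ∈ {r : ℝ | |r - 1| ≤ t}} ≠ ⊤ := by
    refine ((Metric.isBounded_closedBall (x := (0 : Rd d)) (r := 2)).subset ?_).measure_lt_top.ne
    intro ξ hξ
    have h : |‖ξ‖ - 1| ≤ t := hξ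
    have := abs_le.1 h
    simp only [mem_closedBall_zero_iff]; linarith
  refine le_trans ?_ (measureReal_mono hsub hfin)
  rw [measureReal_sdiff (Metric.closedBall_subset_closedBall (by linarith)) Metric.isClosed_closedBall.measurableSet
    (Metric.isBounded_closedBall.measure_lt_top.ne)]
  have h2 : volume.real (Metric.closedBall (0 : Rd d) (1 - t)) = (1 - t) ^ d * volume.real (Metric.closedBall (0 : Rd d) 1) := by
    rw [measureReal_def, Measure.addHaar_closedBall' _ _ (by linarith), ENNReal.toReal_mul, ENNReal.toReal_ofReal]
    · simp [measureReal_def]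
    · exact pow_nonneg (by linarith) _
  rw [h2]
  have h3 : (1 - t) ^ d ≤ 1 - t := by
    calc (1 - t) ^ d ≤ (1 - t) ^ 1 := pow_le_pow_of_le_one (by linarith) (by linarith) hd
      _ = _ := pow_one _
  have h4 : 0 ≤ volume.real (Metric.closedBall (0 : Rd d) 1) := measureReal_nonneg
  nlinarith

lemma ball_real_pos {r : ℝ} (hr : 0 < r) : 0 < volume.real (Metric.closedBall (0 : Rd d) r) := by
  rw [measureReal_def]
  exact ENNReal.toReal_pos (Metric.measure_closedBall_pos volume _ hr).ne' Metric.isBounded_closedBall.measure_lt_top.ne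

lemma rayleigh_upper (hd : 0 < d) {s γ p C : ℝ} (hp : 2 < p) (hγ : 1 < γ) (hC : 0 < C) :
    ∃ C2 : ℝ, 0 < C2 ∧ ∀ (k : ℕ) (C' : ℝ) (g : ℝ → ℝ) (t ε : ℝ), SymB s C' g → 0 < t → t ≤ 1/4 → ε = t ^ γ →
      (∀ r : ℝ, |r - 1| ≤ 1/2 → g r ≤ C * (ε + |r - 1| ^ γ)) →
      Rayleigh d s p g (GkSymmetric d k) ≤ C2 * t ^ (γ - 1) := by
  set b := volume.real (Metric.closedBall (0 : Rd d) (1/20)) with hb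
  set ω := volume.real (Metric.closedBall (0 : Rd d) 1) with hω
  have hb0 : 0 < b := ball_real_pos (by norm_num)
  have hω0 : 0 < ω := ball_real_pos (by norm_num)
  refine ⟨8 * C / (b ^ (2/p) * ω), by positivity, ?_⟩
  intro k C' g t ε hg ht ht4 hε hgb
  set S : Set (Rd d) := {ξ : Rd d | ‖ξ‖ ∈ {r : ℝ | |r - 1| ≤ t}} with hS
  have hmS : ∀ ξ ∈ S, |‖ξ‖ - 1| ≤ t := fun ξ h => h
  have hSm : MeasurableSet S := by
    have hm : Measurable fun r : ℝ => |r - 1| := by fun_prop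
    exact measurable_norm (measurableSet_le hm measurable_const)
  have hSb : ∀ ξ ∈ S, ‖ξ‖ ≤ 2 := fun ξ h => by linarith [(abs_le.1 (hmS ξ h)).2]
  have hmt : volume S ≠ ⊤ := by
    refine ((Metric.isBounded_closedBall (x := (0 : Rd d)) (r := 2)).subset ?_).measure_lt_top.ne
    intro ξ hξ
    simpa using hSb ξ hξ
  have hG : Good (S.indicator (fun _ => (1:ℂ))) :=
    ⟨memLp_indicator_const 2 hSm 1 (Or.inr hmt), 2, fun ξ hξ =>
      Set.indicator_of_notMem (fun h => absurd (hSb ξ h) (not_le.2 hξ)) _⟩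
  have hA : AEInv k (S.indicator (fun _ => (1:ℂ))) :=
    AEInv.indicator (U := fun _ => (1:ℂ)) (fun A _ => Eventually.of_forall fun _ => rfl) _
  have h1 := rayleigh_good hg (k := k) (p := p) hp.le hG hA
  set m := volume.real S with hm
  have hm1 : ω * t ≤ m := shell_meas hd ht ht4
  have hm0 : 0 < m := lt_of_lt_of_le (by positivity) hm1
  set P := LpN p (𝓕⁻ (S.indicator (fun _ => (1:ℂ)))) with hP
  have hP0 : 0 ≤ P := LpN_nonneg _ _
  set R := Rayleigh d s p g (GkSymmetric d k) with hR
  have hPp : b * (m/2) ^ p ≤ P ^ p := by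
    rw [hP, LpN_rpow hp.le (hG.memLp hp.le)]
    have : b * (m/2) ^ p = ∫ x, (Metric.closedBall (0 : Rd d) (1/20)).indicator (fun _ => (m/2) ^ p) x := by
      rw [integral_indicator_const _ Metric.isClosed_closedBall.measurableSet]; rfl
    rw [this]
    refine integral_mono ?_ (hG.int_rpow hp.le) ?_
    · exact (integrable_indicator_iff Metric.isClosed_closedBall.measurableSet).2
        (integrableOn_const Metric.isBounded_closedBall.measure_lt_top.ne)
    · intro x
      by_cases hx : x ∈ Metric.closedBall (0 : Rd d) (1/20)
      · simp only [Set.indicator_of_mem hx]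
        refine Real.rpow_le_rpow (by positivity) ?_ (by linarith)
        exact invFT_shell_lower ht4 hSm hmS hG (by simpa using hx)
      · simp only [Set.indicator_of_notMem hx]; positivity
  have hP2 : b ^ (2/p) * (m/2) ^ 2 ≤ P ^ 2 := by
    have := Real.rpow_le_rpow (by positivity) hPp (show 0 ≤ 2/p by positivity)
    rw [Real.mul_rpow (by positivity) (by positivity), ← Real.rpow_mul (by positivity), ← Real.rpow_mul hP0,
      mul_div_cancel₀ _ (by linarith), Real.rpow_two, Real.rpow_two] at this
    exact this
  have hq : ∫ ξ, ‖S.indicator (fun _ => (1:ℂ)) ξ‖ ^ 2 * g ‖ξ‖ ≤ m * (2 * C * ε) := by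
    have : m * (2 * C * ε) = ∫ x, S.indicator (fun _ => 2 * C * ε) x := by
      rw [integral_indicator_const _ hSm]; rfl
    rw [this]
    refine integral_mono (hG.int_g hg) ((integrable_indicator_iff hSm).2 (integrableOn_const hmt)) ?_
    intro ξ
    by_cases hx : ξ ∈ S
    · simp only [Set.indicator_of_mem hx]
      have h2 := hgb ‖ξ‖ ((hmS ξ hx).trans (by linarith))
      have h3 : |‖ξ‖ - 1| ^ γ ≤ ε := by
        rw [hε]; exact Real.rpow_le_rpow (abs_nonneg _) (hmS ξ hx) (by linarith)
      simp
      nlinarith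
    · simp [Set.indicator_of_notMem hx]
  have hε' : ε = t ^ (γ - 1) * t := by
    rw [hε, ← Real.rpow_add_one ht.ne']; congr 1; ring
  by_cases hRn : R ≤ 0
  · exact hRn.trans (by positivity)
  push Not at hRn
  have h5 : R * (b ^ (2/p) * (m/2) ^ 2) ≤ m * (2 * C * ε) :=
    (mul_le_mul_of_nonneg_left hP2 hRn.le).trans (h1.trans hq)
  have hbp : 0 < b ^ (2/p) := by positivity
  have h6 : R * (b ^ (2/p) * m) ≤ 8 * C * ε := by
    have : (R * (b ^ (2/p) * m)) * m ≤ (8 * C * ε) * m := by nlinarith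
    exact le_of_mul_le_mul_right this hm0
  have h7 : R * (b ^ (2/p) * (ω * t)) ≤ 8 * C * (t ^ (γ - 1) * t) := by
    rw [← hε']
    refine le_trans ?_ h6
    gcongr
  have h8 : R * (b ^ (2/p) * ω) ≤ 8 * C * t ^ (γ - 1) := by
    refine le_of_mul_le_mul_right ?_ ht
    linarith
  rw [div_mul_eq_mul_div, le_div_iff₀ (by positivity)]
  exact h8

end

section
variable {d : ℕ}

/-- partial derivative on the Fourier side -/
def dV (i : Fin d) (V : Rd d → ℂ) : Rd d → ℂ := fun ξ => ((2 * π * ξ i : ℝ) : ℂ) * Complex.I * V ξ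

lemma Good.dV {V : Rd d → ℂ} (h : Good V) (i : Fin d) : Good (dV i V) :=
  h.mul_cont (m := fun ξ => ((2 * π * ξ i : ℝ) : ℂ) * Complex.I) (by fun_prop)

def ei (i : Fin d) : Rd d := EuclideanSpace.single i 1

lemma Good.hasD {V : Rd d → ℂ} (h : Good V) (i : Fin d) (x : Rd d) :
    HasLineDerivAt ℝ (𝓕⁻ V) (𝓕⁻ (_root_.dV i V) x) x (ei i) := by
  have := h.hasLineDerivAt x (ei i)
  have h2 : ∀ ξ : Rd d, ⟪ξ, ei i⟫ = ξ i := fun ξ => by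
    rw [ei, EuclideanSpace.inner_single_right]; simp
  simp only [h2] at this
  exact this

def Bf (a : Rd d → ℝ) (V W : Rd d → ℂ) : ℝ := ∫ x, a x * inner ℝ (𝓕⁻ V x) (𝓕⁻ W x)

def nn (V : Rd d → ℂ) : ℝ := √(∫ ξ, ‖V ξ‖ ^ 2)

lemma nn_nonneg (V : Rd d → ℂ) : 0 ≤ nn V := Real.sqrt_nonneg _

lemma nn_sq (V : Rd d → ℂ) : nn V ^ 2 = ∫ ξ, ‖V ξ‖ ^ 2 := Real.sq_sqrt (integral_nonneg fun _ => by positivity)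

lemma Bf_symm (a : Rd d → ℝ) (V W : Rd d → ℂ) : Bf a V W = Bf a W V := by
  simp only [Bf, real_inner_comm]

structure Wt (a : Rd d → ℝ) (M : ℝ) : Prop where
  cont : Continuous a
  bd : ∀ x, |a x| ≤ M

lemma Bf_int1 {a : Rd d → ℝ} {M : ℝ} (ha : Wt a M) {V W : Rd d → ℂ} (hV : Good V) (hW : Good W) :
    Integrable (fun x => a x * inner ℝ (𝓕⁻ V x) (𝓕⁻ W x)) volume := by
  refine (((memLp_int_sq hV.memLp_two).add (memLp_int_sq hW.memLp_two)).const_mul M).mono' ?_ ?_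
  · exact (ha.cont.mul (hV.cont.inner hW.cont)).aestronglyMeasurable
  · refine Eventually.of_forall fun x => ?_
    have h1 := norm_inner_le_norm (𝕜 := ℝ) (𝓕⁻ V x) (𝓕⁻ W x)
    have h2 : ‖(inner ℝ (𝓕⁻ V x) (𝓕⁻ W x) : ℝ)‖ ≤ ‖𝓕⁻ V x‖ ^ 2 + ‖𝓕⁻ W x‖ ^ 2 := by
      nlinarith [sq_nonneg (‖𝓕⁻ V x‖ - ‖𝓕⁻ W x‖), sq_nonneg (‖𝓕⁻ V x‖), sq_nonneg (‖𝓕⁻ W x‖)]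
    rw [norm_mul]
    exact mul_le_mul (ha.bd x) h2 (norm_nonneg _) ((abs_nonneg _).trans (ha.bd x))

lemma cs_norm {v w : Rd d → ℂ} (hv : MemLp v 2 volume) (hw : MemLp w 2 volume) :
    ∫ x, ‖v x‖ * ‖w x‖ ≤ √(∫ x, ‖v x‖ ^ 2) * √(∫ x, ‖w x‖ ^ 2) := by
  have h := integral_mul_le_Lp_mul_Lq_of_nonneg (μ := volume) (f := fun x => ‖v x‖) (g := fun x => ‖w x‖)
    Real.HolderConjugate.two_two (Eventually.of_forall fun x => norm_nonneg _)
    (Eventually.of_forall fun x => norm_nonneg _) (by simpa using hv.norm) (by simpa using hw.norm)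
  simpa [Real.sqrt_eq_rpow] using h

lemma Bf_le {a : Rd d → ℝ} {M : ℝ} (ha : Wt a M) {V W : Rd d → ℂ} (hV : Good V) (hW : Good W) :
    |Bf a V W| ≤ M * (nn V * nn W) := by
  have hM : 0 ≤ M := (abs_nonneg _).trans (ha.bd 0)
  have h1 := cs_norm hV.memLp_two hW.memLp_two
  rw [hV.plancherel_int, hW.plancherel_int] at h1
  refine le_trans ?_ (mul_le_mul_of_nonneg_left h1 hM)
  rw [Bf, ← integral_const_mul, ← Real.norm_eq_abs]
  refine norm_integral_le_of_norm_le ?_ (Eventually.of_forall fun x => ?_)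
  · refine Integrable.const_mul ?_ _
    exact hV.memLp_two.norm.integrable_mul hW.memLp_two.norm
  · rw [norm_mul]
    exact mul_le_mul (ha.bd x) (norm_inner_le_norm _ _) (norm_nonneg _) hM

lemma int_line_zero {F F' : Rd d → ℝ} {v : Rd d} (hF : Integrable F volume) (hF' : Integrable F' volume)
    (h : ∀ x, HasLineDerivAt ℝ F (F' x) x v) : ∫ x, F' x = 0 := by
  have := integral_bilinear_hasLineDerivAt_right_eq_neg_left_of_integrable (μ := (volume : Measure (Rd d)))
    (f := F) (f' := F') (g := fun _ => (1:ℝ)) (g' := fun _ => (0:ℝ)) (B := ContinuousLinearMap.mul ℝ ℝ) (v := v)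
    (by simpa using hF') (by simp) (by simpa using hF) (fun x _ => h x)
    (fun x _ => hasDerivAt_const _ _)
  simpa using this

lemma ibp {a a' : Rd d → ℝ} {M M' : ℝ} (ha : Wt a M) (ha' : Wt a' M') {V W : Rd d → ℂ} (hV : Good V) (hW : Good W)
    (i : Fin d) (hd : ∀ x, HasLineDerivAt ℝ a (a' x) x (ei i)) :
    Bf a (dV i V) W + Bf a V (dV i W) + Bf a' V W = 0 := by
  have h1 := Bf_int1 ha (hV.dV i) hW
  have h2 := Bf_int1 ha hV (hW.dV i)
  have h3 := Bf_int1 ha' hV hW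
  have h12 : Integrable (fun x => a x * inner ℝ (𝓕⁻ (dV i V) x) (𝓕⁻ W x) + a x * inner ℝ (𝓕⁻ V x) (𝓕⁻ (dV i W) x))
      volume := h1.add h2
  rw [Bf, Bf, Bf, ← integral_add h1 h2, ← integral_add h12 h3]
  refine int_line_zero (Bf_int1 ha hV hW) (h12.add h3) (v := ei i) fun x => ?_
  have e1 : HasDerivAt (fun t : ℝ => a (x + t • ei i)) (a' x) 0 := hd x
  have e2 : HasDerivAt (fun t : ℝ => 𝓕⁻ V (x + t • ei i)) (𝓕⁻ (dV i V) x) 0 := hV.hasD i x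
  have e3 : HasDerivAt (fun t : ℝ => 𝓕⁻ W (x + t • ei i)) (𝓕⁻ (dV i W) x) 0 := hW.hasD i x
  have e4 := e1.mul (e2.inner ℝ e3)
  simp only [zero_smul, add_zero] at e4
  have e5 : HasDerivAt (fun t : ℝ => a (x + t • ei i) * inner ℝ (𝓕⁻ V (x + t • ei i)) (𝓕⁻ W (x + t • ei i)))
    (a x * inner ℝ (𝓕⁻ (dV i V) x) (𝓕⁻ W x) + a x * inner ℝ (𝓕⁻ V x) (𝓕⁻ (dV i W) x)
      + a' x * inner ℝ (𝓕⁻ V x) (𝓕⁻ W x)) 0 := by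
    refine HasDerivAt.congr_deriv e4 ?_
    ring
  exact e5

/-- 4π²(1 - |ξ|²) U -/
def gV (U : Rd d → ℂ) : Rd d → ℂ := fun ξ => ((4 * π ^ 2 * (1 - ‖ξ‖ ^ 2) : ℝ) : ℂ) * U ξ

lemma Good.gV {U : Rd d → ℂ} (h : Good U) : Good (gV U) := h.mul_cont (by fun_prop)

lemma invFT_add {V W : Rd d → ℂ} (hV : Good V) (hW : Good W) (x : Rd d) :
    𝓕⁻ (fun ξ => V ξ + W ξ) x = 𝓕⁻ V x + 𝓕⁻ W x := by
  rw [Real.fourierInv_eq, Real.fourierInv_eq, Real.fourierInv_eq, ← integral_add]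
  · simp
  · refine hV.integrable.mono ?_ (Eventually.of_forall fun ξ => by simp)
    have : Continuous fun ξ : Rd d => 𝐞 ⟪ξ, x⟫ := Real.continuous_fourierChar.comp (by fun_prop)
    exact AEStronglyMeasurable.smul (continuous_subtype_val.comp this).aestronglyMeasurable hV.mem.1
  · refine hW.integrable.mono ?_ (Eventually.of_forall fun ξ => by simp)
    have : Continuous fun ξ : Rd d => 𝐞 ⟪ξ, x⟫ := Real.continuous_fourierChar.comp (by fun_prop)
    exact AEStronglyMeasurable.smul (continuous_subtype_val.comp this).aestronglyMeasurable hW.mem.1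

lemma Good.add {V W : Rd d → ℂ} (hV : Good V) (hW : Good W) : Good (fun ξ => V ξ + W ξ) := by
  obtain ⟨B, hB⟩ := hV.bdd
  obtain ⟨B', hB'⟩ := hW.bdd
  refine ⟨hV.mem.add hW.mem, max B B', fun ξ h => ?_⟩
  rw [hB ξ ((le_max_left _ _).trans_lt h), hB' ξ ((le_max_right _ _).trans_lt h), add_zero]

lemma good_zero : Good (fun _ => 0 : Rd d → ℂ) := ⟨MemLp.zero, 0, fun _ _ => rfl⟩

lemma Good.sum {ι : Type*} (S : Finset ι) {V : ι → Rd d → ℂ} (h : ∀ i, Good (V i)) :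
    Good (fun ξ => ∑ i ∈ S, V i ξ) := by
  classical
  induction S using Finset.induction_on with
  | empty => simpa using good_zero
  | insert i S hi ih =>
    simp only [Finset.sum_insert hi]
    exact (h i).add ih

lemma invFT_sum {ι : Type*} (S : Finset ι) {V : ι → Rd d → ℂ} (h : ∀ i, Good (V i)) (x : Rd d) :
    𝓕⁻ (fun ξ => ∑ i ∈ S, V i ξ) x = ∑ i ∈ S, 𝓕⁻ (V i) x := by
  classical
  induction S using Finset.induction_on with
  | empty => simp [Real.fourierInv_eq]
  | insert i S hi ih =>
    simp only [Finset.sum_insert hi]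
    rw [invFT_add (h i) (Good.sum S h), ih]

lemma invFT_cmul (c : ℂ) (V : Rd d → ℂ) (x : Rd d) : 𝓕⁻ (fun ξ => c * V ξ) x = c * 𝓕⁻ V x := by
  rw [Real.fourierInv_eq, Real.fourierInv_eq, ← integral_const_mul]
  congr 1; ext ξ
  simp only [Circle.smul_def, smul_eq_mul]; ring

lemma gV_apply {U : Rd d → ℂ} (h : Good U) (x : Rd d) :
    𝓕⁻ (gV U) x = ∑ i, 𝓕⁻ (dV i (dV i U)) x + ((4 * π ^ 2 : ℝ) : ℂ) * 𝓕⁻ U x := by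
  have : gV U = fun ξ => (∑ i, dV i (dV i U) ξ) + ((4 * π ^ 2 : ℝ) : ℂ) * U ξ := by
    funext ξ
    have h1 : ∀ i : Fin d, dV i (dV i U) ξ = ((ξ i ^ 2 : ℝ) : ℂ) * (-(4 * π ^ 2) * U ξ) := by
      intro i
      simp only [dV]
      push_cast
      linear_combination (4 * (π:ℂ) ^ 2 * (ξ i : ℂ) ^ 2 * U ξ) * Complex.I_sq
    simp only [h1, gV]
    rw [← Finset.sum_mul, EuclideanSpace.norm_sq_eq]
    push_cast
    simp only [Real.norm_eq_abs, ← Complex.ofReal_pow, sq_abs]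
    ring
  rw [this, invFT_add (Good.sum _ fun i => (h.dV i).dV i) (h.mul_cont (m := fun _ => ((4 * π ^ 2 : ℝ) : ℂ)) (by fun_prop)),
    invFT_sum _ (fun i => (h.dV i).dV i), invFT_cmul]

lemma Bf_gV {a : Rd d → ℝ} {M : ℝ} (ha : Wt a M) {U W : Rd d → ℂ} (hU : Good U) (hW : Good W) :
    Bf a (gV U) W = ∑ i, Bf a (dV i (dV i U)) W + 4 * π ^ 2 * Bf a U W := by
  simp only [Bf]
  rw [← integral_finsetSum _ fun i _ => Bf_int1 ha ((hU.dV i).dV i) hW, ← integral_const_mul,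
    ← integral_add (integrable_finsetSum _ fun i _ => Bf_int1 ha ((hU.dV i).dV i) hW) ((Bf_int1 ha hU hW).const_mul _)]
  congr 1; ext x
  rw [gV_apply hU, inner_add_left, sum_inner, mul_add, Finset.mul_sum]
  congr 1
  rw [← Complex.real_smul, real_inner_smul_left]; ring

lemma dV_comm (i j : Fin d) (U : Rd d → ℂ) : dV i (dV j U) = dV j (dV i U) := by
  funext ξ; simp only [dV]; ring

lemma nn_le {U V : Rd d → ℂ} (hU : Good U) {M : ℝ} (hM : 0 ≤ M) (hV : Good V) (h : ∀ ξ, ‖V ξ‖ ≤ M * ‖U ξ‖) :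
    nn V ≤ M * nn U := by
  rw [nn, nn]
  apply Real.sqrt_le_left (by positivity) |>.2
  rw [mul_pow, Real.sq_sqrt (integral_nonneg fun _ => by positivity), ← integral_const_mul]
  refine integral_mono (memLp_int_sq hV.mem) ((memLp_int_sq hU.mem).const_mul _) fun ξ => ?_
  have := h ξ
  calc ‖V ξ‖ ^ 2 ≤ (M * ‖U ξ‖) ^ 2 := by gcongr
    _ = _ := by ring

lemma nn_dV {U : Rd d → ℂ} (hU : Good U) {h : ℝ} (hh : h ≤ 1/4) (hs : ∀ ξ, U ξ ≠ 0 → |‖ξ‖ - 1| ≤ h) (i : Fin d) :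
    nn (dV i U) ≤ 8 * nn U := by
  refine nn_le hU (by norm_num) (hU.dV i) fun ξ => ?_
  by_cases hz : U ξ = 0
  · simp [dV, hz]
  have h1 := (abs_le.1 (hs ξ hz)).2
  have h2 : ‖ξ i‖ ≤ ‖ξ‖ := PiLp.norm_apply_le ξ i
  simp only [dV, norm_mul, Complex.norm_I, mul_one, Complex.norm_real]
  have h3 := Real.pi_lt_d2
  have h4 : ‖(2:ℝ)‖ * ‖π‖ * ‖ξ i‖ ≤ 8 := by
    rw [Real.norm_of_nonneg (by norm_num : (0:ℝ) ≤ 2), Real.norm_of_nonneg Real.pi_pos.le]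
    have : 2 * π * ‖ξ i‖ ≤ 2 * 3.15 * (5/4) := by gcongr; linarith
    linarith
  exact mul_le_mul_of_nonneg_right h4 (norm_nonneg _)

lemma nn_gV {U : Rd d → ℂ} (hU : Good U) {h : ℝ} (h0 : 0 ≤ h) (hh : h ≤ 1/4) (hs : ∀ ξ, U ξ ≠ 0 → |‖ξ‖ - 1| ≤ h) :
    nn (gV U) ≤ 90 * h * nn U := by
  refine nn_le hU (by positivity) hU.gV fun ξ => ?_
  by_cases hz : U ξ = 0
  · simp [gV, hz]
  have h1 := hs ξ hz
  have h1' := (abs_le.1 h1).2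
  simp only [gV, norm_mul, Complex.norm_real]
  refine mul_le_mul_of_nonneg_right ?_ (norm_nonneg _)
  have h3 := Real.pi_lt_d2
  have h5 : ‖1 - ‖ξ‖ ^ 2‖ ≤ h * (9/4) := by
    have : 1 - ‖ξ‖ ^ 2 = -(‖ξ‖ - 1) * (1 + ‖ξ‖) := by ring
    rw [this, norm_mul, norm_neg, Real.norm_eq_abs, Real.norm_of_nonneg (by positivity)]
    gcongr; linarith
  have h6 : ‖4 * π ^ 2‖ ≤ 40 := by
    rw [Real.norm_of_nonneg (by positivity)]
    nlinarith [Real.pi_pos]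
  rw [norm_mul] at h6
  calc _ ≤ 40 * (h * (9/4)) := mul_le_mul h6 h5 (norm_nonneg _) (by norm_num)
    _ = _ := by ring

end

section
variable {d : ℕ}

def Nf (e : Fin d → ℝ) (x : Rd d) : ℝ := ∑ i, e i * x i ^ 2

def Wf (e : Fin d → ℝ) (L : ℝ) (x : Rd d) : ℝ := √(1 + Nf e x / L ^ 2)

structure Blk (e : Fin d → ℝ) : Prop where
  or : ∀ i, e i = 0 ∨ e i = 1

lemma Blk.nonneg {e : Fin d → ℝ} (he : Blk e) (i : Fin d) : 0 ≤ e i := by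
  rcases he.or i with h | h <;> simp [h]

lemma Blk.le_one {e : Fin d → ℝ} (he : Blk e) (i : Fin d) : e i ≤ 1 := by
  rcases he.or i with h | h <;> simp [h]

lemma Blk.sq {e : Fin d → ℝ} (he : Blk e) (i : Fin d) : e i * e i = e i := by
  rcases he.or i with h | h <;> simp [h]

lemma Nf_nonneg {e : Fin d → ℝ} (he : Blk e) (x : Rd d) : 0 ≤ Nf e x :=
  Finset.sum_nonneg fun i _ => mul_nonneg (he.nonneg i) (by positivity)

lemma Wf_ge {e : Fin d → ℝ} (he : Blk e) (L : ℝ) (x : Rd d) : 1 ≤ Wf e L x := by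
  rw [Wf, Real.one_le_sqrt]
  have := Nf_nonneg he x
  have : 0 ≤ Nf e x / L ^ 2 := by positivity
  linarith

lemma Wf_sq {e : Fin d → ℝ} (he : Blk e) (L : ℝ) (x : Rd d) : Wf e L x ^ 2 = 1 + Nf e x / L ^ 2 := by
  have := Nf_nonneg he x
  rw [Wf, Real.sq_sqrt (by positivity)]

lemma Wf_cont {e : Fin d → ℝ} (L : ℝ) : Continuous (Wf e L) := by
  unfold Wf Nf
  fun_prop

lemma Wf_coord {e : Fin d → ℝ} (he : Blk e) {L : ℝ} (hL : 0 < L) (x : Rd d) (i : Fin d) :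
    |e i * x i| ≤ L * Wf e L x := by
  have h1 : (e i * x i) ^ 2 ≤ Nf e x := by
    have : (e i * x i) ^ 2 = e i * x i ^ 2 := by rw [mul_pow, sq, he.sq]
    rw [this, Nf]
    exact Finset.single_le_sum (f := fun i => e i * x i ^ 2) (fun i _ => mul_nonneg (he.nonneg i) (by positivity)) (Finset.mem_univ i)
  have h2 := Wf_sq he L x
  have h3 := Wf_ge he L x
  refine abs_le_of_sq_le_sq ?_ (by positivity)
  rw [mul_pow L, h2]
  have : L ^ 2 * (1 + Nf e x / L ^ 2) = L ^ 2 + Nf e x := by field_simp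
  rw [this]; nlinarith

lemma Wf_ratio {e : Fin d → ℝ} (he : Blk e) {L : ℝ} (hL : 0 < L) (x : Rd d) (i : Fin d) :
    |e i * x i / (L ^ 2 * Wf e L x)| ≤ 1 / L := by
  have h3 := Wf_ge he L x
  have h1 := Wf_coord he hL x i
  rw [abs_div, abs_of_nonneg (show 0 ≤ L ^ 2 * Wf e L x by positivity), div_le_div_iff₀ (by positivity) hL]
  nlinarith

lemma Wf_deriv {e : Fin d → ℝ} (he : Blk e) (L : ℝ) (x : Rd d) (i : Fin d) :
    HasLineDerivAt ℝ (Wf e L) (e i * x i / (L ^ 2 * Wf e L x)) x (ei i) := by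
  have hN : ∀ t : ℝ, Nf e (x + t • ei i) = Nf e x + e i * (2 * t * x i + t ^ 2) := by
    intro t
    have : ∀ j, e j * (x + t • ei i) j ^ 2 = e j * x j ^ 2 + if i = j then e i * (2 * t * x i + t ^ 2) else 0 := by
      intro j
      by_cases h : i = j
      · subst h; simp [ei]; ring
      · simp [ei, h, Ne.symm h]
    simp only [Nf, this, Finset.sum_add_distrib, Finset.sum_ite_eq, Finset.mem_univ, if_true]
  have hfun : (fun t : ℝ => Wf e L (x + t • ei i)) = fun t => √(1 + (Nf e x + e i * (2 * t * x i + t ^ 2)) / L ^ 2) := by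
    funext t; rw [Wf, hN]
  show HasDerivAt (fun t : ℝ => Wf e L (x + t • ei i)) _ 0
  rw [hfun]
  have hW := Wf_ge he L x
  have h1 : HasDerivAt (fun t : ℝ => 1 + (Nf e x + e i * (2 * t * x i + t ^ 2)) / L ^ 2) (e i * (2 * x i) / L ^ 2) 0 := by
    have h2 : HasDerivAt (fun t : ℝ => 2 * t * x i + t ^ 2) (2 * 1 * x i + 2 * 0) 0 := by
      have := (((hasDerivAt_id (0:ℝ)).const_mul 2).mul_const (x i)).add ((hasDerivAt_id (0:ℝ)).pow 2)
      exact this.congr_deriv (by simp)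
    have := (((h2.const_mul (e i)).const_add (Nf e x)).div_const (L ^ 2)).const_add 1
    simpa using this
  have h3 := h1.sqrt (by
    have h0 := Nf_nonneg he x
    simp only [mul_zero, zero_mul, ne_eq, OfNat.ofNat_ne_zero, not_false_eq_true, zero_pow, add_zero]
    positivity)
  refine h3.congr_deriv ?_
  simp only [mul_zero, zero_mul, ne_eq, OfNat.ofNat_ne_zero, not_false_eq_true, zero_pow, add_zero]
  rw [← Wf]
  have : Wf e L x ≠ 0 := by positivity
  by_cases hL : L = 0
  · simp [hL]
  field_simp

lemma Wf_comp {e : Fin d → ℝ} (he : Blk e) (L : ℝ) {Θ : ℝ → ℝ} {Θ' : ℝ} (x : Rd d) (i : Fin d)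
    (h : HasDerivAt Θ Θ' (Wf e L x)) :
    HasLineDerivAt ℝ (fun x => Θ (Wf e L x)) (Θ' * (e i * x i / (L ^ 2 * Wf e L x))) x (ei i) := by
  have h1 : HasDerivAt (fun t : ℝ => Wf e L (x + t • ei i)) _ 0 := Wf_deriv he L x i
  have h2 : HasDerivAt Θ Θ' (Wf e L (x + (0:ℝ) • ei i)) := by simpa using h
  exact h2.comp (0:ℝ) h1

def Af (a w : ℝ) : ℝ := 1 + π / 2 + Real.arctan (w - a)
def mf (a w : ℝ) : ℝ := 1 / (1 + (w - a) ^ 2)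
def th0 (a w : ℝ) : ℝ := Af a w / w
def th1 (a w : ℝ) : ℝ := mf a w / w - Af a w / w ^ 2
def th2 (a w : ℝ) : ℝ := -2 * (w - a) * mf a w ^ 2 / w - 2 * mf a w / w ^ 2 + 2 * Af a w / w ^ 3

lemma Af_bd (a w : ℝ) : 1 ≤ Af a w ∧ Af a w ≤ 5 := by
  have h1 := Real.neg_pi_div_two_lt_arctan (w - a)
  have h2 := Real.arctan_lt_pi_div_two (w - a)
  have h3 := Real.pi_lt_d2
  unfold Af
  constructor <;> linarith

lemma mf_bd (a w : ℝ) : 0 < mf a w ∧ mf a w ≤ 1 := by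
  unfold mf
  refine ⟨by positivity, ?_⟩
  rw [div_le_one (by positivity)]; nlinarith [sq_nonneg (w - a)]

lemma mf'_bd (a w : ℝ) : |-2 * (w - a) * mf a w ^ 2| ≤ 1 := by
  have h := mf_bd a w
  have h1 : |2 * (w - a)| ≤ 1 + (w - a) ^ 2 := by
    rw [abs_le]; constructor <;> nlinarith [sq_nonneg (w - a + 1), sq_nonneg (w - a - 1)]
  have h2 : (1 + (w - a) ^ 2) * mf a w = 1 := by unfold mf; field_simp
  have : |-2 * (w - a) * mf a w ^ 2| = |2 * (w - a)| * mf a w * mf a w := by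
    rw [abs_mul, abs_of_nonneg (show 0 ≤ mf a w ^ 2 by positivity), show -2 * (w - a) = -(2 * (w - a)) by ring, abs_neg]; ring
  rw [this]
  calc |2 * (w - a)| * mf a w * mf a w ≤ (1 + (w - a) ^ 2) * mf a w * mf a w := by
        have := h.1.le; gcongr
    _ = mf a w := by rw [h2, one_mul]
    _ ≤ 1 := h.2

lemma Af_deriv (a w : ℝ) : HasDerivAt (Af a) (mf a w) w := by
  have := ((hasDerivAt_id w).sub_const a).arctan.const_add (1 + π/2)
  refine this.congr_deriv ?_
  simp [mf]

lemma mf_deriv (a w : ℝ) : HasDerivAt (mf a) (-2 * (w - a) * mf a w ^ 2) w := by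
  have h1 : HasDerivAt (fun w => 1 + (w - a) ^ 2) (2 * (w - a)) w := by
    have := (((hasDerivAt_id w).sub_const a).pow 2).const_add 1
    simpa using this
  have h2 := h1.inv (by positivity)
  have h3 : mf a = (fun w => 1 + (w - a) ^ 2)⁻¹ := by funext w; simp [mf]
  rw [h3]
  refine h2.congr_deriv ?_
  simp only [Pi.inv_apply]
  field_simp

lemma th0_deriv (a : ℝ) {w : ℝ} (hw : 1 ≤ w) : HasDerivAt (th0 a) (th1 a w) w := by
  have h := (Af_deriv a w).div (hasDerivAt_id w) (by simp; linarith)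
  refine h.congr_deriv ?_
  have : w ≠ 0 := by positivity
  simp only [th1, id]
  field_simp

lemma th1_deriv (a : ℝ) {w : ℝ} (hw : 1 ≤ w) : HasDerivAt (th1 a) (th2 a w) w := by
  have hw0 : w ≠ 0 := by positivity
  have h1 := (mf_deriv a w).div (hasDerivAt_id w) (by simpa using hw0)
  have h2 := (Af_deriv a w).div ((hasDerivAt_id w).pow 2) (by simpa using hw0)
  have h := h1.sub h2
  refine h.congr_deriv ?_
  simp only [th2, id, Pi.pow_apply]
  field_simp
  ring

lemma th0_bd (a : ℝ) {w : ℝ} (hw : 1 ≤ w) : |th0 a w| ≤ 5 / w := by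
  have h := Af_bd a w
  rw [th0, abs_of_nonneg (div_nonneg (by linarith) (by linarith))]
  gcongr; exact h.2

lemma th1_bd (a : ℝ) {w : ℝ} (hw : 1 ≤ w) : |th1 a w| ≤ 6 / w := by
  have h := Af_bd a w
  have h' := mf_bd a w
  have e : th1 a w = (mf a w - Af a w / w) / w := by unfold th1; field_simp
  rw [e, abs_div, abs_of_nonneg (show 0 ≤ w by linarith)]
  gcongr
  have h1 : 0 ≤ Af a w / w := div_nonneg (by linarith) (by linarith)
  have h2 : Af a w / w ≤ 5 := by rw [div_le_iff₀ (by linarith)]; nlinarith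
  rw [abs_le]; constructor <;> linarith [h'.1, h'.2]

lemma th2_bd (a : ℝ) {w : ℝ} (hw : 1 ≤ w) : |th2 a w| ≤ 13 / w := by
  have h := Af_bd a w
  have h' := mf_bd a w
  have h'' := abs_le.1 (mf'_bd a w)
  have e : th2 a w = (-2 * (w - a) * mf a w ^ 2 - 2 * (mf a w / w) + 2 * (Af a w / w ^ 2)) / w := by unfold th2; field_simp
  rw [e, abs_div, abs_of_nonneg (show 0 ≤ w by linarith)]
  gcongr
  have h1 : 0 ≤ Af a w / w ^ 2 := div_nonneg (by linarith) (by positivity)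
  have hw2 : 1 ≤ w ^ 2 := one_le_pow₀ hw
  have h2 : Af a w / w ^ 2 ≤ 5 := by rw [div_le_iff₀ (by linarith)]; nlinarith
  have h3 : 0 ≤ mf a w / w := div_nonneg h'.1.le (by linarith)
  have h4 : mf a w / w ≤ 1 := by rw [div_le_iff₀ (by linarith)]; nlinarith
  rw [abs_le]; constructor <;> linarith [h''.1, h''.2]

lemma G_lower (a : ℝ) {w : ℝ} (hw : 1 ≤ w) : mf a w / 3 ≤ th0 a w + (w - 1 / w) * th1 a w := by
  have h := Af_bd a w
  have h' := mf_bd a w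
  have hw0 : w ≠ 0 := by positivity
  have e : th0 a w + (w - 1 / w) * th1 a w = Af a w / w ^ 3 + (1 - 1 / w ^ 2) * mf a w := by
    unfold th0 th1; field_simp; ring
  rw [e]
  have hw3 : 0 < w ^ 3 := by positivity
  have hA : mf a w / w ^ 3 ≤ Af a w / w ^ 3 := by gcongr; linarith
  have key : 1/3 ≤ 1 / w ^ 3 + (1 - 1 / w ^ 2) := by
    have : 1 / w ^ 3 + (1 - 1 / w ^ 2) - 1/3 = (2 * w ^ 3 - 3 * w + 3) / (3 * w ^ 3) := by field_simp; ring
    have h5 : 0 ≤ (2 * w ^ 3 - 3 * w + 3) / (3 * w ^ 3) := by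
      apply div_nonneg _ (by positivity)
      nlinarith [sq_nonneg (w - 1), mul_nonneg (sub_nonneg.2 hw) (sub_nonneg.2 hw)]
    linarith
  calc mf a w / 3 = 1/3 * mf a w := by ring
    _ ≤ (1 / w ^ 3 + (1 - 1 / w ^ 2)) * mf a w := mul_le_mul_of_nonneg_right key h'.1.le
    _ = mf a w / w ^ 3 + (1 - 1 / w ^ 2) * mf a w := by ring
    _ ≤ _ := by linarith

/-- x_i u_j = x_j u_i -/
lemma symm_deriv {k : ℕ} {U : Rd d → ℂ} (hU : Good U) (hi : AEInv k U) {i j : Fin d}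
    (hij : ((i : ℕ) < d - k) ↔ ((j : ℕ) < d - k)) (x : Rd d) :
    (x i : ℂ) * 𝓕⁻ (dV j U) x = (x j : ℂ) * 𝓕⁻ (dV i U) x := by
  by_cases hne : i = j
  · subst hne; rfl
  set v : Rd d := x i • ei j - x j • ei i with hv
  have hsym := hi.symm_inv
  have hvl : ∀ l, v l = if l = j then x i else if l = i then - x j else 0 := by
    intro l
    by_cases h1 : l = j
    · subst h1; simp [hv, ei, Ne.symm hne]
    · by_cases h2 : l = i
      · subst h2; simp [hv, ei, hne]
      · simp [hv, ei, h1, h2]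
  have hgen : ∀ (c : Fin d → ℝ), c i = c j → ∀ t : ℝ,
      ∑ l, c l * (x + t • v) l ^ 2 = ∑ l, c l * (x + (-t) • v) l ^ 2 := by
    intro c hc t
    rw [← sub_eq_zero, ← Finset.sum_sub_distrib]
    have h1 : ∀ l, c l * (x + t • v) l ^ 2 - c l * (x + (-t) • v) l ^ 2 =
        (if l = j then 4 * t * c j * x j * x i else 0) + (if l = i then - (4 * t * c j * x j * x i) else 0) := by
      intro l
      have : c l * (x + t • v) l ^ 2 - c l * (x + (-t) • v) l ^ 2 = 4 * t * c l * x l * v l := by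
        simp only [PiLp.add_apply, PiLp.smul_apply, smul_eq_mul]; ring
      rw [this, hvl]
      by_cases h1 : l = j
      · subst h1; simp [Ne.symm hne]
      · by_cases h2 : l = i
        · subst h2; simp [hne, hc]; ring
        · simp [h1, h2]
    simp only [h1, Finset.sum_add_distrib, Finset.sum_ite_eq', Finset.mem_univ, if_true]
    ring
  have heven : ∀ t : ℝ, 𝓕⁻ U (x + t • v) = 𝓕⁻ U (x + (-t) • v) := by
    intro t
    apply hsym
    · have := hgen (fun l => if (l : ℕ) < d - k then 1 else 0) (by simp only [hij]) t
      simpa [blockSq, ite_mul] using this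
    · have := hgen (fun l => 1) rfl t
      rw [EuclideanSpace.norm_eq, EuclideanSpace.norm_eq]
      congr 1
      simpa [sq_abs] using this
  have hD : HasDerivAt (fun t : ℝ => 𝓕⁻ U (x + t • v)) (𝓕⁻ (fun ξ => (2 * π * ⟪ξ, v⟫ : ℝ) * Complex.I * U ξ) x) 0 :=
    hU.hasLineDerivAt x v
  have hD2 : HasDerivAt (fun t : ℝ => 𝓕⁻ U (x + (-t) • v)) (-(𝓕⁻ (fun ξ => (2 * π * ⟪ξ, v⟫ : ℝ) * Complex.I * U ξ) x)) 0 := by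
    have h0 : HasDerivAt (fun t : ℝ => 𝓕⁻ U (x + t • v)) (𝓕⁻ (fun ξ => (2 * π * ⟪ξ, v⟫ : ℝ) * Complex.I * U ξ) x) (-0) := by
      rwa [neg_zero]
    have := h0.scomp (0:ℝ) (hasDerivAt_neg (0:ℝ))
    exact this.congr_deriv (by simp)
  have hz : 𝓕⁻ (fun ξ => (2 * π * ⟪ξ, v⟫ : ℝ) * Complex.I * U ξ) x = 0 := by
    have h1 := hD.unique (by
      have : (fun t : ℝ => 𝓕⁻ U (x + t • v)) = fun t : ℝ => 𝓕⁻ U (x + (-t) • v) := funext heven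
      rw [this]; exact hD2)
    have h2 : (2:ℂ) * 𝓕⁻ (fun ξ => (2 * π * ⟪ξ, v⟫ : ℝ) * Complex.I * U ξ) x = 0 := by
      linear_combination h1
    simpa using h2
  have hin : ∀ ξ : Rd d, ⟪ξ, v⟫ = x i * ξ j - x j * ξ i := by
    intro ξ
    rw [hv, inner_sub_right, real_inner_smul_right, real_inner_smul_right, ei, ei,
      EuclideanSpace.inner_single_right, EuclideanSpace.inner_single_right]
    simp
  have hlin : (fun ξ => (2 * π * ⟪ξ, v⟫ : ℝ) * Complex.I * U ξ) =
      fun ξ => (x i : ℂ) * dV j U ξ + (-(x j : ℂ)) * dV i U ξ := by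
    funext ξ
    simp only [hin, dV]
    push_cast
    ring
  rw [hlin, invFT_add ((hU.dV j).mul_cont (m := fun _ => (x i : ℂ)) (by fun_prop))
    ((hU.dV i).mul_cont (m := fun _ => (-(x j : ℂ))) (by fun_prop)), invFT_cmul, invFT_cmul] at hz
  linear_combination hz

end

section
variable {d : ℕ}

def Xw (e : Fin d → ℝ) (L a : ℝ) (j : Fin d) (x : Rd d) : ℝ := e j * x j * th0 a (Wf e L x)

def Xw' (e : Fin d → ℝ) (L a : ℝ) (i j : Fin d) (x : Rd d) : ℝ :=
  (if i = j then e j else 0) * th0 a (Wf e L x) + e j * x j * (th1 a (Wf e L x) * (e i * x i / (L ^ 2 * Wf e L x)))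

def Dw (n a w : ℝ) : ℝ := n * th0 a w + (w - 1 / w) * th1 a w
def Dw' (n a w : ℝ) : ℝ := n * th1 a w + ((1 + 1 / w ^ 2) * th1 a w + (w - 1 / w) * th2 a w)

def Dx (e : Fin d → ℝ) (L a : ℝ) (x : Rd d) : ℝ := Dw (∑ i, e i) a (Wf e L x)
def Dx' (e : Fin d → ℝ) (L a : ℝ) (i : Fin d) (x : Rd d) : ℝ :=
  Dw' (∑ i, e i) a (Wf e L x) * (e i * x i / (L ^ 2 * Wf e L x))

lemma Dw_deriv (n a : ℝ) {w : ℝ} (hw : 1 ≤ w) : HasDerivAt (Dw n a) (Dw' n a w) w := by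
  have hw0 : w ≠ 0 := by positivity
  have h1 := (th0_deriv a hw).const_mul n
  have h2 : HasDerivAt (fun w : ℝ => w - 1 / w) (1 + 1 / w ^ 2) w := by
    have := (hasDerivAt_id w).sub ((hasDerivAt_const w (1:ℝ)).div (hasDerivAt_id w) hw0)
    refine this.congr_deriv ?_
    simp; ring
  exact h1.add (h2.mul (th1_deriv a hw))

lemma Af_cont (a : ℝ) : Continuous (Af a) := by unfold Af; fun_prop
lemma mf_cont (a : ℝ) : Continuous (mf a) := by
  unfold mf
  exact continuous_const.div (by fun_prop) (fun w => by positivity)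

section wts

lemma th_cont {e : Fin d → ℝ} (he : Blk e) (a : ℝ) (L : ℝ) : Continuous (fun x => th0 a (Wf e L x)) ∧ Continuous (fun x => th1 a (Wf e L x)) ∧
    Continuous (fun x => th2 a (Wf e L x)) ∧ Continuous (fun x => 1 / Wf e L x) := by
  have hW := Wf_cont (e := e) L
  have hA := (Af_cont a).comp hW
  have hm := (mf_cont a).comp hW
  have hne : ∀ x, Wf e L x ≠ 0 := fun x => by have := Wf_ge he L x; positivity
  simp only [Function.comp_def] at hA hm
  refine ⟨?_, ?_, ?_, continuous_const.div hW hne⟩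
  · exact hA.div hW hne
  · exact (hm.div hW hne).sub (hA.div (hW.pow 2) fun x => pow_ne_zero _ (hne x))
  · unfold th2
    refine ((((continuous_const.mul (hW.sub continuous_const)).mul (hm.pow 2)).div hW hne).sub
      ((continuous_const.mul hm).div (hW.pow 2) fun x => pow_ne_zero _ (hne x))).add
      ((continuous_const.mul hA).div (hW.pow 3) fun x => pow_ne_zero _ (hne x))

lemma ratio_cont {e : Fin d → ℝ} (he : Blk e) {L : ℝ} (hL : 0 < L) (i : Fin d) : Continuous fun x : Rd d => e i * x i / (L ^ 2 * Wf e L x) := by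
  refine Continuous.div (by fun_prop) (continuous_const.mul (Wf_cont L)) fun x => ?_
  have := Wf_ge he L x; positivity

lemma Xw_wt {e : Fin d → ℝ} (he : Blk e) {L : ℝ} (hL : 0 < L) (a : ℝ) (j : Fin d) : Wt (Xw e L a j) (5 * L) := by
  refine ⟨?_, fun x => ?_⟩
  · unfold Xw
    exact (by fun_prop : Continuous fun x : Rd d => e j * x j).mul (th_cont he a L).1
  · have hW := Wf_ge he L x
    rw [Xw, abs_mul]
    calc _ ≤ (L * Wf e L x) * (5 / Wf e L x) := by
          gcongr
          · exact Wf_coord he hL x j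
          · exact th0_bd a hW
      _ = _ := by field_simp

lemma Xw'_wt {e : Fin d → ℝ} (he : Blk e) {L : ℝ} (hL : 0 < L) (a : ℝ) (i j : Fin d) : Wt (Xw' e L a i j) 11 := by
  refine ⟨?_, fun x => ?_⟩
  · unfold Xw'
    exact (continuous_const.mul (th_cont he a L).1).add
      ((by fun_prop : Continuous fun x : Rd d => e j * x j).mul ((th_cont he a L).2.1.mul (ratio_cont he hL i)))
  · have hW := Wf_ge he L x
    rw [Xw']
    refine (abs_add_le _ _).trans ?_
    rw [abs_mul (ite _ _ _) _, abs_mul (e j * x j) _, abs_mul (th1 _ _) _]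
    have h0 : |if i = j then e j else 0| ≤ 1 := by
      split_ifs
      · rw [abs_of_nonneg (he.nonneg j)]; exact he.le_one j
      · simp
    have h1 : |th0 a (Wf e L x)| ≤ 5 := (th0_bd a hW).trans (by rw [div_le_iff₀ (by linarith)]; nlinarith)
    calc _ ≤ 1 * 5 + (L * Wf e L x) * ((6 / Wf e L x) * (1 / L)) := by
          gcongr
          · exact Wf_coord he hL x j
          · exact th1_bd a hW
          · exact Wf_ratio he hL x i
      _ = _ := by field_simp; norm_num

lemma sum_e_le {e : Fin d → ℝ} (he : Blk e) : 0 ≤ ∑ i, e i ∧ ∑ i, e i ≤ d := by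
  refine ⟨Finset.sum_nonneg fun i _ => he.nonneg i, ?_⟩
  have := Finset.sum_le_sum (fun i (_ : i ∈ Finset.univ) => he.le_one i)
  simpa using this

lemma Dx_wt {e : Fin d → ℝ} (he : Blk e) {L : ℝ} (_hL : 0 < L) (a : ℝ) : Wt (Dx e L a) (5 * d + 6) := by
  refine ⟨?_, fun x => ?_⟩
  · unfold Dx Dw
    have h := th_cont he a L
    exact (continuous_const.mul h.1).add (((Wf_cont L).sub h.2.2.2).mul h.2.1)
  · have hW := Wf_ge he L x
    have hn := sum_e_le he
    set w := Wf e L x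
    rw [Dx, Dw]
    refine (abs_add_le _ _).trans ?_
    rw [abs_mul, abs_mul, abs_of_nonneg hn.1]
    have h1 : |th0 a w| ≤ 5 := (th0_bd a hW).trans (by rw [div_le_iff₀ (by linarith)]; nlinarith)
    have hiw : 0 < 1 / w := by positivity
    have hiw1 : 1 / w ≤ 1 := by rw [div_le_one (by linarith)]; exact hW
    have h2 : |w - 1 / w| ≤ w := by rw [abs_le]; constructor <;> linarith
    calc _ ≤ (d:ℝ) * 5 + w * (6 / w) := by
          gcongr
          · exact hn.2
          · exact th1_bd a hW
      _ = _ := by field_simp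

lemma Dx'_wt {e : Fin d → ℝ} (he : Blk e) {L : ℝ} (hL : 0 < L) (a : ℝ) (i : Fin d) : Wt (Dx' e L a i) ((6 * d + 25) / L) := by
  refine ⟨?_, fun x => ?_⟩
  · unfold Dx' Dw'
    have h := th_cont he a L
    refine ((continuous_const.mul h.2.1).add (((continuous_const.add ?_).mul h.2.1).add
      (((Wf_cont L).sub h.2.2.2).mul h.2.2.1))).mul (ratio_cont he hL i)
    exact continuous_const.div ((Wf_cont L).pow 2) (fun x => pow_ne_zero _ (by have := Wf_ge he L x; positivity))
  · have hW := Wf_ge he L x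
    have hn := sum_e_le he
    rw [Dx', abs_mul]
    have hr := Wf_ratio he hL x i
    set w := Wf e L x
    have hiw : 0 < 1 / w := by positivity
    have hiw1 : 1 / w ≤ 1 := by rw [div_le_one (by linarith)]; exact hW
    have h2 : |w - 1 / w| ≤ w := by rw [abs_le]; constructor <;> linarith
    have h6 : 6 / w ≤ 6 := by rw [div_le_iff₀ (by linarith)]; nlinarith
    have h1 : |th1 a w| ≤ 6 := (th1_bd a hW).trans h6
    have h3 : |1 + 1 / w ^ 2| ≤ 2 := by
      rw [abs_of_nonneg (by positivity)]
      have : 1 / w ^ 2 ≤ 1 := by rw [div_le_one (by positivity)]; exact one_le_pow₀ hW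
      linarith
    have h4 : |Dw' (∑ i, e i) a w| ≤ 6 * d + 25 := by
      rw [Dw']
      refine (abs_add_le _ _).trans ?_
      refine (add_le_add le_rfl (abs_add_le _ _)).trans ?_
      rw [abs_mul, abs_mul, abs_mul, abs_of_nonneg hn.1]
      calc _ ≤ (d:ℝ) * 6 + (2 * 6 + w * (13 / w)) := by
            gcongr
            · exact hn.2
            · exact th2_bd a hW
        _ = _ := by field_simp; ring
    calc _ ≤ (6 * d + 25) * (1 / L) := by gcongr
      _ = _ := by ring

lemma Xw_deriv {e : Fin d → ℝ} (he : Blk e) (a : ℝ) (L : ℝ) (i j : Fin d) (x : Rd d) : HasLineDerivAt ℝ (Xw e L a j) (Xw' e L a i j x) x (ei i) := by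
  have h1 : HasDerivAt (fun t : ℝ => th0 a (Wf e L (x + t • ei i))) _ 0 :=
    Wf_comp he L x i (th0_deriv a (Wf_ge he L x))
  have h2 : HasDerivAt (fun t : ℝ => e j * (x + t • ei i) j) (if i = j then e j else 0) 0 := by
    have : (fun t : ℝ => e j * (x + t • ei i) j) = fun t => e j * x j + t * (if i = j then e j else 0) := by
      funext t
      by_cases h : i = j
      · subst h; simp [ei]; ring
      · simp [ei, h, Ne.symm h]
    rw [this]
    have := ((hasDerivAt_id (0:ℝ)).mul_const (if i = j then e j else 0)).const_add (e j * x j)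
    simpa using this
  have h3 := h2.mul h1
  simp only [zero_smul, add_zero] at h3
  exact h3

lemma Dx_deriv {e : Fin d → ℝ} (he : Blk e) (a : ℝ) (L : ℝ) (i : Fin d) (x : Rd d) : HasLineDerivAt ℝ (Dx e L a) (Dx' e L a i x) x (ei i) :=
  Wf_comp he L x i (Dw_deriv _ a (Wf_ge he L x))

lemma sum_Xw' {e : Fin d → ℝ} (he : Blk e) {L : ℝ} (hL : 0 < L) (a : ℝ) (x : Rd d) : ∑ j, Xw' e L a j j x = Dx e L a x := by
  have hW := Wf_ge he L x
  have h2 := Wf_sq he L x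
  simp only [Xw', if_true, Finset.sum_add_distrib, ← Finset.sum_mul]
  rw [Dx, Dw]
  congr 1
  have h3 : ∀ j, e j * x j * (th1 a (Wf e L x) * (e j * x j / (L ^ 2 * Wf e L x))) =
      (e j * x j ^ 2) * (th1 a (Wf e L x) / (L ^ 2 * Wf e L x)) := by
    intro j
    have : e j * x j * (e j * x j) = e j * x j ^ 2 := by
      rw [← he.sq j]; rw [he.sq j]; linear_combination x j ^ 2 * he.sq j
    linear_combination (th1 a (Wf e L x) / (L ^ 2 * Wf e L x)) * this
  simp only [h3, ← Finset.sum_mul]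
  have h4 : ∑ i, e i * x i ^ 2 = L ^ 2 * (Wf e L x ^ 2 - 1) := by
    rw [h2]; rw [← Nf]; field_simp; ring
  rw [h4]
  field_simp
end wts

lemma Bf_sum_w {ι : Type*} (S : Finset ι) {A : ι → Rd d → ℝ} {M : ℝ} (hA : ∀ i, Wt (A i) M) {V W : Rd d → ℂ}
    (hV : Good V) (hW : Good W) : Bf (fun x => ∑ i ∈ S, A i x) V W = ∑ i ∈ S, Bf (A i) V W := by
  simp only [Bf, Finset.sum_mul]
  rw [integral_finsetSum _ fun i _ => Bf_int1 (hA i) hV hW]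

lemma virial {e : Fin d → ℝ} (he : Blk e) {L : ℝ} (hL : 0 < L) (a : ℝ) {U : Rd d → ℂ} (hU : Good U) :
    ∑ j, 2 * Bf (Xw e L a j) (gV U) (dV j U) + Bf (Dx e L a) (gV U) U =
      - (2 * ∑ j, ∑ i, Bf (Xw' e L a i j) (dV i U) (dV j U)) - ∑ i, Bf (Dx' e L a i) (dV i U) U := by
  have hX := Xw_wt he hL a
  have hX' := Xw'_wt he hL a
  have hD := Dx_wt he hL a
  have hD' := Dx'_wt he hL a
  have e1 : ∀ j, Bf (Xw e L a j) (gV U) (dV j U) =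
      ∑ i, Bf (Xw e L a j) (dV i (dV i U)) (dV j U) + 4 * π ^ 2 * Bf (Xw e L a j) U (dV j U) :=
    fun j => Bf_gV (hX j) hU (hU.dV j)
  have e2 : Bf (Dx e L a) (gV U) U =
      ∑ i, Bf (Dx e L a) (dV i (dV i U)) U + 4 * π ^ 2 * Bf (Dx e L a) U U := Bf_gV hD hU hU
  have e3 : ∀ i j, Bf (Xw e L a j) (dV i (dV i U)) (dV j U) =
      - Bf (Xw' e L a i j) (dV i U) (dV j U) - Bf (Xw e L a j) (dV i U) (dV j (dV i U)) := by
    intro i j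
    have := ibp (hX j) (hX' i j) (hU.dV i) (hU.dV j) i (fun x => Xw_deriv he a L i j x)
    rw [dV_comm i j] at this
    linarith
  have e4 : ∀ i j, 2 * Bf (Xw e L a j) (dV i U) (dV j (dV i U)) = - Bf (Xw' e L a j j) (dV i U) (dV i U) := by
    intro i j
    have := ibp (hX j) (hX' j j) (hU.dV i) (hU.dV i) j (fun x => Xw_deriv he a L j j x)
    rw [Bf_symm _ (dV j (dV i U))] at this
    linarith
  have e5 : ∀ j, 2 * Bf (Xw e L a j) U (dV j U) = - Bf (Xw' e L a j j) U U := by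
    intro j
    have := ibp (hX j) (hX' j j) hU hU j (fun x => Xw_deriv he a L j j x)
    rw [Bf_symm _ (dV j U)] at this
    linarith
  have e6 : ∀ i, Bf (Dx e L a) (dV i (dV i U)) U = - Bf (Dx e L a) (dV i U) (dV i U) - Bf (Dx' e L a i) (dV i U) U := by
    intro i
    have := ibp hD (hD' i) (hU.dV i) hU i (fun x => Dx_deriv he a L i x)
    linarith
  have e7 : ∀ V, Good V → ∑ j, Bf (Xw' e L a j j) V V = Bf (Dx e L a) V V := by
    intro V hV
    rw [← Bf_sum_w _ (fun j => hX' j j) hV hV]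
    congr 1; funext x; exact sum_Xw' he hL a x
  have s1 : ∑ j, 2 * Bf (Xw e L a j) (gV U) (dV j U) =
      - (2 * ∑ j, ∑ i, Bf (Xw' e L a i j) (dV i U) (dV j U)) + ∑ j, ∑ i, Bf (Xw' e L a j j) (dV i U) (dV i U)
        - 4 * π ^ 2 * ∑ j, Bf (Xw' e L a j j) U U := by
    rw [Finset.mul_sum, Finset.mul_sum, ← Finset.sum_neg_distrib, ← Finset.sum_add_distrib, ← Finset.sum_sub_distrib]
    refine Finset.sum_congr rfl fun j _ => ?_
    rw [e1, mul_add, Finset.mul_sum, Finset.mul_sum, ← Finset.sum_neg_distrib, ← Finset.sum_add_distrib]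
    have : 2 * (4 * π ^ 2 * Bf (Xw e L a j) U (dV j U)) = - (4 * π ^ 2 * Bf (Xw' e L a j j) U U) := by
      linear_combination 4 * π ^ 2 * e5 j
    rw [this, ← sub_eq_add_neg]
    congr 1
    refine Finset.sum_congr rfl fun i _ => ?_
    linear_combination 2 * e3 i j - e4 i j
  rw [s1, e2, e7 U hU, Finset.sum_comm (f := fun j i => Bf (Xw' e L a j j) (dV i U) (dV i U))]
  simp only [e7 _ (hU.dV _), e6, Finset.sum_sub_distrib, Finset.sum_neg_distrib]
  ring

end

section
variable {d : ℕ}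

def Kv (d : ℕ) : ℝ := 20000 * ((d:ℝ) + 1) ^ 2

lemma mfW_wt {e : Fin d → ℝ} (L a : ℝ) : Wt (fun x => mf a (Wf e L x)) 1 := by
  refine ⟨(mf_cont a).comp (Wf_cont L), fun x => ?_⟩
  have := mf_bd a (Wf e L x)
  rw [abs_of_pos this.1]; exact this.2

lemma pt_lower {k : ℕ} {e : Fin d → ℝ} (he : Blk e) {L : ℝ} (hL : 0 < L) (a : ℝ)
    (hS : ∀ i j, e i = 1 → e j = 1 → (((i : ℕ) < d - k) ↔ ((j : ℕ) < d - k)))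
    {U : Rd d → ℂ} (hU : Good U) (hi : AEInv k U) (x : Rd d) :
    ∑ i, e i * (mf a (Wf e L x) * inner ℝ (𝓕⁻ (dV i U) x) (𝓕⁻ (dV i U) x)) / 3 ≤
      ∑ j, ∑ i, Xw' e L a i j x * inner ℝ (𝓕⁻ (dV i U) x) (𝓕⁻ (dV j U) x) := by
  have hW := Wf_ge he L x
  have h2 := Wf_sq he L x
  have hG := G_lower a hW
  set w := Wf e L x with hw
  set I : Fin d → Fin d → ℝ := fun i j => inner ℝ (𝓕⁻ (dV i U) x) (𝓕⁻ (dV j U) x) with hI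
  have hII : ∀ i, 0 ≤ I i i := fun i => real_inner_self_nonneg
  have key : ∀ i j, e i * e j * (x i * x j * I i j) = e i * e j * (x j ^ 2 * I i i) := by
    intro i j
    rcases he.or i with h | h
    · simp [h]
    rcases he.or j with h' | h'
    · simp [h']
    have hs := symm_deriv hU hi (hS i j h h') x
    have : x i * I i j = x j * I i i := by
      have e1 : x i * I i j = inner ℝ (𝓕⁻ (dV i U) x) ((x i) • 𝓕⁻ (dV j U) x) := by
        rw [real_inner_smul_right]
      have e2 : x j * I i i = inner ℝ (𝓕⁻ (dV i U) x) ((x j) • 𝓕⁻ (dV i U) x) := by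
        rw [real_inner_smul_right]
      rw [e1, e2, Complex.real_smul, Complex.real_smul, hs]
    linear_combination e i * e j * x j * this
  have e0 : ∀ j i, Xw' e L a i j x * I i j =
      (if i = j then e j * th0 a w * I i j else 0) + (e j * x j ^ 2) * ((th1 a w / (L ^ 2 * w)) * (e i * I i i)) := by
    intro j i
    have := key i j
    simp only [Xw', ← hw]
    have h3 : (if i = j then e j else 0) * th0 a w * I i j = (if i = j then e j * th0 a w * I i j else 0) := by
      split_ifs <;> simp
    rw [add_mul, h3]
    congr 1
    linear_combination (th1 a w / (L ^ 2 * w)) * this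
  have e1 : ∑ j, ∑ i, Xw' e L a i j x * I i j = (th0 a w + (w - 1 / w) * th1 a w) * ∑ i, e i * I i i := by
    simp only [e0, Finset.sum_add_distrib, Finset.sum_ite_eq', Finset.mem_univ, if_true]
    simp only [← Finset.mul_sum, ← Finset.sum_mul]
    have h4 : ∑ i, e i * x i ^ 2 = L ^ 2 * (w ^ 2 - 1) := by
      rw [h2]; rw [← Nf]; field_simp; ring
    rw [h4]
    have h5 : L ^ 2 * (w ^ 2 - 1) * (th1 a w / (L ^ 2 * w) * ∑ i, e i * I i i) =
        (w - 1 / w) * th1 a w * ∑ i, e i * I i i := by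
      field_simp
    rw [h5, add_mul]
    congr 1
    rw [Finset.mul_sum]
    exact Finset.sum_congr rfl fun i _ => by ring
  have e2 : ∑ i, e i * (mf a w * I i i) / 3 = (mf a w / 3) * ∑ i, e i * I i i := by
    rw [Finset.mul_sum]
    exact Finset.sum_congr rfl fun i _ => by ring
  rw [e1, e2]
  exact mul_le_mul_of_nonneg_right hG (Finset.sum_nonneg fun i _ => mul_nonneg (he.nonneg i) (hII i))

lemma block_est {k : ℕ} {e : Fin d → ℝ} (he : Blk e) {L : ℝ} (hL : 0 < L) (a : ℝ)
    (hS : ∀ i j, e i = 1 → e j = 1 → (((i : ℕ) < d - k) ↔ ((j : ℕ) < d - k)))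
    {U : Rd d → ℂ} (hU : Good U) (hi : AEInv k U) {h : ℝ} (h0 : 0 ≤ h) (hh : h ≤ 1/4)
    (hs : ∀ ξ, U ξ ≠ 0 → |‖ξ‖ - 1| ≤ h) :
    ∑ i, e i * Bf (fun x => mf a (Wf e L x)) (dV i U) (dV i U) ≤ Kv d * (h * L + h + 1 / L) * nn U ^ 2 := by
  have hv := virial he hL a hU
  set N := nn U with hN
  have hN0 : 0 ≤ N := nn_nonneg U
  have hd := nn_dV hU hh hs
  have hg := nn_gV hU h0 hh hs
  have hX := Xw_wt he hL a
  have hX' := Xw'_wt he hL a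
  have hD := Dx_wt he hL a
  have hD' := Dx'_wt he hL a
  have hT : ∑ i, e i * Bf (fun x => mf a (Wf e L x)) (dV i U) (dV i U) / 3 ≤
      ∑ j, ∑ i, Bf (Xw' e L a i j) (dV i U) (dV j U) := by
    have i1 : ∀ i, Integrable (fun x => e i * (mf a (Wf e L x) * inner ℝ (𝓕⁻ (dV i U) x) (𝓕⁻ (dV i U) x)) / 3) volume :=
      fun i => (((Bf_int1 (mfW_wt L a) (hU.dV i) (hU.dV i)).const_mul (e i)).div_const 3)
    have i2 : ∀ j i, Integrable (fun x => Xw' e L a i j x * inner ℝ (𝓕⁻ (dV i U) x) (𝓕⁻ (dV j U) x)) volume :=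
      fun j i => Bf_int1 (hX' i j) (hU.dV i) (hU.dV j)
    have l1 : ∑ i, e i * Bf (fun x => mf a (Wf e L x)) (dV i U) (dV i U) / 3 =
        ∫ x, ∑ i, e i * (mf a (Wf e L x) * inner ℝ (𝓕⁻ (dV i U) x) (𝓕⁻ (dV i U) x)) / 3 := by
      rw [integral_finsetSum _ fun i _ => i1 i]
      refine Finset.sum_congr rfl fun i _ => ?_
      rw [integral_div, integral_const_mul, Bf]
    have l2 : ∑ j, ∑ i, Bf (Xw' e L a i j) (dV i U) (dV j U) =
        ∫ x, ∑ j, ∑ i, Xw' e L a i j x * inner ℝ (𝓕⁻ (dV i U) x) (𝓕⁻ (dV j U) x) := by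
      rw [integral_finsetSum _ fun j _ => integrable_finsetSum _ fun i _ => i2 j i]
      refine Finset.sum_congr rfl fun j _ => ?_
      rw [integral_finsetSum _ fun i _ => i2 j i]
      rfl
    rw [l1, l2]
    refine integral_mono (integrable_finsetSum _ fun i _ => i1 i)
      (integrable_finsetSum _ fun j _ => integrable_finsetSum _ fun i _ => i2 j i) fun x => ?_
    exact pt_lower he hL a hS hU hi x
  rw [← Finset.sum_div] at hT
  have b1 : -(∑ j, 2 * Bf (Xw e L a j) (gV U) (dV j U)) ≤ d * (7200 * (h * L) * N ^ 2) := by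
    rw [← Finset.sum_neg_distrib]
    calc _ ≤ ∑ j : Fin d, (7200 * (h * L) * N ^ 2) := Finset.sum_le_sum fun j _ => by
          have := (neg_le_abs _).trans (Bf_le (hX j) hU.gV (hU.dV j))
          have h2 : 5 * L * (nn (gV U) * nn (dV j U)) ≤ 5 * L * ((90 * h * N) * (8 * N)) := by
            gcongr
            · exact nn_nonneg _
            · exact hd j
          linarith
      _ = _ := by simp
  have b2 : -(Bf (Dx e L a) (gV U) U) ≤ (5 * d + 6) * (90 * h * N ^ 2) := by
    have := (neg_le_abs _).trans (Bf_le hD hU.gV hU)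
    have h2 : (5 * d + 6) * (nn (gV U) * nn U) ≤ (5 * (d:ℝ) + 6) * ((90 * h * N) * N) := by gcongr
    linarith
  have b3 : -(∑ i, Bf (Dx' e L a i) (dV i U) U) ≤ d * ((6 * d + 25) * 8 * (1 / L) * N ^ 2) := by
    rw [← Finset.sum_neg_distrib]
    calc _ ≤ ∑ j : Fin d, ((6 * d + 25) * 8 * (1 / L) * N ^ 2) := Finset.sum_le_sum fun j _ => by
          have := (neg_le_abs _).trans (Bf_le (hD' j) (hU.dV j) hU)
          have h2 : (6 * d + 25) / L * (nn (dV j U) * nn U) ≤ (6 * (d:ℝ) + 25) / L * ((8 * N) * N) := by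
            gcongr; exact hd j
          calc _ ≤ _ := this
            _ ≤ _ := h2
            _ = _ := by ring
      _ = _ := by simp
  set T := ∑ i, e i * Bf (fun x => mf a (Wf e L x)) (dV i U) (dV i U)
  have f1 : T ≤ 3 / 2 * (d * (7200 * (h * L) * N ^ 2) + (5 * d + 6) * (90 * h * N ^ 2)
      + d * ((6 * d + 25) * 8 * (1 / L) * N ^ 2)) := by linarith
  refine f1.trans ?_
  have hd0 : (0:ℝ) ≤ d := by positivity
  have c1 : 3 / 2 * (d * 7200) ≤ Kv d := by unfold Kv; nlinarith
  have c2 : 3 / 2 * ((5 * d + 6) * 90) ≤ Kv d := by unfold Kv; nlinarith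
  have c3 : 3 / 2 * (d * ((6 * d + 25) * 8)) ≤ Kv d := by unfold Kv; nlinarith
  have q1 : 0 ≤ h * L * N ^ 2 := by positivity
  have q2 : 0 ≤ h * N ^ 2 := by positivity
  have q3 : 0 ≤ 1 / L * N ^ 2 := by positivity
  nlinarith [mul_le_mul_of_nonneg_right c1 q1, mul_le_mul_of_nonneg_right c2 q2, mul_le_mul_of_nonneg_right c3 q3]

def e1b (d k : ℕ) (i : Fin d) : ℝ := if (i : ℕ) < d - k then 1 else 0
def e2b (d k : ℕ) (i : Fin d) : ℝ := if (i : ℕ) < d - k then 0 else 1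

lemma e1b_blk (d k : ℕ) : Blk (e1b d k) := ⟨fun i => by unfold e1b; split_ifs <;> simp⟩
lemma e2b_blk (d k : ℕ) : Blk (e2b d k) := ⟨fun i => by unfold e2b; split_ifs <;> simp⟩

def om (k : ℕ) (L a b : ℝ) (x : Rd d) : ℝ := mf a (Wf (e1b d k) L x) * mf b (Wf (e2b d k) L x)

def om' (k : ℕ) (L a b : ℝ) (i : Fin d) (x : Rd d) : ℝ :=
  (-2 * (Wf (e1b d k) L x - a) * mf a (Wf (e1b d k) L x) ^ 2 * (e1b d k i * x i / (L ^ 2 * Wf (e1b d k) L x))) *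
    mf b (Wf (e2b d k) L x) +
  mf a (Wf (e1b d k) L x) *
    (-2 * (Wf (e2b d k) L x - b) * mf b (Wf (e2b d k) L x) ^ 2 * (e2b d k i * x i / (L ^ 2 * Wf (e2b d k) L x)))

lemma om_wt (k : ℕ) (L a b : ℝ) : Wt (om (d := d) k L a b) 1 := by
  refine ⟨(mfW_wt L a).cont.mul (mfW_wt L b).cont, fun x => ?_⟩
  rw [om, abs_mul]
  have h1 := (mfW_wt (e := e1b d k) L a).bd x
  have h2 := (mfW_wt (e := e2b d k) L b).bd x
  exact mul_le_one₀ h1 (abs_nonneg _) h2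

lemma om'_wt (k : ℕ) {L : ℝ} (hL : 0 < L) (a b : ℝ) (i : Fin d) : Wt (om' k L a b i) (2 / L) := by
  refine ⟨?_, fun x => ?_⟩
  · unfold om'
    have c1 := (mfW_wt (e := e1b d k) L a).cont
    have c2 := (mfW_wt (e := e2b d k) L b).cont
    refine ((((continuous_const.mul ((Wf_cont L).sub continuous_const)).mul (c1.pow 2)).mul
      (ratio_cont (e1b_blk d k) hL i)).mul c2).add (c1.mul (((continuous_const.mul ((Wf_cont L).sub continuous_const)).mul
        (c2.pow 2)).mul (ratio_cont (e2b_blk d k) hL i)))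
  · unfold om'
    refine (abs_add_le _ _).trans ?_
    have h1 := (mfW_wt (e := e1b d k) L a).bd x
    have h2 := (mfW_wt (e := e2b d k) L b).bd x
    have h3 := mf'_bd a (Wf (e1b d k) L x)
    have h4 := mf'_bd b (Wf (e2b d k) L x)
    have h5 := Wf_ratio (e1b_blk d k) hL x i
    have h6 := Wf_ratio (e2b_blk d k) hL x i
    generalize e1b d k i * x i / (L ^ 2 * Wf (e1b d k) L x) = r1 at *
    generalize e2b d k i * x i / (L ^ 2 * Wf (e2b d k) L x) = r2 at *
    generalize -2 * (Wf (e1b d k) L x - a) * mf a (Wf (e1b d k) L x) ^ 2 = s1 at *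
    generalize -2 * (Wf (e2b d k) L x - b) * mf b (Wf (e2b d k) L x) ^ 2 = s2 at *
    rw [abs_mul, abs_mul, abs_mul, abs_mul]
    calc _ ≤ (1 * (1 / L)) * 1 + 1 * (1 * (1 / L)) := by gcongr
      _ = _ := by ring

lemma om_deriv (k : ℕ) (L a b : ℝ) (i : Fin d) (x : Rd d) :
    HasLineDerivAt ℝ (om k L a b) (om' k L a b i x) x (ei i) := by
  have h1 : HasDerivAt (fun t : ℝ => mf a (Wf (e1b d k) L (x + t • ei i))) _ 0 :=
    Wf_comp (e1b_blk d k) L x i (mf_deriv a (Wf (e1b d k) L x))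
  have h2 : HasDerivAt (fun t : ℝ => mf b (Wf (e2b d k) L (x + t • ei i))) _ 0 :=
    Wf_comp (e2b_blk d k) L x i (mf_deriv b (Wf (e2b d k) L x))
  have h3 := h1.mul h2
  simp only [zero_smul, add_zero] at h3
  exact h3

lemma Bf_mono {a a' : Rd d → ℝ} {M M' : ℝ} (ha : Wt a M) (ha' : Wt a' M') {V : Rd d → ℂ} (hV : Good V)
    (h : ∀ x, a x ≤ a' x) : Bf a V V ≤ Bf a' V V :=
  integral_mono (Bf_int1 ha hV hV) (Bf_int1 ha' hV hV) fun x =>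
    mul_le_mul_of_nonneg_right (h x) real_inner_self_nonneg

lemma om_est {k : ℕ} {L : ℝ} (hL : 0 < L) (a b : ℝ)
    {U : Rd d → ℂ} (hU : Good U) (hi : AEInv k U) {h : ℝ} (h0 : 0 ≤ h) (hh : h ≤ 1/4)
    (hs : ∀ ξ, U ξ ≠ 0 → |‖ξ‖ - 1| ≤ h) :
    ∫ x, om k L a b x * ‖𝓕⁻ U x‖ ^ 2 ≤ 3 * Kv d * (h * L + h + 1 / L) * nn U ^ 2 := by
  have hB : ∫ x, om k L a b x * ‖𝓕⁻ U x‖ ^ 2 = Bf (om k L a b) U U := by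
    simp only [Bf, real_inner_self_eq_norm_sq]
  rw [hB]
  set N := nn U with hN
  have hN0 : 0 ≤ N := nn_nonneg U
  have hd := nn_dV hU hh hs
  have hg := nn_gV hU h0 hh hs
  have t1 := block_est (e1b_blk d k) hL a (fun i j h1 h2 => by
    unfold e1b at h1 h2; split_ifs at h1 h2 <;> simp_all) hU hi h0 hh hs
  have t2 := block_est (e2b_blk d k) hL b (fun i j h1 h2 => by
    have q1 : ¬ ((i:ℕ) < d - k) := fun q => by simp [e2b, q] at h1
    have q2 : ¬ ((j:ℕ) < d - k) := fun q => by simp [e2b, q] at h2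
    exact ⟨fun q => absurd q q1, fun q => absurd q q2⟩) hU hi h0 hh hs
  have hw := om_wt (d := d) k L a b
  have hw' := om'_wt (d := d) k hL a b
  have q := Bf_gV hw hU hU
  have q2 : ∀ i, Bf (om k L a b) (dV i (dV i U)) U = - Bf (om k L a b) (dV i U) (dV i U) - Bf (om' k L a b i) (dV i U) U := by
    intro i
    have := ibp hw (hw' i) (hU.dV i) hU i (fun x => om_deriv k L a b i x)
    linarith
  simp only [q2, Finset.sum_sub_distrib, Finset.sum_neg_distrib] at q
  have r1 : Bf (om k L a b) (gV U) U ≤ 90 * h * N ^ 2 := by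
    have := (le_abs_self _).trans (Bf_le hw hU.gV hU)
    have h2 : nn (gV U) * nn U ≤ (90 * h * N) * N := by gcongr
    linarith
  have r2 : ∑ i, Bf (om' k L a b i) (dV i U) U ≤ d * (16 * (1 / L) * N ^ 2) := by
    calc _ ≤ ∑ j : Fin d, (16 * (1 / L) * N ^ 2) := Finset.sum_le_sum fun j _ => by
          have := (le_abs_self _).trans (Bf_le (hw' j) (hU.dV j) hU)
          have h2 : 2 / L * (nn (dV j U) * nn U) ≤ 2 / L * ((8 * N) * N) := by
            gcongr; exact hd j
          calc _ ≤ _ := this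
            _ ≤ _ := h2
            _ = _ := by ring
      _ = _ := by simp
  have r3 : ∑ i, Bf (om k L a b) (dV i U) (dV i U) ≤
      ∑ i, e1b d k i * Bf (fun x => mf a (Wf (e1b d k) L x)) (dV i U) (dV i U) +
      ∑ i, e2b d k i * Bf (fun x => mf b (Wf (e2b d k) L x)) (dV i U) (dV i U) := by
    rw [← Finset.sum_add_distrib]
    refine Finset.sum_le_sum fun i _ => ?_
    have m1 : Bf (om k L a b) (dV i U) (dV i U) ≤ Bf (fun x => mf a (Wf (e1b d k) L x)) (dV i U) (dV i U) := by
      refine Bf_mono hw (mfW_wt L a) (hU.dV i) fun x => ?_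
      exact mul_le_of_le_one_right (mf_bd _ _).1.le (mf_bd _ _).2
    have m2 : Bf (om k L a b) (dV i U) (dV i U) ≤ Bf (fun x => mf b (Wf (e2b d k) L x)) (dV i U) (dV i U) := by
      refine Bf_mono hw (mfW_wt L b) (hU.dV i) fun x => ?_
      exact mul_le_of_le_one_left (mf_bd _ _).1.le (mf_bd _ _).2
    unfold e1b e2b
    unfold e1b at m1
    unfold e2b at m2
    by_cases hi : (i:ℕ) < d - k
    · simp only [if_pos hi, one_mul, zero_mul, add_zero]; exact m1
    · simp only [if_neg hi, one_mul, zero_mul, zero_add]; exact m2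
  have hB0 : 0 ≤ Bf (om k L a b) U U := integral_nonneg fun x =>
    mul_nonneg (mul_nonneg (mf_bd _ _).1.le (mf_bd _ _).1.le) real_inner_self_nonneg
  have hpi : 1 ≤ 4 * π ^ 2 := by nlinarith [Real.pi_gt_three]
  have f : Bf (om k L a b) U U ≤ 90 * h * N ^ 2 + 2 * (Kv d * (h * L + h + 1 / L) * N ^ 2) + d * (16 * (1 / L) * N ^ 2) := by
    nlinarith
  refine f.trans ?_
  have hd0 : (0:ℝ) ≤ d := by positivity
  have c1 : 90 ≤ Kv d := by unfold Kv; nlinarith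
  have c2 : d * 16 ≤ Kv d := by unfold Kv; nlinarith
  have c3 : 0 ≤ Kv d := by unfold Kv; positivity
  have q1 : 0 ≤ h * L * N ^ 2 := by positivity
  have q2 : 0 ≤ h * N ^ 2 := by positivity
  have q3 : 0 ≤ 1 / L * N ^ 2 := by positivity
  nlinarith [mul_le_mul_of_nonneg_right c1 q2, mul_le_mul_of_nonneg_right c2 q3, mul_nonneg c3 q1]
end

section
variable {d : ℕ}

lemma fourier_mul_inv {χ : Rd d → ℂ} (hχ : Integrable χ volume) {U : Rd d → ℂ} (hU : Integrable U volume) (ξ : Rd d) :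
    𝓕 (fun x => χ x * 𝓕⁻ U x) ξ = ∫ η, U η * 𝓕 χ (ξ - η) := by
  have hG : Integrable (fun x : Rd d => 𝐞 (-⟪x, ξ⟫) • χ x) volume :=
    (Real.fourierIntegral_convergent_iff ξ).2 hχ
  have h := VectorFourier.integral_fourierIntegral_smul_eq_flip (μ := (volume : Measure (Rd d)))
    (ν := (volume : Measure (Rd d))) (L := innerₗ (Rd d)) Real.continuous_fourierChar continuous_inner hU.comp_neg hG
  rw [Real.fourier_eq]
  have e1 : ∀ x : Rd d, 𝐞 (-⟪x, ξ⟫) • (χ x * 𝓕⁻ U x) =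
      VectorFourier.fourierIntegral 𝐞 volume (innerₗ (Rd d)) (fun y => U (-y)) x • (𝐞 (-⟪x, ξ⟫) • χ x) := by
    intro x
    have : 𝓕⁻ U x = VectorFourier.fourierIntegral 𝐞 volume (innerₗ (Rd d)) (fun y => U (-y)) x := by
      rw [Real.fourierInv_eq_fourier_comp_neg]; rfl
    rw [← this]
    simp only [Circle.smul_def, smul_eq_mul]; ring
  simp_rw [e1]
  rw [h, ← integral_neg_eq_self]
  refine integral_congr_ae (Eventually.of_forall fun η => ?_)
  simp only [neg_neg, smul_eq_mul]
  congr 1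
  rw [Real.fourier_eq]
  simp only [VectorFourier.fourierIntegral]
  refine integral_congr_ae (Eventually.of_forall fun x => ?_)
  simp only [smul_smul, ← AddChar.map_add_eq_mul]
  congr 2
  simp only [LinearMap.flip_apply, innerₗ_apply_apply, inner_sub_right, inner_neg_right, real_inner_comm x]; ring

/-- Properties of the convolution kernel. -/
structure Ker (κ : Rd d → ℝ) : Prop where
  cont : Continuous κ
  nonneg : ∀ z, 0 ≤ κ z
  inv : ∀ A : Rd d ≃ₗᵢ[ℝ] Rd d, ∀ z, κ (A z) = κ z
  int : Integrable (fun z => κ z * (1 + ‖z‖ ^ 2) ^ 2) volume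
  one : ∫ z, κ z = 1
  supp : ∀ ξ, 2 < ‖ξ‖ → 𝓕 (fun x => (κ x : ℂ)) ξ = 0

lemma exists_ker (d : ℕ) : ∃ κ : Rd d → ℝ, Ker κ := by
  set f : Rd d → ℂ := fun x => ((Real.smoothTransition (1 - ‖x‖ ^ 2) : ℝ) : ℂ) with hf
  have hf0 : ∀ x, 1 < ‖x‖ → f x = 0 := by
    intro x hx
    simp only [hf]
    rw [Real.smoothTransition.zero_of_nonpos]; · simp
    nlinarith
  have hcs : HasCompactSupport f := by
    refine HasCompactSupport.intro (isCompact_closedBall (0 : Rd d) 1) fun x hx => hf0 x ?_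
    simpa using hx
  have hcd : ContDiff ℝ (⊤ : ℕ∞) f := by
    have : ContDiff ℝ (⊤ : ℕ∞) fun x : Rd d => Real.smoothTransition (1 - ‖x‖ ^ 2) :=
      Real.smoothTransition.contDiff.comp (contDiff_const.sub (contDiff_norm_sq ℝ))
    exact Complex.ofRealCLM.contDiff.comp this
  set ψ : SchwartzMap (Rd d) ℂ := hcs.toSchwartzMap hcd with hψ
  have hψf : ∀ x, ψ x = f x := fun x => rfl
  set w : SchwartzMap (Rd d) ℂ := 𝓕⁻ ψ with hw
  have hwf : ∀ x, w x = 𝓕⁻ f x := fun x => by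
    rw [hw, SchwartzMap.fourierInv_coe]; rfl
  have hFw : 𝓕 (w : Rd d → ℂ) = f := by
    have : 𝓕 w = ψ := by rw [hw]; exact FourierTransform.fourier_fourierInv_eq ψ
    rw [← SchwartzMap.fourier_coe, this]; rfl
  obtain ⟨M, hM⟩ : ∃ M : ℝ, ∀ x, ‖w x‖ ≤ M := ⟨_, SchwartzMap.norm_le_seminorm ℝ w⟩
  have hM0 : 0 ≤ M := (norm_nonneg _).trans (hM 0)
  have hkint : Integrable (fun z => ‖w z‖ ^ 2 * (1 + ‖z‖ ^ 2) ^ 2) volume := by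
    have i0 := w.integrable_pow_mul volume 0
    have i2 := w.integrable_pow_mul volume 2
    have i4 := w.integrable_pow_mul volume 4
    refine (((i0.add (i2.const_mul 2)).add i4).const_mul M).mono' ?_ (Eventually.of_forall fun z => ?_)
    · exact ((w.continuous.norm.pow 2).mul (by fun_prop)).aestronglyMeasurable
    · rw [Real.norm_of_nonneg (by positivity)]
      simp only [Pi.add_apply]
      have := hM z
      calc _ ≤ (M * ‖w z‖) * (1 + ‖z‖ ^ 2) ^ 2 := by
            gcongr; rw [sq]; gcongr
        _ = _ := by ring
  have hk1 : Integrable (fun z => ‖w z‖ ^ 2) volume := by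
    refine hkint.mono' (w.continuous.norm.pow 2).aestronglyMeasurable (Eventually.of_forall fun z => ?_)
    rw [Real.norm_of_nonneg (by positivity)]
    exact le_mul_of_one_le_right (by positivity) (one_le_pow₀ (by nlinarith [norm_nonneg z]))
  have hpos : 0 < ∫ z, ‖w z‖ ^ 2 := by
    refine lt_of_le_of_ne (integral_nonneg fun _ => by positivity) fun h0 => ?_
    have h1 := (integral_eq_zero_iff_of_nonneg (fun _ => by positivity) hk1).1 h0.symm
    have h2 : (fun z => ‖w z‖ ^ 2) = fun _ => (0:ℝ) :=
      (Continuous.ae_eq_iff_eq volume (w.continuous.norm.pow 2) continuous_const).1 h1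
    have h3 : (w : Rd d → ℂ) = fun _ => 0 := by
      funext x; have := congrFun h2 x; simpa using this
    have h4 : f 0 = 0 := by
      rw [← hFw, h3, Real.fourier_eq]; simp
    simp [hf] at h4
  set c := ∫ z, ‖w z‖ ^ 2 with hc
  refine ⟨fun z => c⁻¹ * ‖w z‖ ^ 2, ?_, ?_, ?_, ?_, ?_, ?_⟩
  · exact continuous_const.mul (w.continuous.norm.pow 2)
  · intro z; positivity
  · intro A z
    have : w (A z) = w z := by
      rw [hwf, hwf, ← Real.fourierInv_comp_linearIsometry]
      have : f ∘ A = f := by funext x; simp [hf]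
      rw [this]
    simp only [this]
  · simpa [mul_assoc] using hkint.const_mul c⁻¹
  · rw [integral_const_mul]; exact inv_mul_cancel₀ hpos.ne'
  · intro ξ hξ
    set χ : Rd d → ℂ := fun x => (c⁻¹ : ℂ) * (starRingEnd ℂ) (w x) with hχ
    have e1 : (fun x => ((c⁻¹ * ‖w x‖ ^ 2 : ℝ) : ℂ)) = fun x => χ x * 𝓕⁻ f x := by
      funext x
      rw [← hwf, hχ]
      simp only
      rw [mul_assoc, ← Complex.normSq_eq_conj_mul_self, Complex.normSq_eq_norm_sq]
      push_cast; ring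
    have hχi : Integrable χ volume := by
      refine Integrable.const_mul ?_ _
      exact (LinearIsometryEquiv.integrable_comp_iff Complex.conjLIE).2 w.integrable
    have hfi : Integrable f volume := ψ.integrable
    have e2 : ∀ ζ : Rd d, 𝓕 χ ζ = (c⁻¹ : ℂ) * (starRingEnd ℂ) (f (-ζ)) := by
      intro ζ
      rw [← hFw, ← Real.fourierInv_eq_fourier_neg, Real.fourier_eq, Real.fourierInv_eq, ← integral_conj, ← integral_const_mul]
      refine integral_congr_ae (Eventually.of_forall fun x => ?_)
      simp only [hχ, Circle.smul_def, smul_eq_mul, map_mul, AddChar.map_neg_eq_inv, Circle.coe_inv_eq_conj]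
      ring
    rw [e1, fourier_mul_inv hχi hfi]
    have e3 : ∀ η, f η * 𝓕 χ (ξ - η) = 0 := by
      intro η
      by_cases h : 1 < ‖η‖
      · rw [hf0 η h, zero_mul]
      · rw [e2, hf0 (-(ξ - η)), map_zero, mul_zero, mul_zero]
        rw [norm_neg]
        have := norm_sub_norm_le ξ η
        push Not at h
        linarith
    simp [e3]
end

section
variable {d : ℕ}

def al (e : Fin d → ℝ) (r : ℝ) (x : Rd d) : ℝ := √(Nf e x) / r

lemma Nf_cont (e : Fin d → ℝ) : Continuous (Nf e) := by unfold Nf; fun_prop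

lemma al_cont (e : Fin d → ℝ) (r : ℝ) : Continuous (al e r) := by
  unfold al
  exact (Real.continuous_sqrt.comp (Nf_cont e)).div_const r

def Pe (e : Fin d → ℝ) (x : Rd d) : Rd d := WithLp.toLp 2 (fun i => e i * x i)

lemma Pe_norm {e : Fin d → ℝ} (he : Blk e) (x : Rd d) : ‖Pe e x‖ = √(Nf e x) := by
  rw [EuclideanSpace.norm_eq, Nf]
  congr 1
  refine Finset.sum_congr rfl fun i _ => ?_
  simp only [Pe, Real.norm_eq_abs, sq_abs]
  linear_combination x i ^ 2 * he.sq i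

lemma Nf_le {e : Fin d → ℝ} (he : Blk e) (x : Rd d) : √(Nf e x) ≤ ‖x‖ := by
  rw [EuclideanSpace.norm_eq, Nf]
  apply Real.sqrt_le_sqrt
  refine Finset.sum_le_sum fun i _ => ?_
  rw [Real.norm_eq_abs, sq_abs]
  exact mul_le_of_le_one_left (by positivity) (he.le_one i)

lemma al_lip {e : Fin d → ℝ} (he : Blk e) {r : ℝ} (hr : 0 < r) (x z : Rd d) : |al e r (x - z) - al e r x| ≤ ‖z‖ / r := by
  have h1 : Pe e (x - z) - Pe e x = - Pe e z := by
    ext i; simp [Pe]; ring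
  rw [al, al, ← sub_div, abs_div, abs_of_pos hr]
  gcongr
  rw [← Pe_norm he, ← Pe_norm he]
  refine (abs_norm_sub_norm_le _ _).trans ?_
  rw [h1, norm_neg, Pe_norm he]
  exact Nf_le he z

lemma al_nonneg {e : Fin d → ℝ} {r : ℝ} (hr : 0 < r) (x : Rd d) : 0 ≤ al e r x := by unfold al; positivity

lemma Wf_al {e : Fin d → ℝ} (he : Blk e) {r : ℝ} (hr : 0 < r) (x : Rd d) :
    al e r x ≤ Wf e r x ∧ Wf e r x ≤ al e r x + 1 := by
  have h1 := Wf_sq he r x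
  have h2 := Wf_ge he r x
  have h3 := al_nonneg (e := e) hr x
  have h4 : al e r x ^ 2 = Nf e x / r ^ 2 := by rw [al, div_pow, Real.sq_sqrt (Nf_nonneg he x)]
  constructor <;> nlinarith

def Es (d k : ℕ) (r : ℝ) (n : ℤ × ℤ) : Set (Rd d) :=
  {y | ((n.1:ℝ) - 1 ≤ al (e1b d k) r y ∧ al (e1b d k) r y < n.1 + 2) ∧
    ((n.2:ℝ) - 1 ≤ al (e2b d k) r y ∧ al (e2b d k) r y < n.2 + 2)}

def E0 (d k : ℕ) (r : ℝ) (n : ℤ × ℤ) : Set (Rd d) :=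
  {y | ((n.1:ℝ) ≤ al (e1b d k) r y ∧ al (e1b d k) r y < n.1 + 1) ∧
    ((n.2:ℝ) ≤ al (e2b d k) r y ∧ al (e2b d k) r y < n.2 + 1)}

lemma Es_meas (k : ℕ) (r : ℝ) (n : ℤ × ℤ) : MeasurableSet (Es d k r n) := by
  have h1 := (al_cont (e1b d k) r).measurable
  have h2 := (al_cont (e2b d k) r).measurable
  exact ((measurableSet_le measurable_const h1).inter (measurableSet_lt h1 measurable_const)).inter
    ((measurableSet_le measurable_const h2).inter (measurableSet_lt h2 measurable_const))

lemma E0_meas (k : ℕ) (r : ℝ) (n : ℤ × ℤ) : MeasurableSet (E0 d k r n) := by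
  have h1 := (al_cont (e1b d k) r).measurable
  have h2 := (al_cont (e2b d k) r).measurable
  exact ((measurableSet_le measurable_const h1).inter (measurableSet_lt h1 measurable_const)).inter
    ((measurableSet_le measurable_const h2).inter (measurableSet_lt h2 measurable_const))

lemma Nf_e1 (k : ℕ) (x : Rd d) : Nf (e1b d k) x = blockSq d k x := by
  unfold Nf e1b blockSq
  exact Finset.sum_congr rfl fun i _ => by split_ifs <;> simp

lemma Nf_add (k : ℕ) (x : Rd d) : Nf (e1b d k) x + Nf (e2b d k) x = ‖x‖ ^ 2 := by
  rw [EuclideanSpace.norm_sq_eq, Nf, Nf, ← Finset.sum_add_distrib]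
  refine Finset.sum_congr rfl fun i _ => ?_
  unfold e1b e2b
  split_ifs <;> simp

lemma al_G {k : ℕ} {A : Rd d ≃ₗᵢ[ℝ] Rd d} (hA : IsG d k A) (r : ℝ) (x : Rd d) :
    al (e1b d k) r (A x) = al (e1b d k) r x ∧ al (e2b d k) r (A x) = al (e2b d k) r x := by
  have h1 : Nf (e1b d k) (A x) = Nf (e1b d k) x := by rw [Nf_e1, Nf_e1, hA]
  have h2 := Nf_add k (A x)
  rw [A.norm_map, ← Nf_add k x, h1] at h2
  have h3 : Nf (e2b d k) (A x) = Nf (e2b d k) x := by linarith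
  exact ⟨by rw [al, al, h1], by rw [al, al, h3]⟩

lemma Es_bdd (k : ℕ) {r : ℝ} (hr : 0 < r) (n : ℤ × ℤ) :
    Es d k r n ⊆ Metric.closedBall 0 (r * (n.1 + n.2 + 4)) := by
  intro y hy
  obtain ⟨⟨_, h1⟩, ⟨_, h2⟩⟩ := hy
  rw [mem_closedBall_zero_iff]
  have h3 := Nf_add k y
  rw [al, div_lt_iff₀ hr] at h1 h2
  have a1 := Nf_nonneg (e1b_blk d k) y
  have a2 := Nf_nonneg (e2b_blk d k) y
  have s1 := Real.sq_sqrt a1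
  have s2 := Real.sq_sqrt a2
  have p1 := Real.sqrt_nonneg (Nf (e1b d k) y)
  have p2 := Real.sqrt_nonneg (Nf (e2b d k) y)
  have h4 : ‖y‖ ≤ √(Nf (e1b d k) y) + √(Nf (e2b d k) y) := by
    refine abs_le_of_sq_le_sq' ?_ (by positivity) |>.2
    nlinarith
  nlinarith

lemma Es_count (k : ℕ) (r : ℝ) (F : Finset (ℤ × ℤ)) (y : Rd d) :
    ∑ n ∈ F, (Es d k r n).indicator (fun _ => (1:ℝ)) y ≤ 9 := by
  classical
  simp only [Set.indicator_apply]
  rw [Finset.sum_boole]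
  set α := al (e1b d k) r y with hα
  set β := al (e2b d k) r y with hβ
  have hsub : F.filter (fun n => y ∈ Es d k r n) ⊆
      Finset.Icc (⌊α⌋ - 1) (⌊α⌋ + 1) ×ˢ Finset.Icc (⌊β⌋ - 1) (⌊β⌋ + 1) := by
    intro n hn
    obtain ⟨⟨h1, h2⟩, ⟨h3, h4⟩⟩ := (Finset.mem_filter.1 hn).2
    rw [← hα] at h1 h2
    rw [← hβ] at h3 h4
    have f1 := Int.floor_le α
    have f2 := Int.lt_floor_add_one α
    have f3 := Int.floor_le β
    have f4 := Int.lt_floor_add_one β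
    rw [Finset.mem_product, Finset.mem_Icc, Finset.mem_Icc]
    have g1 : (n.1:ℝ) < (⌊α⌋ + 2 : ℤ) := by push_cast; linarith
    have g2 : ((⌊α⌋ : ℤ) : ℝ) < (n.1 + 2 : ℤ) := by push_cast; linarith
    have g3 : (n.2:ℝ) < (⌊β⌋ + 2 : ℤ) := by push_cast; linarith
    have g4 : ((⌊β⌋ : ℤ) : ℝ) < (n.2 + 2 : ℤ) := by push_cast; linarith
    rw [Int.cast_lt] at g1 g2 g3 g4
    omega
  have := Finset.card_le_card hsub
  rw [Finset.card_product, Int.card_Icc, Int.card_Icc] at this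
  have h9 : (⌊α⌋ + 1 + 1 - (⌊α⌋ - 1)).toNat * (⌊β⌋ + 1 + 1 - (⌊β⌋ - 1)).toNat = 9 := by
    rw [show ⌊α⌋ + 1 + 1 - (⌊α⌋ - 1) = 3 by ring, show ⌊β⌋ + 1 + 1 - (⌊β⌋ - 1) = 3 by ring]; rfl
  rw [h9] at this
  exact_mod_cast this

/-- Properties of the cutoff functions. -/
structure Cut (d k : ℕ) (r C : ℝ) (X : ℤ × ℤ → Rd d → ℝ) : Prop where
  r_pos : 1 ≤ r
  C_pos : 0 ≤ C
  nonneg : ∀ n x, 0 ≤ X n x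
  le_one : ∀ n x, X n x ≤ 1
  half : ∀ n, ∀ x ∈ E0 d k r n, 1/2 ≤ X n x
  inv : ∀ A, IsG d k A → ∀ n x, X n (A x) = X n x
  int : ∀ n, Integrable (X n) volume
  le_om : ∀ n x, X n x ≤ C * om k r n.1 n.2 x
  supp : ∀ n ξ, 2 < ‖ξ‖ → 𝓕 (fun x => (X n x : ℂ)) ξ = 0
  count : ∀ (F : Finset (ℤ × ℤ)) x, ∑ n ∈ F, X n x ≤ 9

lemma exists_cut (d k : ℕ) : ∃ (r C : ℝ) (X : ℤ × ℤ → Rd d → ℝ), Cut d k r C X := by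
  obtain ⟨κ, hκ⟩ := exists_ker d
  set J := ∫ z, κ z * (1 + ‖z‖ ^ 2) ^ 2 with hJ
  have hκi : Integrable κ volume := by
    refine hκ.int.mono' hκ.cont.aestronglyMeasurable (Eventually.of_forall fun z => ?_)
    rw [Real.norm_of_nonneg (hκ.nonneg z)]
    exact le_mul_of_one_le_right (hκ.nonneg z) (one_le_pow₀ (by nlinarith [norm_nonneg z]))
  have hJ1 : 1 ≤ J := by
    rw [← hκ.one]
    refine integral_mono hκi hκ.int fun z => ?_
    exact le_mul_of_one_le_right (hκ.nonneg z) (one_le_pow₀ (by nlinarith [norm_nonneg z]))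
  set r := 2 * J with hr
  have hr1 : 1 ≤ r := by linarith
  have hr0 : 0 < r := by linarith
  set ind : ℤ × ℤ → Rd d → ℝ := fun n => (Es d k r n).indicator (fun _ => (1:ℝ)) with hind
  have hind0 : ∀ n y, 0 ≤ ind n y := fun n y => Set.indicator_nonneg (fun _ _ => zero_le_one) y
  have hind1 : ∀ n y, ind n y ≤ 1 := fun n y => Set.indicator_le_self' (fun _ _ => zero_le_one) y
  have hmeas : ∀ n, Measurable (ind n) := fun n => measurable_const.indicator (Es_meas k r n)
  have hint : ∀ n x, Integrable (fun z => κ z * ind n (x - z)) volume := by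
    intro n x
    refine hκi.mono' ?_ (Eventually.of_forall fun z => ?_)
    · exact (hκ.cont.measurable.mul ((hmeas n).comp (measurable_const.sub measurable_id))).aestronglyMeasurable
    · rw [Real.norm_of_nonneg (mul_nonneg (hκ.nonneg z) (hind0 _ _))]
      exact mul_le_of_le_one_right (hκ.nonneg z) (hind1 _ _)
  set X : ℤ × ℤ → Rd d → ℝ := fun n x => ∫ z, κ z * ind n (x - z) with hX
  have hf1 : Integrable (fun x => (κ x : ℂ)) volume := hκi.ofReal
  have hf2 : ∀ n, Integrable (fun x => (ind n x : ℂ)) volume := by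
    intro n
    refine Integrable.ofReal ?_
    refine (integrable_indicator_iff (Es_meas k r n)).2 ?_
    refine integrableOn_const ?_ (by simp)
    exact ((measure_mono (Es_bdd k hr0 n)).trans_lt measure_closedBall_lt_top).ne
  have hconv : ∀ n, (fun x => (X n x : ℂ)) =
      convolution (fun x => (κ x : ℂ)) (fun x => (ind n x : ℂ)) (ContinuousLinearMap.mul ℂ ℂ) volume := by
    intro n
    funext x
    simp only [hX, convolution, ContinuousLinearMap.mul_apply']
    refine (integral_ofReal (𝕜 := ℂ) (f := fun z => κ z * ind n (x - z))).symm.trans ?_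
    refine integral_congr_ae (Eventually.of_forall fun z => ?_)
    simp
  refine ⟨r, 361 * J, X, hr1, by linarith, ?_, ?_, ?_, ?_, ?_, ?_, ?_, ?_⟩
  · exact fun n x => integral_nonneg fun z => mul_nonneg (hκ.nonneg z) (hind0 _ _)
  · intro n x
    rw [← hκ.one]
    exact integral_mono (hint n x) hκi fun z => mul_le_of_le_one_right (hκ.nonneg z) (hind1 _ _)
  · intro n x hx
    have e1 : (1:ℝ)/2 = ∫ z, (κ z - κ z * (1 + ‖z‖ ^ 2) ^ 2 / (2 * J)) := by
      rw [integral_sub hκi (hκ.int.div_const _), integral_div, hκ.one, ← hJ]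
      field_simp; norm_num
    rw [e1]
    refine integral_mono (hκi.sub (hκ.int.div_const _)) (hint n x) fun z => ?_
    simp only
    have hk := hκ.nonneg z
    by_cases hz : x - z ∈ Es d k r n
    · simp only [hind, Set.indicator_of_mem hz, mul_one]
      have : 0 ≤ κ z * (1 + ‖z‖ ^ 2) ^ 2 / (2 * J) := by positivity
      linarith
    · simp only [hind, Set.indicator_of_notMem hz, mul_zero]
      have hzr : r < ‖z‖ := by
        by_contra hcon
        push Not at hcon
        apply hz
        have q : ‖z‖ / r ≤ 1 := by rw [div_le_one hr0]; exact hcon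
        have l1 := abs_le.1 ((al_lip (e1b_blk d k) hr0 x z).trans q)
        have l2 := abs_le.1 ((al_lip (e2b_blk d k) hr0 x z).trans q)
        obtain ⟨⟨h1, h2⟩, ⟨h3, h4⟩⟩ := hx
        refine ⟨⟨?_, ?_⟩, ⟨?_, ?_⟩⟩ <;> linarith
      have : κ z ≤ κ z * (1 + ‖z‖ ^ 2) ^ 2 / (2 * J) := by
        rw [le_div_iff₀ (by linarith)]
        refine mul_le_mul_of_nonneg_left ?_ hk
        rw [← hr]
        have : ‖z‖ ≤ 1 + ‖z‖ ^ 2 := by nlinarith [norm_nonneg z]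
        nlinarith [norm_nonneg z]
      linarith
  · intro A hA n x
    simp only [hX]
    have := (A.measurePreserving).integral_comp' (f := A.toMeasurableEquiv) (fun z => κ z * ind n (A x - z))
    rw [← this]
    refine integral_congr_ae (Eventually.of_forall fun z => ?_)
    change κ (A z) * ind n (A x - A z) = _
    rw [hκ.inv, ← map_sub]
    congr 1
    have := al_G hA r (x - z)
    simp only [hind, Set.indicator_apply, Es, Set.mem_ofPred_eq, this.1, this.2]
  · intro n
    have : Integrable (fun x => (X n x : ℂ)) volume := by
      rw [hconv n]
      exact hf1.integrable_convolution _ (hf2 n)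
    exact this.re
  · intro n x
    set W1 := Wf (e1b d k) r x
    set W2 := Wf (e2b d k) r x
    have e1 : om k r n.1 n.2 x = 1 / ((1 + (W1 - n.1) ^ 2) * (1 + (W2 - n.2) ^ 2)) := by
      simp only [om, mf]; rw [div_mul_div_comm, one_mul]
    rw [e1, mul_one_div, le_div_iff₀ (by positivity)]
    simp only [hX]
    rw [← integral_mul_const, hJ, ← integral_const_mul]
    refine integral_mono ((hint n x).mul_const _) (hκ.int.const_mul _) fun z => ?_
    have hk := hκ.nonneg z
    simp only
    by_cases hz : x - z ∈ Es d k r n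
    · simp only [hind, Set.indicator_of_mem hz, mul_one]
      obtain ⟨⟨h1, h2⟩, ⟨h3, h4⟩⟩ := hz
      have q : ‖z‖ / r ≤ ‖z‖ := div_le_self (norm_nonneg _) hr1
      have l1 := abs_le.1 ((al_lip (e1b_blk d k) hr0 x z).trans q)
      have l2 := abs_le.1 ((al_lip (e2b_blk d k) hr0 x z).trans q)
      have w1 := Wf_al (e1b_blk d k) hr0 x
      have w2 := Wf_al (e2b_blk d k) hr0 x
      have b1 : 1 + (W1 - n.1) ^ 2 ≤ 19 * (1 + ‖z‖ ^ 2) := by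
        have : (W1 - n.1) ^ 2 ≤ (‖z‖ + 3) ^ 2 := sq_le_sq' (by linarith) (by linarith)
        nlinarith [sq_nonneg (‖z‖ - 3)]
      have b2 : 1 + (W2 - n.2) ^ 2 ≤ 19 * (1 + ‖z‖ ^ 2) := by
        have : (W2 - n.2) ^ 2 ≤ (‖z‖ + 3) ^ 2 := sq_le_sq' (by linarith) (by linarith)
        nlinarith [sq_nonneg (‖z‖ - 3)]
      calc κ z * ((1 + (W1 - n.1) ^ 2) * (1 + (W2 - n.2) ^ 2)) ≤
          κ z * ((19 * (1 + ‖z‖ ^ 2)) * (19 * (1 + ‖z‖ ^ 2))) := by gcongr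
        _ = _ := by ring
    · simp only [hind, Set.indicator_of_notMem hz, mul_zero, zero_mul]
      positivity
  · intro n ξ hξ
    rw [hconv n, Real.fourier_mul_convolution_eq hf1 (hf2 n), hκ.supp ξ hξ, zero_mul]
  · intro F x
    simp only [hX]
    rw [← integral_finsetSum _ fun n _ => hint n x]
    calc _ ≤ ∫ z, κ z * 9 := by
          refine integral_mono (integrable_finsetSum _ fun n _ => hint n x) (hκi.mul_const 9) fun z => ?_
          simp only [← Finset.mul_sum]
          exact mul_le_mul_of_nonneg_left (Es_count k r F (x - z)) (hκ.nonneg z)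
      _ = 9 := by rw [integral_mul_const, hκ.one, one_mul]
end

section
variable {d : ℕ}

lemma fourier_dilate (f : Rd d → ℂ) {r : ℝ} (hr : 0 < r) (ξ : Rd d) :
    𝓕 (fun x => f (r • x)) ξ = ((r ^ d)⁻¹ : ℝ) * 𝓕 f (r⁻¹ • ξ) := by
  rw [Real.fourier_eq, Real.fourier_eq]
  have h := Measure.integral_comp_smul (volume : Measure (Rd d)) (fun ζ : Rd d => 𝐞 (-⟪ζ, r⁻¹ • ξ⟫) • f ζ) r
  simp only [finrank_euclideanSpace, Fintype.card_fin] at h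
  rw [abs_of_pos (by positivity)] at h
  rw [Complex.real_smul] at h
  rw [← h]
  congr 1; ext x
  rw [inner_smul_left, inner_smul_right]
  simp only [conj_trivial]
  rw [mul_inv_cancel_left₀ hr.ne']

lemma Wf_scale (e : Fin d → ℝ) {r μ : ℝ} (hμ : 0 < μ) (x : Rd d) :
    Wf e r (μ • x) = Wf e (r / μ) x := by
  unfold Wf
  have : Nf e (μ • x) = μ ^ 2 * Nf e x := by
    unfold Nf
    rw [Finset.mul_sum]
    refine Finset.sum_congr rfl fun i _ => ?_
    simp; ring
  rw [this, div_pow]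
  congr 2
  field_simp

lemma om_scale (k : ℕ) {r μ : ℝ} (hμ : 0 < μ) (a b : ℝ) (x : Rd d) :
    om k r a b (μ • x) = om k (r / μ) a b x := by
  unfold om
  rw [Wf_scale _ hμ, Wf_scale _ hμ]

variable {k : ℕ} {r Cc : ℝ} {X : ℤ × ℤ → Rd d → ℝ}

lemma piece_mem (hX : Cut d k r Cc X) {U : Rd d → ℂ} (hU : Good U) {μ : ℝ} (hμ : 0 < μ) (n : ℤ × ℤ) {p : ℝ} (hp : 2 ≤ p) :
    Integrable (fun x => (X n (μ • x) : ℂ)) volume ∧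
    Integrable (fun x => (X n (μ • x) : ℂ) * 𝓕⁻ U x) volume ∧
    MemLp (fun x => (X n (μ • x) : ℂ) * 𝓕⁻ U x) 2 volume ∧
    MemLp (fun x => (X n (μ • x) : ℂ) * 𝓕⁻ U x) (ENNReal.ofReal p) volume := by
  have hi1 : Integrable (fun x => X n (μ • x)) volume := (hX.int n).comp_smul hμ.ne'
  have hi2 : Integrable (fun x => (X n (μ • x) : ℂ)) volume := hi1.ofReal
  have hle : ∀ x, ‖(X n (μ • x) : ℂ) * 𝓕⁻ U x‖ ≤ ‖𝓕⁻ U x‖ := by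
    intro x
    rw [norm_mul, Complex.norm_real, Real.norm_of_nonneg (hX.nonneg _ _)]
    exact mul_le_of_le_one_left (norm_nonneg _) (hX.le_one _ _)
  have hm : AEStronglyMeasurable (fun x => (X n (μ • x) : ℂ) * 𝓕⁻ U x) volume :=
    hi2.1.mul hU.cont.aestronglyMeasurable
  refine ⟨hi2, ?_, hU.memLp_two.mono hm (Eventually.of_forall hle), (hU.memLp hp).mono hm (Eventually.of_forall hle)⟩
  exact hi2.mul_bdd hU.cont.aestronglyMeasurable (Eventually.of_forall fun x => Good.bound x)

lemma piece_good (hX : Cut d k r Cc X) {U : Rd d → ℂ} (hU : Good U) {t δ : ℝ} (ht : 0 < t)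
    (hδ : δ ≤ 1/2) (hs : ∀ ξ, U ξ ≠ 0 → |‖ξ‖ - 1| ≤ δ * t) (n : ℤ × ℤ) :
    (∀ ξ, 𝓕 (fun x => (X n ((t/4) • x) : ℂ) * 𝓕⁻ U x) ξ ≠ 0 → |‖ξ‖ - 1| ≤ t) ∧
    Good (𝓕 (fun x => (X n ((t/4) • x) : ℂ) * 𝓕⁻ U x)) := by
  have hμ : 0 < t / 4 := by positivity
  obtain ⟨h1, h2, -, -⟩ := piece_mem hX hU hμ n (le_refl (2:ℝ))
  have hsup : ∀ ξ, t < |‖ξ‖ - 1| → 𝓕 (fun x => (X n ((t/4) • x) : ℂ) * 𝓕⁻ U x) ξ = 0 := by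
    intro ξ hξ
    rw [fourier_mul_inv h1 hU.integrable]
    refine integral_eq_zero_of_ae (Eventually.of_forall fun η => ?_)
    by_cases hη : U η = 0
    · simp [hη]
    have h3 := hs η hη
    have h4 : t / 2 < ‖ξ - η‖ := by
      have a1 := abs_norm_sub_norm_le ξ η
      have a2 : |‖ξ‖ - 1| ≤ |‖ξ‖ - ‖η‖| + |‖η‖ - 1| := by
        have := abs_add_le (‖ξ‖ - ‖η‖) (‖η‖ - 1)
        rwa [show ‖ξ‖ - ‖η‖ + (‖η‖ - 1) = ‖ξ‖ - 1 by ring] at this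
      nlinarith
    have h5 := fourier_dilate (fun x => (X n x : ℂ)) hμ (ξ - η)
    have h6 : 𝓕 (fun x => (X n x : ℂ)) ((t/4)⁻¹ • (ξ - η)) = 0 := by
      refine hX.supp n _ ?_
      rw [norm_smul, norm_inv, Real.norm_of_nonneg hμ.le, inv_mul_eq_div, lt_div_iff₀ hμ]
      linarith
    simp only [h5, h6, Pi.zero_apply, mul_zero]
  have hc : Continuous (𝓕 (fun x => (X n ((t/4) • x) : ℂ) * 𝓕⁻ U x)) :=
    VectorFourier.fourierIntegral_continuous Real.continuous_fourierChar continuous_inner h2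
  have hb : ∀ ξ, 1 + t < ‖ξ‖ → 𝓕 (fun x => (X n ((t/4) • x) : ℂ) * 𝓕⁻ U x) ξ = 0 := by
    intro ξ hξ
    refine hsup ξ ?_
    rw [lt_abs]; left; linarith
  refine ⟨fun ξ h => ?_, ?_, 1 + t, hb⟩
  · by_contra h'
    exact h (hsup ξ (not_le.1 h'))
  · refine hc.memLp_of_hasCompactSupport ?_
    refine HasCompactSupport.intro (isCompact_closedBall (0 : Rd d) (1+t)) fun ξ hξ => hb ξ ?_
    simpa using hξ

lemma piece_bound (hX : Cut d k r Cc X) {s p C C' γ : ℝ} {g : ℝ → ℝ} (hg : SymB s C' g) (hp : 2 < p)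
    {U : Rd d → ℂ} (hU : Good U) (hi : AEInv k U) {t δ ε : ℝ} (hC : 0 ≤ C) (hγ : 0 < γ) (ht : 0 < t) (ht4 : t ≤ 1/4) (hε : ε = t ^ γ)
    (hgu : ∀ r, |r - 1| ≤ 1/2 → g r ≤ C * (ε + |r - 1| ^ γ))
    (hδ : δ ≤ 1/2) (hs : ∀ ξ, U ξ ≠ 0 → |‖ξ‖ - 1| ≤ δ * t) (n : ℤ × ℤ) :
    Rayleigh d s p g (GkSymmetric d k) * LpN p (fun x => (X n ((t/4) • x) : ℂ) * 𝓕⁻ U x) ^ 2 ≤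
      2 * C * ε * ∫ x, ‖(X n ((t/4) • x) : ℂ) * 𝓕⁻ U x‖ ^ 2 := by
  have hμ : 0 < t / 4 := by positivity
  obtain ⟨h1, h2, h3, h4⟩ := piece_mem hX hU hμ n hp.le
  obtain ⟨g1, g2⟩ := piece_good hX hU ht hδ hs n
  have hft := isFT_fourier h2
  have hsym : GkSymmetric d k (fun x => (X n ((t/4) • x) : ℂ) * 𝓕⁻ U x) := by
    rw [symm_iff]
    intro A hA x
    have := (symm_iff k _).1 hi.symm_inv A hA x
    rw [this, ← map_smul, hX.inv A hA]
  refine (rayleigh_le hg hp.le hsym h3 h4 g2 hft).trans ?_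
  rw [isFT_plancherel_int g2.mem h3 hft, ← integral_const_mul]
  refine integral_mono (g2.int_g hg) ((memLp_int_sq g2.mem).const_mul _) fun ξ => ?_
  simp only
  by_cases h0 : 𝓕 (fun x => (X n ((t/4) • x) : ℂ) * 𝓕⁻ U x) ξ = 0
  · rw [h0]; simp
  have h5 := g1 ξ h0
  have h6 := hgu ‖ξ‖ (by linarith)
  have h7 : |‖ξ‖ - 1| ^ γ ≤ ε := by
    rw [hε]; exact Real.rpow_le_rpow (abs_nonneg _) h5 hγ.le
  rw [mul_comm]
  have : g ‖ξ‖ ≤ 2 * C * ε := by nlinarith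
  gcongr

lemma piece_mass (hX : Cut d k r Cc X) {U : Rd d → ℂ} (hU : Good U) (hi : AEInv k U) {t δ : ℝ} (ht : 0 < t) (ht4 : t ≤ 1/4)
    (hδ0 : 0 < δ) (hδ : δ ≤ 1/2) (hs : ∀ ξ, U ξ ≠ 0 → |‖ξ‖ - 1| ≤ δ * t) (n : ℤ × ℤ) :
    ∫ x, ‖(X n ((t/4) • x) : ℂ) * 𝓕⁻ U x‖ ^ 2 ≤ Cc * (3 * Kv d * (4 * r + 1)) * (δ + t) * nn U ^ 2 := by
  have hμ : 0 < t / 4 := by positivity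
  obtain ⟨h1, h2, h3, h4⟩ := piece_mem hX hU hμ n (le_refl (2:ℝ))
  have hr := hX.r_pos
  have hCc := hX.C_pos
  have hL : 0 < r / (t/4) := by positivity
  have h5 := om_est hL n.1 n.2 hU hi (h := δ * t) (by positivity) (by nlinarith) hs
  obtain ⟨wc, wb⟩ := om_wt k (r/(t/4)) n.1 n.2 (d := d)
  have h6 : ∫ x, ‖(X n ((t/4) • x) : ℂ) * 𝓕⁻ U x‖ ^ 2 ≤ Cc * ∫ x, om k (r/(t/4)) n.1 n.2 x * ‖𝓕⁻ U x‖^2 := by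
    rw [← integral_const_mul]
    refine integral_mono (memLp_int_sq h3) (((memLp_int_sq hU.memLp_two).bdd_mul wc.aestronglyMeasurable (c := 1) (Eventually.of_forall wb)).const_mul _) fun x => ?_
    simp only
    rw [norm_mul, Complex.norm_real, Real.norm_of_nonneg (hX.nonneg _ _), mul_pow, ← mul_assoc]
    gcongr
    have a1 := hX.le_om n ((t/4) • x)
    rw [om_scale k hμ] at a1
    have a2 := hX.nonneg n ((t/4) • x)
    have a3 := hX.le_one n ((t/4) • x)
    nlinarith
  refine h6.trans ?_
  have hK : 0 ≤ Kv d := by unfold Kv; positivity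
  have h7 : δ * t * (r / (t/4)) + δ * t + 1 / (r / (t/4)) ≤ (4 * r + 1) * (δ + t) := by
    have b1 : δ * t * (r / (t/4)) = 4 * r * δ := by field_simp
    have b2 : 1 / (r / (t/4)) ≤ t := by
      rw [one_div_div, div_le_iff₀ (by linarith)]
      nlinarith
    rw [b1]
    nlinarith [mul_pos hδ0 ht]
  calc _ ≤ Cc * (3 * Kv d * (δ * t * (r / (t/4)) + δ * t + 1 / (r / (t/4))) * nn U ^ 2) := by gcongr
    _ ≤ Cc * (3 * Kv d * ((4 * r + 1) * (δ + t)) * nn U ^ 2) := by gcongr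
    _ = _ := by ring

lemma piece_sum (hX : Cut d k r Cc X) {U : Rd d → ℂ} (hU : Good U) {μ : ℝ} (hμ : 0 < μ) (F : Finset (ℤ × ℤ)) :
    ∑ n ∈ F, ∫ x, ‖(X n (μ • x) : ℂ) * 𝓕⁻ U x‖ ^ 2 ≤ 9 * nn U ^ 2 := by
  rw [← integral_finsetSum _ fun n _ => memLp_int_sq (piece_mem hX hU hμ n (le_refl (2:ℝ))).2.2.1]
  rw [nn_sq, ← hU.plancherel_int, ← integral_const_mul]
  refine integral_mono (integrable_finsetSum _ fun n _ => memLp_int_sq (piece_mem hX hU hμ n (le_refl (2:ℝ))).2.2.1)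
    ((memLp_int_sq hU.memLp_two).const_mul _) fun x => ?_
  simp only
  calc _ ≤ ∑ n ∈ F, X n (μ • x) * ‖𝓕⁻ U x‖ ^ 2 := by
        refine Finset.sum_le_sum fun n _ => ?_
        rw [norm_mul, Complex.norm_real, Real.norm_of_nonneg (hX.nonneg _ _), mul_pow]
        gcongr
        have a2 := hX.nonneg n (μ • x)
        have a3 := hX.le_one n (μ • x)
        nlinarith
    _ ≤ _ := by
        rw [← Finset.sum_mul]
        gcongr
        exact hX.count F _

lemma E0_cover (k : ℕ) (r : ℝ) (y : Rd d) : ∃ n, y ∈ E0 d k r n :=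
  ⟨(⌊al (e1b d k) r y⌋, ⌊al (e2b d k) r y⌋), ⟨Int.floor_le _, Int.lt_floor_add_one _⟩, ⟨Int.floor_le _, Int.lt_floor_add_one _⟩⟩

lemma E0_disj (k : ℕ) (r : ℝ) {n m : ℤ × ℤ} {y : Rd d} (hn : y ∈ E0 d k r n) (hm : y ∈ E0 d k r m) : n = m := by
  obtain ⟨⟨h1, h2⟩, ⟨h3, h4⟩⟩ := hn
  obtain ⟨⟨k1, k2⟩, ⟨k3, k4⟩⟩ := hm
  have a1 : (⌊al (e1b d k) r y⌋ : ℤ) = n.1 := Int.floor_eq_iff.2 ⟨h1, h2⟩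
  have a2 : (⌊al (e1b d k) r y⌋ : ℤ) = m.1 := Int.floor_eq_iff.2 ⟨k1, k2⟩
  have a3 : (⌊al (e2b d k) r y⌋ : ℤ) = n.2 := Int.floor_eq_iff.2 ⟨h3, h4⟩
  have a4 : (⌊al (e2b d k) r y⌋ : ℤ) = m.2 := Int.floor_eq_iff.2 ⟨k3, k4⟩
  exact Prod.ext (a1.symm.trans a2) (a3.symm.trans a4)

end

section
variable {d : ℕ} {k : ℕ} {r Cc : ℝ} {X : ℤ × ℤ → Rd d → ℝ}

lemma sq_rpow_half {x p : ℝ} (hx : 0 ≤ x) : (x ^ 2) ^ (p / 2) = x ^ p := by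
  rw [← Real.rpow_natCast x 2, ← Real.rpow_mul hx]; congr 1; push_cast; ring

lemma near_cut (hX : Cut d k r Cc X) {s p c C C' γ : ℝ} {g : ℝ → ℝ} (hg : SymB s C' g) (hp : 2 < p)
    {U : Rd d → ℂ} (hU : Good U) (hi : AEInv k U) {t δ ε : ℝ} (hc : 0 < c) (hC : 0 < C) (hγ : 0 < γ) (ht : 0 < t)
    (ht4 : t ≤ 1/4) (hε : ε = t ^ γ)
    (hgl : ∀ r, |r - 1| ≤ 1/2 → c * (ε + |r - 1| ^ γ) ≤ g r)
    (hgu : ∀ r, |r - 1| ≤ 1/2 → g r ≤ C * (ε + |r - 1| ^ γ))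
    (hδ0 : 0 < δ) (hδ : δ ≤ 1/2) (hs : ∀ ξ, U ξ ≠ 0 → |‖ξ‖ - 1| ≤ δ * t)
    (hR : 0 < Rayleigh d s p g (GkSymmetric d k)) :
    Rayleigh d s p g (GkSymmetric d k) * LpN p (𝓕⁻ U) ^ 2 ≤
      72 * C / c * (Cc * (3 * Kv d * (4 * r + 1)) * (δ + t)) ^ (1 - 2 / p) * ∫ ξ, ‖U ξ‖ ^ 2 * g ‖ξ‖ := by
  have hμ : 0 < t / 4 := by positivity
  have hp0 : 0 < p := by linarith
  have hε0 : 0 < ε := by rw [hε]; positivity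
  set R := Rayleigh d s p g (GkSymmetric d k) with hRdef
  set η := Cc * (3 * Kv d * (4 * r + 1)) * (δ + t) with hη
  have hη0 : 0 ≤ η := by
    have hK : 0 ≤ Kv d := by unfold Kv; positivity
    have := hX.r_pos
    have := hX.C_pos
    positivity
  set M := nn U ^ 2 with hM
  have hM0 : 0 ≤ M := by positivity
  set K := 2 * C * ε / R with hK
  have hK0 : 0 < K := by positivity
  set N : ℤ × ℤ → ℝ := fun n => ∫ x, ‖(X n ((t/4) • x) : ℂ) * 𝓕⁻ U x‖ ^ 2 with hN
  have hN0 : ∀ n, 0 ≤ N n := fun n => integral_nonneg fun x => by positivity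
  have hN1 : ∀ n, N n ≤ η * M := fun n => piece_mass hX hU hi ht ht4 hδ0 hδ hs n
  have hN2 : ∀ F : Finset (ℤ × ℤ), ∑ n ∈ F, N n ≤ 9 * M := fun F => piece_sum hX hU hμ F
  have hup := hU.memLp hp.le
  have hint : Integrable (fun x => ‖𝓕⁻ U x‖ ^ p) volume := hU.int_rpow hp.le
  set E : ℤ × ℤ → Set (Rd d) := fun n => {x | (t/4) • x ∈ E0 d k r n} with hE
  have hEm : ∀ n, MeasurableSet (E n) := fun n => measurable_const_smul (t/4) (E0_meas k r n)
  have hEd : Pairwise (Function.onFun Disjoint E) := by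
    intro n m hnm
    rw [Function.onFun, Set.disjoint_left]
    intro x h1 h2
    exact hnm (E0_disj k r h1 h2)
  have hEu : ⋃ n, E n = Set.univ := by
    rw [Set.eq_univ_iff_forall]
    intro x
    obtain ⟨n, hn⟩ := E0_cover k r ((t/4) • x)
    exact Set.mem_iUnion.2 ⟨n, hn⟩
  have hsum := hasSum_integral_iUnion (μ := volume) (f := fun x => ‖𝓕⁻ U x‖ ^ p) hEm hEd hint.integrableOn
  rw [hEu, setIntegral_univ] at hsum
  have hpc : ∀ n, ∫ x in E n, ‖𝓕⁻ U x‖ ^ p ≤ 2 ^ p * ((K * (η * M)) ^ (p/2 - 1) * (K * N n)) := by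
    intro n
    obtain ⟨h1, h2, h3, h4⟩ := piece_mem hX hU hμ n hp.le
    have hb := piece_bound hX hg hp hU hi hC.le hγ ht ht4 hε hgu hδ hs n
    have hpi : Integrable (fun x => ‖(X n ((t/4) • x) : ℂ) * 𝓕⁻ U x‖ ^ p) volume := by
      have := h4.integrable_norm_rpow (by simp; linarith) (by simp)
      rwa [ENNReal.toReal_ofReal hp0.le] at this
    have a1 : ∫ x in E n, ‖𝓕⁻ U x‖ ^ p ≤ 2 ^ p * LpN p (fun x => (X n ((t/4) • x) : ℂ) * 𝓕⁻ U x) ^ p := by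
      rw [LpN_rpow hp.le h4, ← integral_const_mul]
      refine (setIntegral_mono_on hint.integrableOn (hpi.const_mul _).integrableOn (hEm n) fun x hx => ?_).trans
        (setIntegral_le_integral (hpi.const_mul _) (Eventually.of_forall fun x => by positivity))
      rw [← Real.mul_rpow (by norm_num) (norm_nonneg _)]
      refine Real.rpow_le_rpow (norm_nonneg _) ?_ hp0.le
      rw [norm_mul, Complex.norm_real, Real.norm_of_nonneg (hX.nonneg _ _)]
      have := hX.half n _ hx
      nlinarith [norm_nonneg (𝓕⁻ U x)]
    refine a1.trans ?_
    have hKN : 0 ≤ K * N n := mul_nonneg hK0.le (hN0 n)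
    have a2 : LpN p (fun x => (X n ((t/4) • x) : ℂ) * 𝓕⁻ U x) ^ 2 ≤ K * N n := by
      rw [hK, div_mul_eq_mul_div, le_div_iff₀ hR]
      linarith
    have a3 : LpN p (fun x => (X n ((t/4) • x) : ℂ) * 𝓕⁻ U x) ^ p ≤ (K * N n) ^ (p/2) := by
      rw [← sq_rpow_half (LpN_nonneg _ _)]
      exact Real.rpow_le_rpow (by positivity) a2 (by positivity)
    have a4 : (K * N n) ^ (p/2) ≤ (K * (η * M)) ^ (p/2 - 1) * (K * N n) := by
      have : (K * N n) ^ (p/2) = (K * N n) ^ (p/2 - 1) * (K * N n) := by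
        rw [← Real.rpow_add_one' hKN (by linarith)]; congr 1; ring
      rw [this]
      gcongr
      · linarith
      · exact hN1 n
    gcongr
    exact a3.trans a4
  have hT : ∫ x, ‖𝓕⁻ U x‖ ^ p ≤ 2 ^ p * ((K * (η * M)) ^ (p/2 - 1) * (K * (9 * M))) := by
    rw [← hsum.tsum_eq]
    refine hsum.summable.tsum_le_of_sum_le fun F => ?_
    calc _ ≤ ∑ n ∈ F, 2 ^ p * ((K * (η * M)) ^ (p/2 - 1) * (K * N n)) := Finset.sum_le_sum fun n _ => hpc n
      _ = 2 ^ p * ((K * (η * M)) ^ (p/2 - 1) * (K * ∑ n ∈ F, N n)) := by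
        rw [← Finset.mul_sum, ← Finset.mul_sum, ← Finset.mul_sum]
      _ ≤ _ := by
        gcongr
        exact hN2 F
  have hfin : LpN p (𝓕⁻ U) ^ 2 ≤ 36 * K * η ^ (1 - 2/p) * M := by
    have hpp : 0 < p / 2 := by positivity
    rw [← Real.rpow_le_rpow_iff (by positivity) (by positivity) hpp, sq_rpow_half (LpN_nonneg _ _), LpN_rpow hp.le hup]
    refine hT.trans ?_
    have e1 : (K * (η * M)) ^ (p/2 - 1) * (K * (9 * M)) = 9 * (K ^ (p/2) * (η ^ (p/2 - 1) * M ^ (p/2))) := by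
      have f1 : K ^ (p/2) = K ^ (p/2 - 1) * K := by
        rw [← Real.rpow_add_one' hK0.le (by linarith)]; congr 1; ring
      have f2 : M ^ (p/2) = M ^ (p/2 - 1) * M := by
        rw [← Real.rpow_add_one' hM0 (by linarith)]; congr 1; ring
      rw [Real.mul_rpow hK0.le (by positivity), Real.mul_rpow hη0 hM0, f1, f2]; ring
    have e2 : (36 * K * η ^ (1 - 2/p) * M) ^ (p/2) = 6 ^ p * (K ^ (p/2) * (η ^ (p/2 - 1) * M ^ (p/2))) := by
      rw [Real.mul_rpow (by positivity) hM0, Real.mul_rpow (by positivity) (by positivity), Real.mul_rpow (by norm_num) hK0.le,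
        ← Real.rpow_mul hη0, show (36:ℝ) = 6 ^ 2 by norm_num, sq_rpow_half (by norm_num)]
      rw [show (1 - 2/p) * (p/2) = p/2 - 1 by field_simp]
      ring
    rw [e1, e2, ← mul_assoc]
    gcongr
    have : (9:ℝ) ≤ 3 ^ p := by
      have := Real.rpow_le_rpow_of_exponent_le (x := 3) (by norm_num) hp.le
      norm_num at this; exact this
    rw [show (6:ℝ) = 2 * 3 by norm_num, Real.mul_rpow (by norm_num) (by norm_num)]
    gcongr
  have hq : c * ε * M ≤ ∫ ξ, ‖U ξ‖ ^ 2 * g ‖ξ‖ := by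
    rw [hM, nn_sq, ← integral_const_mul]
    refine integral_mono ((memLp_int_sq hU.mem).const_mul _) (hU.int_g hg) fun ξ => ?_
    simp only
    by_cases h0 : U ξ = 0
    · simp [h0]
    have h1 := hs ξ h0
    have h2 := hgl ‖ξ‖ (by nlinarith)
    have h3 : 0 ≤ |‖ξ‖ - 1| ^ γ := by positivity
    rw [mul_comm]
    gcongr
    nlinarith
  calc R * LpN p (𝓕⁻ U) ^ 2 ≤ R * (36 * K * η ^ (1 - 2/p) * M) := by gcongr
    _ = 72 * C / c * η ^ (1 - 2/p) * (c * ε * M) := by rw [hK]; field_simp; ring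
    _ ≤ _ := by gcongr

end

section
variable {d : ℕ} {k : ℕ}

/-- The data needed on the Fourier side. -/
structure Dat (k : ℕ) (g : ℝ → ℝ) (U : Rd d → ℂ) : Prop where
  mem : MemLp U 2 volume
  inv : AEInv k U
  int : Integrable (fun ξ => ‖U ξ‖ ^ 2 * g ‖ξ‖) volume

lemma indicator_sq_mul (S : Set (Rd d)) (U : Rd d → ℂ) (g : ℝ → ℝ) (ξ : Rd d) :
    ‖S.indicator U ξ‖ ^ 2 * g ‖ξ‖ = S.indicator (fun ξ => ‖U ξ‖ ^ 2 * g ‖ξ‖) ξ := by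
  by_cases h : ξ ∈ S <;> simp [h]

lemma rad_meas {T : Set ℝ} (hT : MeasurableSet T) : MeasurableSet {ξ : Rd d | ‖ξ‖ ∈ T} := measurable_norm hT

lemma Dat.ind {g : ℝ → ℝ} {U : Rd d → ℂ} (h : Dat k g U) {T : Set ℝ} (hT : MeasurableSet T) :
    Dat k g ({ξ : Rd d | ‖ξ‖ ∈ T}.indicator U) := by
  refine ⟨h.mem.indicator (rad_meas hT), h.inv.indicator T, ?_⟩
  simp_rw [indicator_sq_mul]
  exact h.int.indicator (rad_meas hT)

lemma Dat.split {p : ℝ} (hp : 2 ≤ p) {g : ℝ → ℝ} (hg : ∀ r, 0 < g r) {U : Rd d → ℂ} (h : Dat k g U) {T : Set ℝ} (hT : MeasurableSet T)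
    {B1 B2 : ℝ} (hB1 : 0 ≤ B1) (hB2 : 0 ≤ B2) {Q : ℝ → Prop} (hQ : ∀ ξ, U ξ ≠ 0 → Q ‖ξ‖)
    (h1 : ∀ V : Rd d → ℂ, Dat k g V → (∀ ξ, V ξ ≠ 0 → Q ‖ξ‖ ∧ ‖ξ‖ ∈ T) → Bd p (fun ξ => g ‖ξ‖) B1 V)
    (h2 : ∀ V : Rd d → ℂ, Dat k g V → (∀ ξ, V ξ ≠ 0 → Q ‖ξ‖ ∧ ‖ξ‖ ∉ T) → Bd p (fun ξ => g ‖ξ‖) B2 V) :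
    Bd p (fun ξ => g ‖ξ‖) (B1 + B2) U := by
  refine Bd.split hp (fun ξ => (hg _).le) hB1 hB2 h.mem h.int (rad_meas hT) (h1 _ (h.ind hT) ?_) (h2 _ (h.ind hT.compl) ?_)
  · intro ξ hξ
    have := Set.mem_of_indicator_ne_zero hξ
    rw [Set.indicator_of_mem this] at hξ
    exact ⟨hQ ξ hξ, this⟩
  · intro ξ hξ
    have : ξ ∈ {ξ : Rd d | ‖ξ‖ ∈ T}ᶜ := Set.mem_of_indicator_ne_zero hξ
    rw [Set.indicator_of_mem this] at hξ
    exact ⟨hQ ξ hξ, this⟩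

lemma tau_nonneg (γ a : ℝ) : 0 ≤ tauF γ a := tsum_nonneg fun j => by split_ifs <;> positivity

lemma w_bound (hd : 0 < d) (k : ℕ) {s γ p c C : ℝ} (hs : 0 < s) (hγ : 1 < γ) (hp : 2 < p)
    (hps : s < (d : ℝ) / 2 → p < 2 * (d : ℝ) / ((d : ℝ) - 2 * s)) (hc : 0 < c) (hC : 0 < C) :
    ∃ a1 a2 a3 H : ℝ, 0 ≤ a1 ∧ 0 ≤ a2 ∧ 0 ≤ a3 ∧ 0 ≤ H ∧ ∀ (C' : ℝ) (g : ℝ → ℝ) (t ε δ : ℝ), SymB s C' g → 0 < t → t ≤ 1/4 → ε = t ^ γ →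
      0 < δ → δ ≤ 1/2 →
      (∀ r : ℝ, |r - 1| ≤ 1/2 → c * (ε + |r - 1| ^ γ) ≤ g r ∧ g r ≤ C * (ε + |r - 1| ^ γ)) →
      (∀ r : ℝ, 1/2 ≤ |r - 1| → c * (1 + |r| ^ (2*s)) ≤ g r) →
      0 < Rayleigh d s p g (GkSymmetric d k) →
      ∀ U : Rd d → ℂ, Dat k g U → (∀ ξ, U ξ ≠ 0 → |‖ξ‖ - 1| < δ * t ∨ δ⁻¹ * t < |‖ξ‖ - 1|) →
      ∀ u : Rd d → ℂ, MemLp u 2 volume → IsFT U u →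
      Rayleigh d s p g (GkSymmetric d k) * LpN p u ^ 2 ≤
        (a1 * (H * (δ + t)) ^ (1 - 2/p) + a2 * tauF γ δ⁻¹ + a3 * t ^ (γ - 1)) * ∫ ξ, ‖U ξ‖ ^ 2 * g ‖ξ‖ := by
  obtain ⟨r, Cc, X, hX⟩ := exists_cut d k
  obtain ⟨C1, hC1, hout⟩ := outer_bound hd hs hp hc hps
  obtain ⟨C2, hC2, hup⟩ := rayleigh_upper (s := s) hd hp hγ hC
  set D := 2 ^ d * (C * (1 + 2 ^ γ)) / c with hD
  have hD0 : 0 < D := by positivity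
  have hr1 := hX.r_pos
  have hCc := hX.C_pos
  have hKv : 0 ≤ Kv d := by unfold Kv; positivity
  refine ⟨72 * C / c, 2 * D, C1 * C2, Cc * (3 * Kv d * (4 * r + 1)), by positivity, by positivity, by positivity, by positivity, ?_⟩
  intro C' g t ε δ hg ht ht4 hε hδ0 hδ hgb hgo hR U hU hsupp u hu hUu
  set R := Rayleigh d s p g (GkSymmetric d k) with hRdef
  set H := Cc * (3 * Kv d * (4 * r + 1)) with hH
  have hRup := hup k C' g t ε hg ht ht4 hε (fun r hr => (hgb r hr).2)
  set β1 := 72 * C / c * (H * (δ + t)) ^ (1 - 2/p) with hβ1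
  have hH0 : 0 ≤ H := by positivity
  have hβ10 : 0 ≤ β1 := by positivity
  have hτ := tau_nonneg γ δ⁻¹
  have hδi : 2 ≤ δ⁻¹ := by
    rw [le_inv_comm₀ (by norm_num) hδ0]; linarith
  have key : Bd p (fun ξ => g ‖ξ‖) (β1 / R + ((D / R * tauF γ δ⁻¹ + D / R * tauF γ δ⁻¹) + C1)) U := by
    refine Dat.split hp.le hg.pos hU (T := {ρ : ℝ | |ρ - 1| ≤ δ * t}) (measurableSet_le (by fun_prop) measurable_const)
      (by positivity) (by positivity) (Q := fun ρ => |ρ - 1| < δ * t ∨ δ⁻¹ * t < |ρ - 1|) hsupp ?_ ?_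
    · intro V hV hVs
      have hVG : Good V := ⟨hV.mem, 1 + δ * t, fun ξ hξ => by
        by_contra h0
        have h1 : |‖ξ‖ - 1| ≤ δ * t := (hVs ξ h0).2
        have := le_abs_self (‖ξ‖ - 1)
        linarith⟩
      refine Bd.of_good hp.le hVG ?_
      have := near_cut hX hg hp hVG hV.inv hc hC (by linarith) ht ht4 hε (fun r hr => (hgb r hr).1) (fun r hr => (hgb r hr).2)
        hδ0 hδ (fun ξ hξ => (hVs ξ hξ).2) hR
      rw [div_mul_eq_mul_div, le_div_iff₀ hR, mul_comm]
      exact this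
    · intro V hV hVs
      refine Dat.split hp.le hg.pos hV (T := {ρ : ℝ | |ρ - 1| ≤ 1/2}) (measurableSet_le (by fun_prop) measurable_const)
        (by positivity) (by positivity) (Q := fun ρ => δ⁻¹ * t < |ρ - 1|) ?_ ?_ ?_
      · intro ξ hξ
        obtain ⟨h1, h2⟩ := hVs ξ hξ
        have h2' : ¬ |‖ξ‖ - 1| ≤ δ * t := h2
        rcases h1 with h1 | h1
        · exact absurd h1.le h2'
        · exact h1
      · intro W hW hWs
        refine Dat.split hp.le hg.pos hW (T := {ρ : ℝ | 1 ≤ ρ}) (measurableSet_le measurable_const (by fun_prop))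
          (by positivity) (by positivity) (Q := fun ρ => δ⁻¹ * t < |ρ - 1| ∧ |ρ - 1| ≤ 1/2) hWs ?_ ?_
        · intro Z hZ hZs
          refine mid_side hg hp hγ hc hC ht ht4 hε hδi (Or.inl rfl) hgb hR hZ.mem hZ.inv hZ.int ?_
          intro ξ hξ
          obtain ⟨⟨h1, h2⟩, h3⟩ := hZs ξ hξ
          have h3' : 1 ≤ ‖ξ‖ := h3
          rw [abs_of_nonneg (by linarith)] at h1 h2
          rw [one_mul]; exact ⟨h1, h2⟩
        · intro Z hZ hZs
          refine mid_side hg hp hγ hc hC ht ht4 hε hδi (Or.inr rfl) hgb hR hZ.mem hZ.inv hZ.int ?_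
          intro ξ hξ
          obtain ⟨⟨h1, h2⟩, h3⟩ := hZs ξ hξ
          have h3' : ¬ 1 ≤ ‖ξ‖ := h3
          rw [abs_of_neg (by linarith)] at h1 h2
          constructor <;> linarith
      · intro W hW hWs
        refine hout g hg.pos hgo W hW.mem hW.int fun ξ hξ => ?_
        have h1 : ¬ |‖ξ‖ - 1| ≤ 1/2 := (hWs ξ hξ).2
        linarith
  obtain ⟨-, hb⟩ := key u hu hUu
  have hq : 0 ≤ ∫ ξ, ‖U ξ‖ ^ 2 * g ‖ξ‖ := integral_nonneg fun ξ => mul_nonneg (by positivity) (hg.pos _).le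
  calc R * LpN p u ^ 2 ≤ R * ((β1 / R + ((D / R * tauF γ δ⁻¹ + D / R * tauF γ δ⁻¹) + C1)) * ∫ ξ, ‖U ξ‖ ^ 2 * g ‖ξ‖) := by gcongr
    _ = (β1 + 2 * D * tauF γ δ⁻¹ + C1 * R) * ∫ ξ, ‖U ξ‖ ^ 2 * g ‖ξ‖ := by field_simp; ring
    _ ≤ (β1 + 2 * D * tauF γ δ⁻¹ + C1 * (C2 * t ^ (γ - 1))) * ∫ ξ, ‖U ξ‖ ^ 2 * g ‖ξ‖ := by gcongr
    _ = _ := by ring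

lemma final_real {R x y m qv qw β : ℝ} (hR : 0 < R) (hx : 0 ≤ x) (hy : 0 ≤ y) (hm : 0 < m) (hmx : m ≤ x + y)
    (hβ0 : 0 ≤ β) (hβ : β ≤ 1/2) (hq : R * m ^ 2 = qv + qw) (h1 : R * x ^ 2 ≤ qv) (h2 : R * y ^ 2 ≤ β * qw) :
    0 < x ∧ 0 < qv ∧ y / x ≤ 16 * β ∧ qw / qv ≤ 16 * β := by
  have h3 : qw ≤ R * (2 * x * y + y ^ 2) := by
    have : R * m ^ 2 ≤ R * (x + y) ^ 2 := by gcongr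
    nlinarith
  have h4 : R * y ^ 2 ≤ R * (β * (2 * x * y + y ^ 2)) := by nlinarith
  have h5 : y ^ 2 ≤ β * (2 * x * y + y ^ 2) := le_of_mul_le_mul_left h4 hR
  have h6 : y ≤ 4 * β * x := by
    rcases hy.eq_or_lt with h | h
    · rw [← h]; positivity
    · have : y * y ≤ y * (4 * β * x) := by nlinarith [sq_nonneg y]
      exact le_of_mul_le_mul_left this h
  have hx0 : 0 < x := by
    rcases hx.eq_or_lt with h | h
    · rw [← h] at h6 hmx; linarith
    · exact h
  have hv : 0 < qv := lt_of_lt_of_le (by positivity) h1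
  refine ⟨hx0, hv, ?_, ?_⟩
  · rw [div_le_iff₀ hx0]; nlinarith [mul_nonneg hβ0 hx]
  · rw [div_le_iff₀ hv]
    have a1 : 2 * x * y + y ^ 2 ≤ 16 * β * x ^ 2 := by
      have b1 : x * y ≤ x * (4 * β * x) := by gcongr
      have b2 : y * y ≤ (4 * β * x) * (4 * β * x) := by gcongr
      have b3 : β * β * x ^ 2 ≤ 1/2 * β * x ^ 2 := by gcongr
      nlinarith
    calc qw ≤ R * (16 * β * x ^ 2) := h3.trans (by gcongr)
      _ = 16 * β * (R * x ^ 2) := by ring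
      _ ≤ _ := by gcongr

end

/-- Theorem 1.4, `G_k`-symmetric case: Fourier concentration of
minimizers of `R^k_ε(p)` near the unit sphere: `‖w_ε‖_p/‖v_ε‖_p → 0` and
`q_ε(w_ε)/q_ε(v_ε) → 0` as `ε → 0⁺`. -/
theorem stmt5 (d k : ℕ) (hd : 2 ≤ d) (hk1 : 1 ≤ k) (hkd : k ≤ d - 1)
    (s γ p c C : ℝ)
    (hs : (d : ℝ) / ((d : ℝ) + 1) < s) (hγ : 1 < γ)
    (hp : 2 < p) (hps : s < (d : ℝ) / 2 → p < 2 * (d : ℝ) / ((d : ℝ) - 2 * s))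
    (hc : 0 < c) (hcC : c ≤ C)
    (g : ℝ → ℝ → ℝ) (hg : IsAdmissible s γ c C g)
    (δ : ℝ → ℝ) (hδpos : ∀ ε : ℝ, 0 < ε → 0 < δ ε)
    (hδ0 : Tendsto δ (𝓝[>] (0:ℝ)) (𝓝 0))
    (u v w : ℝ → HsFn d s)
    (hmin : ∀ ε ∈ Set.Ioo (0:ℝ) 1,
        GkSymmetric d k (u ε).toFun ∧
        ¬ (u ε).toFun =ᵐ[volume] (fun _ => (0 : ℂ)) ∧
        MemLp (u ε).toFun (ENNReal.ofReal p) volume ∧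
        qeps (g ε) (u ε) / LpN p (u ε).toFun ^ 2
          = Rayleigh d s p (g ε) (GkSymmetric d k))
    (hsplit : ∀ ε ∈ Set.Ioo (0:ℝ) 1,
        (u ε).toFun =ᵐ[volume] (fun x => (v ε).toFun x + (w ε).toFun x) ∧
        (v ε).ft =ᵐ[volume] (Aset d γ ε (δ ε)).indicator (u ε).ft ∧
        (w ε).ft =ᵐ[volume] ((Aset d γ ε (δ ε))ᶜ).indicator (u ε).ft ∧
        MemLp (v ε).toFun (ENNReal.ofReal p) volume ∧
        MemLp (w ε).toFun (ENNReal.ofReal p) volume) :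
    Tendsto (fun ε => LpN p (w ε).toFun / LpN p (v ε).toFun) (𝓝[>] (0:ℝ)) (𝓝 0) ∧
    Tendsto (fun ε => qeps (g ε) (w ε) / qeps (g ε) (v ε)) (𝓝[>] (0:ℝ)) (𝓝 0) ∧
    (∀ᶠ ε in 𝓝[>] (0:ℝ), ¬ (v ε).toFun =ᵐ[volume] (fun _ => (0 : ℂ))) := by
  have hd0 : 0 < d := by omega
  have hs0 : 0 < s := lt_of_le_of_lt (by positivity) hs
  have hC : 0 < C := by linarith
  have hγ0 : 0 < γ := by linarith
  have hp0 : 0 < p := by linarith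
  have hexp : 0 < 1 - 2 / p := by rw [sub_pos, div_lt_one hp0]; exact hp
  obtain ⟨a1, a2, a3, H, ha1, ha2, ha3, hH, hmain⟩ := w_bound hd0 k hs0 hγ hp hps hc hC
  set T : ℝ → ℝ := fun ε => ε ^ (1/γ) with hT
  set β : ℝ → ℝ := fun ε => a1 * (H * (δ ε + T ε)) ^ (1 - 2/p) + a2 * tauF γ (δ ε)⁻¹ + a3 * T ε ^ (γ - 1) with hβ
  have hpos : ∀ᶠ ε in 𝓝[>] (0:ℝ), 0 < ε := eventually_mem_nhdsWithin
  have hTt : Tendsto T (𝓝[>] (0:ℝ)) (𝓝 0) := by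
    have : Tendsto T (𝓝 (0:ℝ)) (𝓝 ((0:ℝ) ^ (1/γ))) :=
      (Real.continuousAt_rpow_const 0 (1/γ) (Or.inr (by positivity))).tendsto
    rw [Real.zero_rpow (by positivity)] at this
    exact this.mono_left nhdsWithin_le_nhds
  have hrp : ∀ (f : ℝ → ℝ) (e : ℝ), 0 < e → Tendsto f (𝓝[>] (0:ℝ)) (𝓝 0) →
      Tendsto (fun ε => f ε ^ e) (𝓝[>] (0:ℝ)) (𝓝 0) := by
    intro f e he hf
    have := hf.rpow_const (p := e) (Or.inr he.le)
    rwa [Real.zero_rpow he.ne'] at this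
  have hδi : Tendsto (fun ε => (δ ε)⁻¹) (𝓝[>] (0:ℝ)) atTop := by
    refine tendsto_inv_nhdsGT_zero.comp (tendsto_nhdsWithin_iff.2 ⟨hδ0, ?_⟩)
    filter_upwards [hpos] with ε h using hδpos ε h
  have hβt : Tendsto β (𝓝[>] (0:ℝ)) (𝓝 0) := by
    have e1 : Tendsto (fun ε => H * (δ ε + T ε)) (𝓝[>] (0:ℝ)) (𝓝 0) := by
      have := (hδ0.add hTt).const_mul H
      simpa using this
    have e2 := (hrp _ _ hexp e1).const_mul a1
    have e3 := ((tau_tendsto hγ).comp hδi).const_mul a2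
    have e4 := (hrp _ _ (sub_pos.2 hγ) hTt).const_mul a3
    have := (e2.add e3).add e4
    simpa using this
  have hev : ∀ᶠ ε in 𝓝[>] (0:ℝ), 0 < LpN p (v ε).toFun ∧ 0 < qeps (g ε) (v ε) ∧
      LpN p (w ε).toFun / LpN p (v ε).toFun ≤ 16 * β ε ∧ qeps (g ε) (w ε) / qeps (g ε) (v ε) ≤ 16 * β ε ∧
      0 ≤ qeps (g ε) (w ε) := by
    filter_upwards [hpos, hTt.eventually_le_const (show (0:ℝ) < 1/4 by norm_num),
      hδ0.eventually_le_const (show (0:ℝ) < 1/2 by norm_num), hβt.eventually_le_const (show (0:ℝ) < 1/2 by norm_num),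
      (tendsto_nhdsWithin_of_tendsto_nhds tendsto_id).eventually_lt_const (show (0:ℝ) < 1 by norm_num)]
      with ε hε0 hTε hδε hβε hε1
    have hεI : ε ∈ Set.Ioo (0:ℝ) 1 := ⟨hε0, hε1⟩
    have hδp := hδpos ε hε0
    have hTpos : 0 < T ε := Real.rpow_pos_of_pos hε0 _
    have hTγ : ε = T ε ^ γ := by
      simp only [hT]
      rw [← Real.rpow_mul hε0.le, one_div, inv_mul_cancel₀ hγ0.ne', Real.rpow_one]
    have hsym := symB_of_admissible hs0 hγ hc hcC hg hεI
    obtain ⟨m1, m2, m3, m4⟩ := hmin ε hεI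
    obtain ⟨s1, s2, s3, s4, s5⟩ := hsplit ε hεI
    obtain ⟨-, -, g3, g4⟩ := hg
    have hab : Measurable fun ρ : ℝ => |ρ - 1| := by fun_prop
    have hAr : ∃ S : Set ℝ, MeasurableSet S ∧ Aset d γ ε (δ ε) = {ξ : Rd d | ‖ξ‖ ∈ S} ∧
        S = {ρ : ℝ | δ ε * T ε ≤ |ρ - 1| ∧ |ρ - 1| ≤ (δ ε)⁻¹ * T ε} :=
      ⟨{ρ : ℝ | δ ε * T ε ≤ |ρ - 1| ∧ |ρ - 1| ≤ (δ ε)⁻¹ * T ε},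
        (measurableSet_le measurable_const hab).inter (measurableSet_le hab measurable_const), rfl, rfl⟩
    obtain ⟨S, hSm, hAS, hSdef⟩ := hAr
    have hAm : MeasurableSet (Aset d γ ε (δ ε)) := by rw [hAS]; exact rad_meas hSm
    have hD : Dat k (g ε) (u ε).ft :=
      ⟨(u ε).ft_memL2, aeInv_of_symm (u ε).ft_memL2 (u ε).isFT m1, hsym.int (u ε).ft_memL2.1 (u ε).memHs⟩
    have hDv := hD.ind hSm
    have hDw := hD.ind hSm.compl
    have hAc : {ξ : Rd d | ‖ξ‖ ∈ Sᶜ} = (Aset d γ ε (δ ε))ᶜ := by rw [hAS]; rfl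
    rw [← hAS] at hDv
    rw [hAc] at hDw
    have hPu := LpN_pos hp.le m3 m2
    have hqv : qeps (g ε) (v ε) = ∫ ξ, ‖(Aset d γ ε (δ ε)).indicator (u ε).ft ξ‖ ^ 2 * g ε ‖ξ‖ :=
      integral_congr_ae (by filter_upwards [s2] with ξ h; rw [h])
    have hqw : qeps (g ε) (w ε) = ∫ ξ, ‖(Aset d γ ε (δ ε))ᶜ.indicator (u ε).ft ξ‖ ^ 2 * g ε ‖ξ‖ :=
      integral_congr_ae (by filter_upwards [s3] with ξ h; rw [h])
    have hq0 : ∀ U : Rd d → ℂ, 0 ≤ ∫ ξ, ‖U ξ‖ ^ 2 * g ε ‖ξ‖ := fun U =>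
      integral_nonneg fun ξ => mul_nonneg (by positivity) (hsym.pos _).le
    have hqadd : qeps (g ε) (u ε) = qeps (g ε) (v ε) + qeps (g ε) (w ε) := by
      rw [hqv, hqw]
      simp_rw [indicator_sq_mul]
      rw [integral_indicator hAm, integral_indicator hAm.compl, integral_add_compl hAm hD.int]
      rfl
    have hRm : Rayleigh d s p (g ε) (GkSymmetric d k) * LpN p (u ε).toFun ^ 2 = qeps (g ε) (u ε) := by
      rw [← m4]; field_simp
    have hqu : 0 < qeps (g ε) (u ε) := by
      refine lt_of_le_of_ne (hq0 _) fun h0 => m2 ?_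
      have h1 := (integral_eq_zero_iff_of_nonneg (fun ξ => mul_nonneg (by positivity) (hsym.pos _).le) hD.int).1 h0.symm
      have h2 : (u ε).ft =ᵐ[volume] fun _ => (0:ℂ) := by
        filter_upwards [h1] with ξ hξ
        have := (hsym.pos ‖ξ‖).ne'
        simpa [this] using hξ
      exact isFT_unique_right2 ((u ε).isFT.congr h2 (Filter.EventuallyEq.refl _ _)) isFT_zero (u ε).memL2 MemLp.zero
    have hR : 0 < Rayleigh d s p (g ε) (GkSymmetric d k) := by
      rw [← m4]; positivity
    have hw := hmain (2 * C) (g ε) (T ε) ε (δ ε) hsym hTpos hTε hTγ hδp hδε (g4 ε hεI)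
      (fun r hr => (g3 ε hεI r hr).1) hR _ hDw (by
        intro ξ hξ
        have h1 : ξ ∈ (Aset d γ ε (δ ε))ᶜ := Set.mem_of_indicator_ne_zero hξ
        by_contra h2
        rw [not_or, not_lt, not_lt] at h2
        exact h1 h2) _ (w ε).memL2 ((w ε).isFT.congr s3 (Filter.EventuallyEq.refl _ _))
    rw [← hqw] at hw
    have hvG : Good ((Aset d γ ε (δ ε)).indicator (u ε).ft) := ⟨hDv.mem, 1 + (δ ε)⁻¹ * T ε, fun ξ hξ => by
      by_contra h0
      have h1 : ξ ∈ Aset d γ ε (δ ε) := Set.mem_of_indicator_ne_zero h0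
      have h2 : |‖ξ‖ - 1| ≤ (δ ε)⁻¹ * T ε := h1.2
      have := le_abs_self (‖ξ‖ - 1)
      linarith⟩
    have hvR := rayleigh_good hsym hp.le hvG hDv.inv
    rw [← hqv, ← LpN_congr (hvG.ae_eq (v ε).memL2 ((v ε).isFT.congr s2 (Filter.EventuallyEq.refl _ _)))] at hvR
    have htri : LpN p (u ε).toFun ≤ LpN p (v ε).toFun + LpN p (w ε).toFun := by
      rw [LpN_congr s1]; exact LpN_add_le hp.le s4 s5
    have hβ0 : 0 ≤ β ε := by
      have := tau_nonneg γ (δ ε)⁻¹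
      simp only [hβ]
      positivity
    obtain ⟨r1, r2, r3, r4⟩ := final_real hR (LpN_nonneg _ _) (LpN_nonneg _ _) hPu htri hβ0 hβε (hRm.trans hqadd) hvR hw
    exact ⟨r1, r2, r3, r4, by rw [hqw]; exact hq0 _⟩
  have hβ16 : Tendsto (fun ε => 16 * β ε) (𝓝[>] (0:ℝ)) (𝓝 0) := by simpa using hβt.const_mul 16
  refine ⟨?_, ?_, ?_⟩
  · refine tendsto_of_tendsto_of_tendsto_of_le_of_le' tendsto_const_nhds hβ16 ?_ ?_
    · exact Eventually.of_forall fun ε => div_nonneg (LpN_nonneg _ _) (LpN_nonneg _ _)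
    · filter_upwards [hev] with ε h using h.2.2.1
  · refine tendsto_of_tendsto_of_tendsto_of_le_of_le' tendsto_const_nhds hβ16 ?_ ?_
    · filter_upwards [hev] with ε h using div_nonneg h.2.2.2.2 h.2.1.le
    · filter_upwards [hev] with ε h using h.2.2.2.1
  · filter_upwards [hev] with ε h h0
    have h1 := h.1
    rw [LpN_congr h0, LpN] at h1
    have h2 : (fun _ => 0 : Rd d → ℂ) = 0 := rfl
    rw [h2, eLpNorm_zero] at h1
    simp at h1
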